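/- arXiv:1803.01435 — 3 statements merged into one kernel-verified Lean document; each statement's English description precedes it below -/
import Mathlib

section
/- Let q be a prime power and suppose a, b, c ∈ F_q satisfy a ≠ 0 and b² − 4ac ≠ 0. If q > 4·W(q − 1)⁴, then there exists a primitive root g of F_q such that a·g² + b·g + c is also a primitive root of F_q. -/
/-- `W(m) = 2^{ω(m)}`, where `ω(m)` is the number of distinct prime divisors of `m`. -/
def W (m : ℕ) : ℕ := 2 ^ m.primeFactors.card

section

open Polynomial

/-- The coordinate ring `K[y, z] / (zⁿ - F(y))` of a Kummer curve. -/
abbrev KummerRing {K : Type*} [Field K] (F : K[X]) (n : ℕ) : Type _ :=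
  AdjoinRoot (X ^ n - C F : K[X][X])

namespace KummerRing

variable {K : Type*} [Field K] {F : K[X]} {n : ℕ}

/-- The function `P(y) z ^ j` on the Kummer curve. -/
noncomputable def mono (F : K[X]) (n : ℕ) (P : K[X]) (j : ℕ) : KummerRing F n :=
  AdjoinRoot.of _ P * AdjoinRoot.root _ ^ j

/-- Exponents `⟨j, i⟩` of the monomials `y ^ i z ^ j` of weight `i + 2 j ≤ A` with `j < n`. -/
def expSet (n A : ℕ) : Finset (Σ _ : ℕ, ℕ) :=
  (Finset.range n).sigma fun j => Finset.range (A + 1 - 2 * j)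

/-- The space of functions of weight at most `A`, where `y` has weight one and `z` weight two. -/
noncomputable def weightSpace (F : K[X]) (n A : ℕ) : Submodule K (KummerRing F n) :=
  Submodule.span K ((fun x : Σ _ : ℕ, ℕ => mono F n (X ^ x.2) x.1) '' expSet n A)

theorem root_pow_self : AdjoinRoot.root (X ^ n - C F : K[X][X]) ^ n = AdjoinRoot.of _ F := by
  have h := AdjoinRoot.eval₂_root (X ^ n - C F : K[X][X])
  simpa [eval₂_sub, sub_eq_zero] using h

theorem smul_mono (a : K) (P : K[X]) (j : ℕ) : a • mono F n P j = mono F n (C a * P) j := by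
  rw [mono, mono, map_mul, Algebra.smul_def, mul_assoc]
  rfl

theorem mono_sum {ι : Type*} (s : Finset ι) (P : ι → K[X]) (j : ℕ) :
    mono F n (∑ i ∈ s, P i) j = ∑ i ∈ s, mono F n (P i) j := by
  simp [mono, Finset.sum_mul]

theorem mono_mem_weightSpace (hF : F.natDegree ≤ 2 * n) (hn : 0 < n) {A : ℕ} (j : ℕ) :
    ∀ P : K[X], P.natDegree + 2 * j ≤ A → mono F n P j ∈ weightSpace F n A := by
  induction j using Nat.strong_induction_on with
  | _ j ih =>
  intro P hP
  by_cases hj : j < n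
  · rw [P.as_sum_range_C_mul_X_pow, mono_sum]
    refine Submodule.sum_mem _ fun i hi => ?_
    rw [← smul_mono]
    refine Submodule.smul_mem _ _ (Submodule.subset_span ⟨⟨j, i⟩, ?_, rfl⟩)
    simp only [Finset.mem_range] at hi
    simp only [expSet, Finset.coe_sigma, Set.mem_sigma_iff, Finset.coe_range, Set.mem_Iio]
    omega
  · have : mono F n P j = mono F n (P * F) (j - n) := by
      rw [mono, mono, map_mul, ← root_pow_self, mul_assoc, ← pow_add]
      congr 2; omega
    rw [this]
    refine ih _ (by omega) _ ?_
    have := natDegree_mul_le (p := P) (q := F)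
    omega

theorem exists_eq_sum_of_mem_weightSpace {A : ℕ} {θ : KummerRing F n}
    (h : θ ∈ weightSpace F n A) :
    ∃ P : ℕ → K[X], (∀ j, (P j).natDegree ≤ A) ∧ θ = ∑ j ∈ Finset.range n, mono F n (P j) j := by
  induction h using Submodule.span_induction with
  | mem x hx =>
    obtain ⟨⟨j, i⟩, h, rfl⟩ := hx
    simp only [expSet, Finset.coe_sigma, Set.mem_sigma_iff, Finset.coe_range, Set.mem_Iio] at h
    refine ⟨fun k => if k = j then X ^ i else 0, fun k => ?_, ?_⟩
    · beta_reduce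
      split_ifs
      · rw [natDegree_X_pow]; omega
      · simp
    · rw [Finset.sum_eq_single j]
      · simp
      · intro k _ hk; simp [hk, mono]
      · intro hj; exact absurd (Finset.mem_range.2 h.1) hj
  | zero => exact ⟨0, by simp, by simp [mono]⟩
  | add x y _ _ hx hy =>
    obtain ⟨P, hP, rfl⟩ := hx
    obtain ⟨Q, hQ, rfl⟩ := hy
    refine ⟨P + Q, fun j => (natDegree_add_le _ _).trans (max_le (hP j) (hQ j)), ?_⟩
    rw [← Finset.sum_add_distrib]
    exact Finset.sum_congr rfl fun j _ => by simp [mono, add_mul]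
  | smul a x _ hx =>
    obtain ⟨P, hP, rfl⟩ := hx
    refine ⟨fun j => C a * P j, fun j => (natDegree_C_mul_le _ _).trans (hP j), ?_⟩
    rw [Finset.smul_sum]
    exact Finset.sum_congr rfl fun j _ => smul_mono _ _ _

theorem finrank_weightSpace_le (A : ℕ) :
    Module.finrank K (weightSpace F n A) ≤ (expSet n A).card := by
  classical
  rw [weightSpace, ← Finset.coe_image]
  exact (finrank_span_finset_le_card _).trans Finset.card_image_le

instance (A : ℕ) : Module.Finite K (weightSpace F n A) :=
  FiniteDimensional.span_of_finite K ((expSet n A).finite_toSet.image _)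

theorem card_expSet {A : ℕ} (h : 2 * n ≤ A) : (expSet n A).card + n * n = n * (A + 2) := by
  have key : ∀ m ≤ n, ∑ j ∈ Finset.range m, (A + 1 - 2 * j) + m * m = m * (A + 2) := by
    intro m
    induction m with
    | zero => simp
    | succ m ih =>
      intro hm
      have := ih (by omega)
      rw [Finset.sum_range_succ]
      zify [show 2 * m ≤ A + 1 by omega] at this ⊢
      linarith
  simpa [expSet] using key n le_rfl

theorem mul_root_cancel (hn : 0 < n) (hF : F ≠ 0) {w : KummerRing F n}
    (h : AdjoinRoot.root (X ^ n - C F : K[X][X]) * w = 0) : w = 0 := by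
  have hm : (X ^ n - C F : K[X][X]).Monic := monic_X_pow_sub_C F hn.ne'
  obtain ⟨p, rfl⟩ := AdjoinRoot.mk_surjective w
  have h1 : AdjoinRoot.mk (X ^ n - C F : K[X][X]) (C F * p) = 0 := by
    rw [map_mul, AdjoinRoot.mk_C, ← root_pow_self]
    have hk : n - 1 + 1 = n := Nat.sub_add_cancel hn
    have : AdjoinRoot.root (X ^ n - C F : K[X][X]) ^ n =
        AdjoinRoot.root (X ^ n - C F : K[X][X]) ^ (n - 1) * AdjoinRoot.root _ := by
      rw [← pow_succ, hk]
    rw [this, mul_assoc, h, mul_zero]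
  have h2 : AdjoinRoot.mk (X ^ n - C F : K[X][X]) (C F * (p %ₘ (X ^ n - C F))) = 0 := by
    rw [map_mul] at h1 ⊢
    rwa [modByMonic_eq_sub_mul_div, map_sub, map_mul, AdjoinRoot.mk_self, zero_mul, sub_zero]
  rw [AdjoinRoot.mk_eq_zero] at h2
  have h3 : C F * (p %ₘ (X ^ n - C F)) = 0 := by
    by_contra hne
    refine hm.not_dvd_of_degree_lt hne ?_ h2
    rw [degree_C_mul hF]
    exact degree_modByMonic_lt _ hm
  rw [mul_eq_zero, C_eq_zero, or_iff_right hF] at h3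
  rw [AdjoinRoot.mk_eq_zero]
  exact (modByMonic_eq_zero_iff_dvd hm).1 h3

/-- Evaluation at a point of the Kummer curve. -/
noncomputable def evalAt (y z : K) (h : z ^ n = F.eval y) : KummerRing F n →+* K :=
  AdjoinRoot.lift (evalRingHom y) z (by simp [eval₂_sub, h])

@[simp] theorem evalAt_mono (y z : K) (h : z ^ n = F.eval y) (P : K[X]) (j : ℕ) :
    evalAt y z h (mono F n P j) = P.eval y * z ^ j := by
  simp [evalAt, mono]

/-- At a simple zero `y₀` of `F` the function `z` is a uniformizer, so monomials in `y - y₀` and `z`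
with distinct orders of vanishing are linearly independent. -/
theorem sum_smul_mono_ne_zero {U : K[X]} {y₀ : K} (hn : 0 < n) (hF : F = (X - C y₀) * U)
    (hU : U.eval y₀ ≠ 0) {ι : Type*} (s : Finset ι) (d : ι → K) (a b : ι → ℕ)
    (hinj : Set.InjOn (fun i => n * a i + b i) s) (hd : ∃ i ∈ s, d i ≠ 0) :
    ∑ i ∈ s, d i • mono F n ((X - C y₀) ^ a i) (b i) ≠ 0 := by
  classical
  have hF0 : F ≠ 0 := by
    rw [hF]
    exact mul_ne_zero (X_sub_C_ne_zero _) (by rintro rfl; simp at hU)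
  obtain ⟨i₀, hi₀, hmin⟩ := Finset.exists_min_image (s.filter fun i => d i ≠ 0)
    (fun i => n * a i + b i) (by obtain ⟨i, hi, h⟩ := hd; exact ⟨i, by simp [hi, h]⟩)
  rw [Finset.mem_filter] at hi₀
  set N := fun i => n * a i + b i with hN
  set B := s.sup a
  have haB : ∀ i ∈ s, a i ≤ B := fun i hi => Finset.le_sup hi
  set u : KummerRing F n := AdjoinRoot.of _ U
  set z : KummerRing F n := AdjoinRoot.root _
  have hmono : ∀ i ∈ s, u ^ B * mono F n ((X - C y₀) ^ a i) (b i) =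
      mono F n (U ^ (B - a i)) (N i) := by
    intro i hi
    have : u ^ B = u ^ (B - a i) * u ^ a i := by rw [← pow_add, Nat.sub_add_cancel (haB i hi)]
    rw [this, mono, mono, hN]
    simp only
    have hFu : AdjoinRoot.of (X ^ n - C F : K[X][X]) F = AdjoinRoot.of _ (X - C y₀) * u := by
      rw [← map_mul]; exact congrArg _ hF
    rw [pow_add, pow_mul, root_pow_self, hFu]
    simp only [map_pow, mul_pow, u]
    ring
  intro h0
  have h1 : ∑ i ∈ s, d i • mono F n (U ^ (B - a i)) (N i) = 0 := by
    rw [← mul_zero (u ^ B), ← h0, Finset.mul_sum]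
    exact Finset.sum_congr rfl fun i hi => by rw [mul_smul_comm, hmono i hi]
  have h2 : z ^ N i₀ * (d i₀ • mono F n (U ^ (B - a i₀)) 0 +
      ∑ i ∈ s.erase i₀, d i • mono F n (U ^ (B - a i)) (N i - N i₀)) = 0 := by
    rw [← h1, ← Finset.add_sum_erase _ _ hi₀.1, mul_add, Finset.mul_sum]
    congr 1
    · rw [mul_smul_comm]; congr 1
      simp only [mono, pow_zero, z]; ring
    · refine Finset.sum_congr rfl fun i hi => ?_
      by_cases hdi : d i = 0
      · simp [hdi]
      · rw [mul_smul_comm]; congr 1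
        have : N i₀ ≤ N i := hmin i (by simp [hdi, Finset.mem_of_mem_erase hi])
        have e : N i = N i₀ + (N i - N i₀) := by omega
        conv_rhs => rw [e]
        simp only [mono, pow_add, z]; ring
  have hcancel : ∀ (k : ℕ) (w : KummerRing F n), z ^ k * w = 0 → w = 0 := by
    intro k
    induction k with
    | zero => intro w hw; simpa using hw
    | succ k ih =>
      intro w hw
      refine ih w (mul_root_cancel hn hF0 ?_)
      rw [← mul_assoc, ← pow_succ']; exact hw
  have h3 := congrArg (evalAt y₀ 0 (by simp [hF, hn.ne'])) (hcancel _ _ h2)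
  have hz : ∀ x : K, ∀ w : KummerRing F n, evalAt (F := F) (n := n) y₀ 0 (by simp [hF, hn.ne'])
      (x • w) = x * evalAt (F := F) (n := n) y₀ 0 (by simp [hF, hn.ne']) w := by
    intro x w
    have : x • w = mono F n (C x) 0 * w := by
      rw [mono, Algebra.smul_def, pow_zero, mul_one]; rfl
    rw [this, map_mul, evalAt_mono]; simp
  rw [map_add, hz, map_sum, map_zero, Finset.sum_eq_zero, add_zero, evalAt_mono] at h3
  · simp only [eval_pow, pow_zero, mul_one, mul_eq_zero] at h3
    exact h3.elim hi₀.2 (pow_ne_zero _ hU)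
  · intro i hi
    by_cases hdi : d i = 0
    · simp [hdi]
    · rw [hz, evalAt_mono, zero_pow, mul_zero, mul_zero]
      have : N i₀ ≤ N i := hmin i (by simp [hdi, Finset.mem_of_mem_erase hi])
      have hne : N i ≠ N i₀ := fun h => (Finset.ne_of_mem_erase hi)
        (hinj (Finset.mem_of_mem_erase hi) hi₀.1 h)
      omega

theorem mul_add_injOn {n ρ r : ℕ} (hr : r = n * ρ + 1) {m : ℕ} :
    Set.InjOn (fun x : (Σ _ : ℕ, ℕ) × (Σ _ : ℕ, ℕ) =>
      n * (x.2.2 + x.1.2 * r) + (x.2.1 + x.1.1 * r)) (expSet n m ×ˢ expSet n ρ : Finset _) := by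
  have key : ∀ i j i' j', j < n → j' < n → n * i + j = n * i' + j' → i = i' ∧ j = j' := by
    intro i j i' j' hj hj' h
    have h1 := congrArg (· / n) h
    have h2 := congrArg (· % n) h
    simp only [Nat.mul_add_div (show n > 0 by omega), Nat.mul_add_mod, Nat.div_eq_of_lt hj,
      Nat.div_eq_of_lt hj', Nat.mod_eq_of_lt hj, Nat.mod_eq_of_lt hj'] at h1 h2
    exact ⟨h1, h2⟩
  rintro ⟨⟨j, i⟩, ⟨l, k⟩⟩ h ⟨⟨j', i'⟩, ⟨l', k'⟩⟩ h' heq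
  simp only [expSet, Finset.coe_product, Finset.coe_sigma, Set.mem_prod, Set.mem_sigma_iff,
    Finset.coe_range, Set.mem_Iio] at h h' heq
  have b1 : n * k + l < r := by rw [hr]; nlinarith [show k + 2 * l ≤ ρ by omega]
  have b2 : n * k' + l' < r := by rw [hr]; nlinarith [show k' + 2 * l' ≤ ρ by omega]
  have e : r * (n * i + j) + (n * k + l) = r * (n * i' + j') + (n * k' + l') := by linarith
  have h1 := congrArg (· / r) e
  have h2 := congrArg (· % r) e
  simp only [Nat.mul_add_div (show r > 0 by omega), Nat.mul_add_mod, Nat.div_eq_of_lt b1,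
    Nat.div_eq_of_lt b2, Nat.mod_eq_of_lt b1, Nat.mod_eq_of_lt b2] at h1 h2
  obtain ⟨rfl, rfl⟩ := key _ _ _ _ h.1.1 h'.1.1 h1
  obtain ⟨rfl, rfl⟩ := key _ _ _ _ h.2.1 h'.2.1 h2
  rfl

/-- A nonzero function of weight at most `A` vanishes on at most `A` full fibres of `(y, z) ↦ y`. -/
theorem card_le_of_evalAt_eq_zero [IsAlgClosed K] (hn : (n : K) ≠ 0) {A : ℕ} {θ : KummerRing F n}
    (hθ : θ ∈ weightSpace F n A) (hθ0 : θ ≠ 0) (S : Finset K) (hS : ∀ y ∈ S, F.eval y ≠ 0)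
    (h : ∀ y ∈ S, ∀ z, ∀ hz : z ^ n = F.eval y, evalAt y z hz θ = 0) : S.card ≤ A := by
  classical
  obtain ⟨P, hP, rfl⟩ := exists_eq_sum_of_mem_weightSpace hθ
  obtain ⟨j, hj, hj0⟩ : ∃ j ∈ Finset.range n, P j ≠ 0 := by
    by_contra! hall
    exact hθ0 (Finset.sum_eq_zero fun j hj => by simp [hall j hj, mono])
  have hroot : ∀ y ∈ S, (P j).eval y = 0 := by
    intro y hy
    set G : K[X] := ∑ i ∈ Finset.range n, C ((P i).eval y) * X ^ i with hG
    have hsep : (X ^ n - C (F.eval y)).Separable := separable_X_pow_sub_C _ hn (hS y hy)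
    have hn0 : n ≠ 0 := by rintro rfl; simp at hn
    have hcard : (X ^ n - C (F.eval y)).roots.toFinset.card = n := by
      rw [Multiset.toFinset_card_of_nodup (nodup_roots hsep),
        ← (IsAlgClosed.splits _).natDegree_eq_card_roots, natDegree_X_pow_sub_C]
    have hG0 : G = 0 := by
      refine eq_zero_of_degree_lt_of_eval_finset_eq_zero (X ^ n - C (F.eval y)).roots.toFinset ?_ ?_
      · rw [hcard]
        exact (degree_sum_fin_lt (n := n) fun i => (P i).eval y) |>.trans_eq' (by
          rw [hG, Finset.sum_range])
      · intro z hz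
        have hz' : z ^ n = F.eval y := by
          rw [Multiset.mem_toFinset, mem_roots (X_pow_sub_C_ne_zero (by omega) _)] at hz
          simpa [sub_eq_zero] using hz
        have := h y hy z hz'
        rw [map_sum] at this
        simpa [hG, eval_finsetSum] using this
    have := congrArg (fun q => coeff q j) hG0
    simpa [hG, finsetSum_coeff, coeff_C_mul, coeff_X_pow, Finset.mem_range.1 hj] using this
  by_contra! hlt
  exact hj0 (eq_zero_of_natDegree_lt_card_of_eval_eq_zero' _ S hroot ((hP j).trans_lt hlt))

theorem exists_sum_smul_eq_zero {M ι : Type*} [AddCommGroup M] [Module K M] [Fintype ι]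
    {V : Submodule K M} [Module.Finite K V] (f : ι → M) (hf : ∀ i, f i ∈ V)
    (hV : Module.finrank K V < Fintype.card ι) :
    ∃ c : ι → K, ∑ i, c i • f i = 0 ∧ ∃ i, c i ≠ 0 := by
  refine Fintype.not_linearIndependent_iff.1 fun hli => ?_
  have : LinearIndependent K fun i => (⟨f i, hf i⟩ : V) :=
    LinearIndependent.of_comp V.subtype hli
  exact hV.not_ge this.fintype_card_le_finrank

theorem card_expSet_lt {n ρ : ℕ} (hn : 2 ≤ n) (hρ : n * n ≤ ρ) :
    (expSet n (ρ * (n * ρ + 1) + (ρ + 2 * n - 2))).card <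
      (expSet n (ρ + 2 * n - 2)).card * (expSet n ρ).card := by
  have hnn : 2 * n ≤ n * n := Nat.mul_le_mul_right n hn
  set m := ρ + 2 * n - 2 with hm
  have c1 := card_expSet (n := n) (A := m) (by omega)
  have c2 := card_expSet (n := n) (A := ρ) (by omega)
  have c3 := card_expSet (n := n) (A := ρ * (n * ρ + 1) + m) (by omega)
  have hm' : (m : ℤ) = ρ + 2 * n - 2 := by omega
  zify at c1 c2 c3 hn hρ ⊢
  have e1 : ((expSet n m).card : ℤ) = n * (ρ + n) := by rw [hm'] at c1; linarith
  have e2 : ((expSet n ρ).card : ℤ) = n * (ρ + 2 - n) := by linarith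
  have e3 : ((expSet n (ρ * (n * ρ + 1) + m)).card : ℤ) = n * (ρ * (n * ρ + 1) + ρ + n) := by
    rw [hm'] at c3; linarith
  rw [e1, e2, e3]
  have hn0 : (0 : ℤ) < n := by linarith
  have h2 : (ρ : ℤ) * (n * ρ + 1) + ρ + n < n * (ρ + n) * (ρ + 2 - n) := by
    have h3 : (n : ℤ) * n * (2 * n - 2) ≤ ρ * (2 * n - 2) :=
      mul_le_mul_of_nonneg_right hρ (by linarith)
    nlinarith [mul_pos hn0 (mul_pos hn0 hn0), mul_pos hn0 hn0]
  calc (n : ℤ) * (ρ * (n * ρ + 1) + ρ + n) < n * (n * (ρ + n) * (ρ + 2 - n)) := by gcongr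
    _ = _ := by ring

theorem card_le_of_twisted_frobenius [IsAlgClosed K] (p : ℕ) [Fact p.Prime] [CharP K p]
    {w r ρ : ℕ} (hw : r = p ^ w) (hr : r = n * ρ + 1) (hn : 2 ≤ n) (hn0 : (n : K) ≠ 0)
    (hρ : n * n ≤ ρ) {U : K[X]} {y₀ : K} (hdeg : F.natDegree ≤ 2 * n)
    (hF : F = (X - C y₀) * U) (hU : U.eval y₀ ≠ 0) (u v : K) (S : Finset K)
    (hS : ∀ y ∈ S, F.eval y ≠ 0 ∧ y ^ (r * r) = u * y ∧
      ∀ z, z ^ n = F.eval y → z ^ (r * r) = v * z) :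
    S.card ≤ ρ + (ρ + 2 * n - 2) * r := by
  classical
  set m := ρ + 2 * n - 2 with hm
  have hnn : 2 * n ≤ n * n := Nat.mul_le_mul_right n hn
  set E : Finset ((Σ _ : ℕ, ℕ) × (Σ _ : ℕ, ℕ)) := expSet n m ×ˢ expSet n ρ with hE
  set f : E → KummerRing F n := fun x => mono F n ((X - C y₀) ^ (r * x.1.2.2) *
        (C u * X - C (y₀ ^ (r * r))) ^ x.1.1.2 * C (v ^ x.1.1.1)) (r * x.1.2.1 + x.1.1.1) with hf
  have hmem : ∀ x, f x ∈ weightSpace F n (ρ * r + m) := by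
    rintro ⟨⟨⟨j, i⟩, ⟨l, k⟩⟩, h⟩
    simp only [hE, expSet, Finset.mem_product, Finset.mem_sigma, Finset.mem_range] at h
    refine mono_mem_weightSpace hdeg (by omega) _ _ ?_
    have h1 : ((X - C y₀) ^ (r * k) * (C u * X - C (y₀ ^ (r * r))) ^ i *
        C (v ^ j)).natDegree ≤ r * k + i := by
      compute_degree
    have : r * (k + 2 * l) ≤ r * ρ := Nat.mul_le_mul_left _ (by omega)
    simp only
    nlinarith [show i + 2 * j ≤ m by omega]
  have hcard : Module.finrank K (weightSpace F n (ρ * r + m)) < Fintype.card E := by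
    rw [Fintype.card_coe, Finset.card_product]
    refine (finrank_weightSpace_le _).trans_lt ?_
    have := card_expSet_lt hn hρ
    rwa [← hr, ← hm] at this
  have hlin := exists_sum_smul_eq_zero f hmem hcard
  obtain ⟨c, hc, x₀, hx₀⟩ := hlin
  have hr0 : 0 < r := by omega
  choose d hd using fun x => IsAlgClosed.exists_pow_nat_eq (c x) hr0
  set θ : KummerRing F n := ∑ x, d x • mono F n ((X - C y₀) ^ (x.1.2.2 + x.1.1.2 * r))
    (x.1.2.1 + x.1.1.1 * r) with hθ
  have hθ0 : θ ≠ 0 := by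
    refine sum_smul_mono_ne_zero (by omega) hF hU _ d _ _ ?_ ⟨x₀, Finset.mem_univ _, ?_⟩
    · intro x _ y _ h
      exact Subtype.ext (mul_add_injOn hr x.2 y.2 h)
    · intro h0
      rw [← hd, h0, zero_pow hr0.ne'] at hx₀
      exact hx₀ rfl
  refine card_le_of_evalAt_eq_zero hn0 (θ := θ) ?_ hθ0 S (fun y hy => (hS y hy).1) ?_
  · refine Submodule.sum_mem _ fun ⟨⟨⟨j, i⟩, ⟨l, k⟩⟩, h⟩ _ => Submodule.smul_mem _ _ ?_
    simp only [hE, expSet, Finset.mem_product, Finset.mem_sigma, Finset.mem_range] at h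
    refine mono_mem_weightSpace hdeg (by omega) _ _ ?_
    rw [natDegree_pow, natDegree_X_sub_C]
    have : r * (i + 2 * j) ≤ r * m := Nat.mul_le_mul_left _ (by omega)
    nlinarith [show k + 2 * l ≤ ρ by omega]
  · intro y hy z hz
    obtain ⟨-, hyQ, hzQ⟩ := hS y hy
    have hzQ := hzQ z hz
    have hsmul : ∀ (a : K) (P : K[X]) (j : ℕ),
        evalAt y z hz (a • mono F n P j) = a * (P.eval y * z ^ j) := by
      intro a P j; rw [smul_mono, evalAt_mono]; simp; ring
    have hpow : (evalAt y z hz θ) ^ r = 0 := by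
      rw [← map_zero (evalAt y z hz), ← hc, hθ, map_sum, map_sum, hw, sum_pow_char_pow p w, ← hw]
      refine Finset.sum_congr rfl fun x _ => ?_
      rw [hf, hsmul, hsmul, ← hd]
      have e1 : ((X - C y₀ : K[X]) ^ (x.1.2.2 + x.1.1.2 * r)).eval y =
          (y - y₀) ^ (x.1.2.2) * ((y - y₀) ^ r) ^ x.1.1.2 := by
        simp [pow_add, pow_mul']
      have e2 : ((y - y₀) ^ r) ^ r = u * y - y₀ ^ (r * r) := by
        rw [← pow_mul, ← hyQ, hw, ← pow_add, sub_pow_char_pow]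
      have e3 : (z ^ r) ^ r = v * z := by rw [← pow_mul, hzQ]
      rw [e1]
      simp only [eval_mul, eval_pow, eval_sub, eval_X, eval_C, ← e2]
      have e4 : z ^ (r * x.1.2.1 + x.1.1.1) * v ^ x.1.1.1 =
          z ^ (r * x.1.2.1) * ((z ^ r) ^ r) ^ x.1.1.1 := by rw [e3, pow_add, mul_pow]; ring
      calc _ = d x ^ r * ((y - y₀) ^ (r * x.1.2.2) * (((y - y₀) ^ r) ^ r) ^ x.1.1.2 *
            (z ^ (r * x.1.2.1) * ((z ^ r) ^ r) ^ x.1.1.1)) := by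
            simp only [mul_pow, ← pow_mul, pow_add]; ring_nf
        _ = _ := by rw [← e4]; ring
    exact pow_eq_zero_iff hr0.ne' |>.1 hpow

end KummerRing

namespace FiniteFieldCharSum

open Finset

variable {F : Type*} [Field F] [Fintype F] {K : Type*} [Field K]

local notation "q" => Fintype.card F

/-- The exponent `1 + q + ⋯ + q ^ (k - 1)` of the norm map `F_{q^k} → F_q`. -/
def normExp (F : Type*) [Fintype F] (k : ℕ) : ℕ := ∑ i ∈ range k, Fintype.card F ^ i

theorem normExp_mul_add_one (k : ℕ) : (q - 1) * normExp F k + 1 = q ^ k := by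
  have hq : 1 < q := Fintype.one_lt_card
  induction k with
  | zero => simp [normExp]
  | succ k ih =>
    rw [normExp, sum_range_succ, mul_add, pow_succ, ← normExp]
    obtain ⟨m, hm⟩ := Nat.exists_eq_add_of_lt hq
    rw [hm] at ih ⊢
    simp only [Nat.add_sub_cancel] at ih ⊢
    linarith

/-- The elements of `K` fixed by the `k`-th power of the `q`-Frobenius. -/
noncomputable def fixedPts (F K : Type*) [Field K] [Fintype F] (k : ℕ) : Finset K :=
  open scoped Classical in (X ^ (Fintype.card F ^ k) - X : K[X]).roots.toFinset

theorem mem_fixedPts {k : ℕ} (hk : k ≠ 0) {x : K} : x ∈ fixedPts F K k ↔ x ^ q ^ k = x := by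
  have h1 : 1 < q ^ k := Nat.one_lt_pow hk Fintype.one_lt_card
  classical
  rw [fixedPts, Multiset.mem_toFinset, mem_roots (FiniteField.X_pow_card_sub_X_ne_zero K h1)]
  simp [sub_eq_zero]

theorem pow_normExp_pow {k : ℕ} {x : K} (hx : x ^ q ^ k = x) :
    (x ^ normExp F k) ^ q = x ^ normExp F k := by
  have hq : 1 < q := Fintype.one_lt_card
  have h := normExp_mul_add_one (F := F) k
  have e : normExp F k * q = (q - 1) * normExp F k + normExp F k := by
    obtain ⟨m, hm⟩ := Nat.exists_eq_add_of_lt hq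
    rw [hm, Nat.add_sub_cancel]; ring
  by_cases hx0 : x = 0
  · rcases Nat.eq_zero_or_pos (normExp F k) with h0 | h0
    · rw [h0]; simp
    · rw [hx0, zero_pow h0.ne', zero_pow (by omega)]
  · rw [← pow_mul, e, pow_add]
    have : x ^ ((q - 1) * normExp F k) = 1 := by
      refine mul_right_cancel₀ hx0 ?_
      rw [← pow_succ, h, hx, one_mul]
    rw [this, one_mul]

variable [Algebra F K]

theorem cast_card_eq_zero : (q : K) = 0 := by
  rw [← map_natCast (algebraMap F K), FiniteField.cast_card_eq_zero, map_zero]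

theorem card_fixedPts [IsAlgClosed K] {k : ℕ} (hk : k ≠ 0) :
    (fixedPts F K k).card = q ^ k := by
  classical
  have h1 : 1 < q ^ k := Nat.one_lt_pow hk Fintype.one_lt_card
  have hsep : (X ^ (q ^ k) - X : K[X]).Separable := by
    have h0 : ((q ^ k : ℕ) : K[X]) = 0 := by
      rw [Nat.cast_pow, ← C_eq_natCast, cast_card_eq_zero, C_0, zero_pow hk]
    refine ⟨0, -1, ?_⟩
    simp only [derivative_sub, derivative_X_pow, derivative_X]
    rw [C_eq_natCast, h0]
    simp
  rw [fixedPts, Multiset.toFinset_card_of_nodup (nodup_roots hsep),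
    ← (IsAlgClosed.splits _).natDegree_eq_card_roots,
    FiniteField.X_pow_card_sub_X_natDegree_eq K h1]

theorem exists_algebraMap_eq {x : K} (hx : x ^ q = x) : ∃ a : F, algebraMap F K a = x := by
  classical
  have h1 : 1 < q := Fintype.one_lt_card
  have hsub : univ.image (algebraMap F K) ⊆ fixedPts F K 1 := by
    intro y hy
    obtain ⟨a, -, rfl⟩ := mem_image.1 hy
    rw [mem_fixedPts one_ne_zero, pow_one, ← map_pow, FiniteField.pow_card]
  have hcard : (fixedPts F K 1).card ≤ (univ.image (algebraMap F K)).card := by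
    rw [card_image_of_injective _ (algebraMap F K).injective, card_univ, fixedPts]
    refine (Multiset.toFinset_card_le _).trans ((card_roots' _).trans ?_)
    rw [pow_one, FiniteField.X_pow_card_sub_X_natDegree_eq K h1]
  have hx' : x ∈ fixedPts F K 1 := by rw [mem_fixedPts one_ne_zero, pow_one, hx]
  rw [← eq_of_subset_of_card_le hsub hcard] at hx'
  obtain ⟨a, -, h⟩ := mem_image.1 hx'
  exact ⟨a, h⟩

/-- The points `x ∈ F_{q^k}` such that `x` has norm `u` and `f(x)` has norm `v`. -/
noncomputable def normFiber (K : Type*) [Field K] [Algebra F K] (f : F[X]) (k : ℕ) (u v : F) :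
    Finset K :=
  open scoped Classical in (fixedPts F K k).filter fun x =>
    x ^ normExp F k = algebraMap F K u ∧ (aeval x f) ^ normExp F k = algebraMap F K v

theorem card_normFiber_le [IsAlgClosed K] {f : F[X]} (hf : f.natDegree ≤ 2) {α : K} (hα : α ≠ 0)
    (hα1 : aeval α f = 0) (hα2 : aeval α (derivative f) ≠ 0) (hq : 3 ≤ q) {k : ℕ} (hk : 3 ≤ k)
    {u v : F} (hu : u ≠ 0) (hv : v ≠ 0) :
    (q - 1) ^ 2 * (normFiber K f (2 * k) u v).card ≤ q ^ (2 * k) + 2 * (q - 1) ^ 2 * q ^ k := by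
  classical
  obtain ⟨p', hpF⟩ := CharP.exists F
  obtain ⟨s', hp', hs'⟩ := FiniteField.card F p'
  have : Fact p'.Prime := ⟨hp'⟩
  have : CharP K p' := charP_of_injective_algebraMap (algebraMap F K).injective p'
  set n := q - 1 with hn
  have hn0 : (n : K) ≠ 0 := by
    have : (n : K) + 1 = 0 := by
      rw [← cast_card_eq_zero (F := F) (K := K), ← Nat.cast_succ]
      congr 1; omega
    intro h0; simp [h0] at this
  obtain ⟨y₀, hy₀⟩ := IsAlgClosed.exists_pow_nat_eq α (n := n) (by omega)
  have hy₀0 : y₀ ≠ 0 := by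
    rintro rfl; rw [zero_pow (by omega)] at hy₀; exact hα hy₀.symm
  set G : K[X] := expand K n (f.map (algebraMap F K)) with hG
  have hGev : ∀ y, G.eval y = aeval (y ^ n) f := by
    intro y; rw [hG, expand_eval, eval_map_algebraMap]
  obtain ⟨U, hU⟩ : X - C y₀ ∣ G := by rw [dvd_iff_isRoot, IsRoot, hGev, hy₀, hα1]
  have hU0 : U.eval y₀ ≠ 0 := by
    have h1 : (derivative G).eval y₀ = U.eval y₀ := by
      rw [hU]; simp
    rw [← h1, hG, derivative_expand, eval_mul, expand_eval, hy₀, derivative_map,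
      eval_map_algebraMap]
    simp only [eval_mul, eval_natCast, eval_pow, eval_X]
    exact mul_ne_zero hα2 (mul_ne_zero hn0 (pow_ne_zero _ hy₀0))
  set r := q ^ k with hr
  set ρ := normExp F k with hρ
  have hrρ : r = n * ρ + 1 := (normExp_mul_add_one k).symm
  have hQ : n * normExp F (2 * k) + 1 = r * r := by
    rw [normExp_mul_add_one, hr, ← pow_add, two_mul]
  have hρn : n * n ≤ ρ := by
    have h1 : q ^ 2 ≤ ρ := single_le_sum (f := fun i => q ^ i) (fun _ _ => Nat.zero_le _)
      (mem_range.2 (by omega : 2 < k))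
    calc n * n ≤ q * q := Nat.mul_le_mul (by omega) (by omega)
      _ ≤ ρ := by rw [← sq]; exact h1
  have he : normExp F (2 * k) ≠ 0 := by
    intro h0
    have : 1 < r := Nat.one_lt_pow (by omega) (by omega)
    rw [h0] at hQ; nlinarith
  have hα' : ∀ {w : F}, w ≠ 0 → algebraMap F K w ≠ 0 := fun h =>
    (map_ne_zero (algebraMap F K)).2 h
  set T := normFiber K f (2 * k) u v with hT
  have hTmem : ∀ x ∈ T, x ^ normExp F (2 * k) = algebraMap F K u ∧
      (aeval x f) ^ normExp F (2 * k) = algebraMap F K v := fun x hx => (mem_filter.1 hx).2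
  set S := T.biUnion fun x => (X ^ n - C x).roots.toFinset with hS
  have hroots : ∀ x y : K, y ∈ (X ^ n - C x).roots.toFinset ↔ y ^ n = x := by
    intro x y
    rw [Multiset.mem_toFinset, mem_roots (X_pow_sub_C_ne_zero (by omega) _)]
    simp [sub_eq_zero]
  have hcard : S.card = T.card * n := by
    rw [hS, card_biUnion]
    · refine sum_const_nat fun x hx => ?_
      have hx0 : x ≠ 0 := by
        rintro rfl
        have := (hTmem 0 hx).1
        rw [zero_pow he] at this
        exact hα' hu this.symm
      rw [Multiset.toFinset_card_of_nodup (nodup_roots (separable_X_pow_sub_C _ hn0 hx0)),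
        ← (IsAlgClosed.splits _).natDegree_eq_card_roots, natDegree_X_pow_sub_C]
    · intro x _ x' _ hne
      refine disjoint_left.2 fun y hy hy' => hne ?_
      rw [hroots] at hy hy'
      rw [← hy, hy']
  have hmain : S.card ≤ ρ + (ρ + 2 * n - 2) * r := by
    refine KummerRing.card_le_of_twisted_frobenius p' (w := s' * k) (by rw [hr, hs', pow_mul]) hrρ
      (by omega) hn0 hρn (F := G) ?_ hU hU0 (algebraMap F K u) (algebraMap F K v) S ?_
    · rw [hG, natDegree_expand, natDegree_map]
      exact Nat.mul_le_mul_right n hf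
    · intro y hy
      obtain ⟨x, hx, hyx⟩ := mem_biUnion.1 hy
      rw [hroots] at hyx
      obtain ⟨h1, h2⟩ := hTmem x hx
      refine ⟨?_, ?_, ?_⟩
      · rw [hGev, hyx]
        intro h0
        rw [h0, zero_pow he] at h2
        exact hα' hv h2.symm
      · rw [← hQ, pow_succ, pow_mul, hyx, h1]
      · intro z hz
        rw [← hQ, pow_succ, pow_mul, hz, hGev, hyx, h2]
  rw [hcard] at hmain
  have e : q ^ (2 * k) = r * r := by rw [hr, ← pow_add, two_mul]
  rw [e]
  have hn2 : 2 ≤ n := by omega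
  have h3 : ρ + 2 * n - 2 ≤ ρ + 2 * n := Nat.sub_le _ _
  have h4 : n * (T.card * n) ≤ n * (ρ + (ρ + 2 * n) * r) :=
    Nat.mul_le_mul_left _ (hmain.trans (by gcongr))
  nlinarith [h4]

end FiniteFieldCharSum

namespace FiniteFieldCharSum

open Finset

variable {F : Type*} [Field F] {K : Type*} [Field K] [Algebra F K]

/-- A multiplicative character of `F`, extended by zero to an extension field `K`. -/
noncomputable def extChar (K : Type*) [Field K] [Algebra F K] (χ : MulChar F ℂ) : K → ℂ :=
  Function.extend (algebraMap F K) χ 0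

@[simp] theorem extChar_algebraMap (χ : MulChar F ℂ) (u : F) :
    extChar K χ (algebraMap F K u) = χ u :=
  (algebraMap F K).injective.extend_apply _ _ _

variable [Fintype F]

local notation "q" => Fintype.card F

theorem aeval_pow_card (f : F[X]) (x : K) (k : ℕ) :
    (aeval x f) ^ q ^ k = aeval (x ^ q ^ k) f := by
  induction k with
  | zero => simp
  | succ k ih =>
    rw [pow_succ, pow_mul, ih, pow_mul, ← map_pow, ← FiniteField.expand_card, expand_aeval]

/-- The value at `x ∈ F_{q^k}` of `χ₁(x) χ₂(f(x))`, lifted through the norm map. -/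
noncomputable def liftedTerm (χ₁ χ₂ : MulChar F ℂ) (f : F[X]) (k : ℕ) (x : K) : ℂ :=
  extChar K χ₁ (x ^ normExp F k) * extChar K χ₂ ((aeval x f) ^ normExp F k)

/-- The character sum `∑ χ₁(N x) χ₂(N f(x))` over `F_{q^k}`. -/
noncomputable def liftedSum (K : Type*) [Field K] [Algebra F K] (χ₁ χ₂ : MulChar F ℂ) (f : F[X])
    (k : ℕ) : ℂ :=
  ∑ x ∈ fixedPts F K k, liftedTerm χ₁ χ₂ f k x

theorem norm_mulChar_of_ne_zero (χ : MulChar F ℂ) {u : F} (hu : u ≠ 0) : ‖χ u‖ = 1 := by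
  have hq : q - 1 ≠ 0 := by have := Fintype.one_lt_card (α := F); omega
  refine Complex.norm_eq_one_of_pow_eq_one (n := q - 1) ?_ hq
  rw [← map_pow, FiniteField.pow_card_sub_one_eq_one u hu, map_one]

theorem norm_mulChar_le_one (χ : MulChar F ℂ) (u : F) : ‖χ u‖ ≤ 1 := by
  by_cases hu : u = 0
  · rw [hu, MulChar.map_zero]; simp
  · exact (norm_mulChar_of_ne_zero χ hu).le

theorem exists_norms {k : ℕ} (hk : k ≠ 0) {x : K} (hx : x ∈ fixedPts F K k) (f : F[X]) :
    ∃ u v : F, x ^ normExp F k = algebraMap F K u ∧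
      (aeval x f) ^ normExp F k = algebraMap F K v := by
  rw [mem_fixedPts hk] at hx
  obtain ⟨u, hu⟩ := exists_algebraMap_eq (F := F) (pow_normExp_pow hx)
  obtain ⟨v, hv⟩ := exists_algebraMap_eq (F := F)
    (pow_normExp_pow (F := F) (k := k) (x := aeval x f) (by rw [aeval_pow_card, hx]))
  exact ⟨u, v, hu.symm, hv.symm⟩

theorem liftedTerm_eq {χ₁ χ₂ : MulChar F ℂ} {f : F[X]} {k : ℕ} {x : K} {u v : F}
    (hu : x ^ normExp F k = algebraMap F K u) (hv : (aeval x f) ^ normExp F k = algebraMap F K v) :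
    liftedTerm χ₁ χ₂ f k x = χ₁ u * χ₂ v := by
  rw [liftedTerm, hu, hv, extChar_algebraMap, extChar_algebraMap]

theorem liftedSum_eq (χ₁ χ₂ : MulChar F ℂ) (f : F[X]) {k : ℕ} (hk : k ≠ 0) :
    liftedSum K χ₁ χ₂ f k =
      ∑ p : F × F, χ₁ p.1 * χ₂ p.2 * ((normFiber K f k p.1 p.2).card : ℂ) := by
  classical
  have h : ∀ p : F × F, χ₁ p.1 * χ₂ p.2 * ((normFiber K f k p.1 p.2).card : ℂ) =
      ∑ x ∈ fixedPts F K k, if x ^ normExp F k = algebraMap F K p.1 ∧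
        (aeval x f) ^ normExp F k = algebraMap F K p.2 then χ₁ p.1 * χ₂ p.2 else 0 := by
    intro p
    rw [← sum_filter, sum_const, nsmul_eq_mul, mul_comm]
    congr 3
  rw [sum_congr rfl fun p _ => h p, sum_comm, liftedSum]
  refine sum_congr rfl fun x hx => ?_
  obtain ⟨u, v, hu, hv⟩ := exists_norms hk hx f
  rw [sum_eq_single (u, v), if_pos ⟨hu, hv⟩, liftedTerm_eq hu hv]
  · rintro ⟨u', v'⟩ _ hne
    refine if_neg fun h => hne ?_
    rw [hu, hv] at h
    exact Prod.ext ((algebraMap F K).injective h.1).symm ((algebraMap F K).injective h.2).symm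
  · simp

/-- The pairs of nonzero elements. -/
noncomputable def unitPairs (F : Type*) [Field F] [Fintype F] : Finset (F × F) :=
  open scoped Classical in univ.filter fun p => p.1 ≠ 0 ∧ p.2 ≠ 0

theorem mem_unitPairs {p : F × F} : p ∈ unitPairs F ↔ p.1 ≠ 0 ∧ p.2 ≠ 0 := by
  simp [unitPairs]

theorem card_unitPairs : (unitPairs F).card = (q - 1) ^ 2 := by
  classical
  have : unitPairs F = (univ.erase (0 : F)) ×ˢ (univ.erase (0 : F)) := by
    ext p; simp [mem_unitPairs]
  rw [this, card_product, card_erase_of_mem (mem_univ _), card_univ, sq]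

theorem le_sum_card_normFiber [IsAlgClosed K] {f : F[X]} (hf0 : f ≠ 0) (hf : f.natDegree ≤ 2)
    {k : ℕ} (hk : k ≠ 0) :
    q ^ k ≤ ∑ p ∈ unitPairs F, (normFiber K f k p.1 p.2).card + 3 := by
  classical
  have hsub : fixedPts F K k ⊆ (unitPairs F).biUnion (fun p => normFiber K f k p.1 p.2) ∪
      insert 0 (f.map (algebraMap F K)).roots.toFinset := by
    intro x hx
    rw [mem_union, mem_insert, Multiset.mem_toFinset, mem_roots (map_ne_zero hf0), IsRoot,
      eval_map_algebraMap]
    by_cases h0 : x = 0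
    · exact Or.inr (Or.inl h0)
    by_cases h1 : aeval x f = 0
    · exact Or.inr (Or.inr h1)
    left
    obtain ⟨u, v, hu, hv⟩ := exists_norms hk hx f
    refine mem_biUnion.2 ⟨(u, v), mem_unitPairs.2 ⟨?_, ?_⟩, mem_filter.2 ⟨hx, hu, hv⟩⟩
    · rintro rfl; rw [map_zero] at hu; exact pow_ne_zero _ h0 hu
    · rintro rfl; rw [map_zero] at hv; exact pow_ne_zero _ h1 hv
  rw [← card_fixedPts (F := F) (K := K) hk]
  refine (card_le_card hsub).trans ((card_union_le _ _).trans (add_le_add card_biUnion_le ?_))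
  refine (card_insert_le _ _).trans (Nat.succ_le_succ ?_)
  refine (Multiset.toFinset_card_le _).trans ((card_roots' _).trans ?_)
  rwa [natDegree_map]

theorem norm_liftedSum_le [IsAlgClosed K] {f : F[X]} (hf : f.natDegree ≤ 2) {α : K} (hα : α ≠ 0)
    (hα1 : aeval α f = 0) (hα2 : aeval α (derivative f) ≠ 0) (hq : 3 ≤ q) {χ₁ χ₂ : MulChar F ℂ}
    (hχ : ¬(χ₁ = 1 ∧ χ₂ = 1)) {k : ℕ} (hk : 3 ≤ k) :
    ‖liftedSum K χ₁ χ₂ f (2 * k)‖ ≤ (4 * (q - 1 : ℝ) ^ 2 + 3) * q ^ k := by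
  classical
  have hf0 : f ≠ 0 := by rintro rfl; simp at hα2
  set n : ℝ := q - 1 with hn
  have hn1 : ((q - 1 : ℕ) : ℝ) = n := by rw [Nat.cast_sub (by omega), Nat.cast_one]
  have hn0 : 0 < n := by
    have : (3 : ℝ) ≤ q := by exact_mod_cast hq
    rw [hn]; linarith
  set N : F × F → ℝ := fun p => (normFiber K f (2 * k) p.1 p.2).card with hN
  set Q : ℝ := (q : ℝ) ^ (2 * k) with hQ
  set r : ℝ := (q : ℝ) ^ k with hr
  have hr1 : 1 ≤ r := one_le_pow₀ (by exact_mod_cast (show 1 ≤ q by omega))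
  have hupper : ∀ p ∈ unitPairs F, N p - Q / n ^ 2 ≤ 2 * r := by
    intro p hp
    rw [mem_unitPairs] at hp
    have := card_normFiber_le hf hα hα1 hα2 hq hk hp.1 hp.2
    have h2 : n ^ 2 * N p ≤ Q + 2 * n ^ 2 * r := by
      simp only [hN, hQ, hr, ← hn1]; exact_mod_cast this
    have h3 : n ^ 2 * (Q / n ^ 2) = Q := by field_simp
    refine le_of_mul_le_mul_left ?_ (pow_pos hn0 2)
    rw [mul_sub, h3]; linarith
  have hcard : ((unitPairs F).card : ℝ) = n ^ 2 := by
    rw [card_unitPairs, Nat.cast_pow, hn1]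
  have hlower : -3 ≤ ∑ p ∈ unitPairs F, (N p - Q / n ^ 2) := by
    have h1 := le_sum_card_normFiber (K := K) hf0 hf (k := 2 * k) (by omega)
    have h2 : Q ≤ ∑ p ∈ unitPairs F, N p + 3 := by
      simp only [hN, hQ]; exact_mod_cast h1
    rw [sum_sub_distrib, sum_const, nsmul_eq_mul, hcard]
    have h3 : n ^ 2 * (Q / n ^ 2) = Q := by field_simp
    rw [h3]; linarith
  have hzero : ∑ p ∈ unitPairs F, χ₁ p.1 * χ₂ p.2 = 0 := by
    have h1 : ∑ p ∈ unitPairs F, χ₁ p.1 * χ₂ p.2 = ∑ p : F × F, χ₁ p.1 * χ₂ p.2 := by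
      refine sum_subset (subset_univ _) fun p _ hp => ?_
      rw [mem_unitPairs, not_and_or, not_not, not_not] at hp
      rcases hp with h | h <;> simp [h, MulChar.map_zero]
    rw [h1, Fintype.sum_prod_type, ← Finset.sum_mul_sum]
    by_cases h : χ₁ = 1
    · rw [MulChar.sum_eq_zero_of_ne_one (χ := χ₂) fun h' => hχ ⟨h, h'⟩, mul_zero]
    · rw [MulChar.sum_eq_zero_of_ne_one h, zero_mul]
  have hsum : liftedSum K χ₁ χ₂ f (2 * k) =
      ∑ p ∈ unitPairs F, χ₁ p.1 * χ₂ p.2 * ((N p - Q / n ^ 2 : ℝ) : ℂ) := by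
    have h1 : liftedSum K χ₁ χ₂ f (2 * k) =
        ∑ p ∈ unitPairs F, χ₁ p.1 * χ₂ p.2 * ((N p : ℝ) : ℂ) := by
      rw [liftedSum_eq _ _ _ (by omega)]
      refine (sum_subset (subset_univ _) fun p _ hp => ?_).symm.trans
        (sum_congr rfl fun p _ => by simp [hN])
      rw [mem_unitPairs, not_and_or, not_not, not_not] at hp
      rcases hp with h | h <;> simp [h, MulChar.map_zero]
    simp only [Complex.ofReal_sub, mul_sub, sum_sub_distrib]
    rw [← sum_mul, hzero, zero_mul, sub_zero, h1]
  rw [hsum]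
  calc _ ≤ ∑ p ∈ unitPairs F, |N p - Q / n ^ 2| := by
        refine (norm_sum_le _ _).trans (sum_le_sum fun p _ => ?_)
        rw [norm_mul, norm_mul, Complex.norm_real, Real.norm_eq_abs]
        have := mul_le_one₀ (norm_mulChar_le_one χ₁ p.1) (norm_nonneg _)
          (norm_mulChar_le_one χ₂ p.2)
        exact mul_le_of_le_one_left (abs_nonneg _) this
    _ ≤ ∑ p ∈ unitPairs F, (4 * r - (N p - Q / n ^ 2)) := by
        refine sum_le_sum fun p hp => ?_
        have := hupper p hp
        rw [abs_le]; constructor <;> linarith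
    _ ≤ _ := by
        rw [sum_sub_distrib, sum_const, nsmul_eq_mul, hcard]
        nlinarith

theorem exists_liftedTerm_ne_one [IsAlgClosed K] {f : F[X]} (hf : f.natDegree ≤ 2) {α : K}
    (hα : α ≠ 0) (hα1 : aeval α f = 0) (hα2 : aeval α (derivative f) ≠ 0) (hq : 3 ≤ q)
    {χ₁ χ₂ : MulChar F ℂ} (hχ : ¬(χ₁ = 1 ∧ χ₂ = 1)) :
    ∃ k ≠ 0, q - 1 ∣ k ∧
      ∃ x ∈ fixedPts F K k, x ≠ 0 ∧ aeval x f ≠ 0 ∧ liftedTerm χ₁ χ₂ f k x ≠ 1 := by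
  classical
  by_contra! hall
  have hf0 : f ≠ 0 := by rintro rfl; simp at hα2
  obtain ⟨k, hk⟩ := pow_unbounded_of_one_lt (4 * (q - 1 : ℝ) ^ 2 + 6)
    (show (1 : ℝ) < q by exact_mod_cast (show 1 < q by omega))
  set m := (k + 3) * (q - 1) with hm
  have hkm : k + 3 ≤ m := Nat.le_mul_of_pos_right _ (by omega)
  have hk' : 4 * (q - 1 : ℝ) ^ 2 + 6 < (q : ℝ) ^ m :=
    hk.trans_le (pow_le_pow_right₀ (by exact_mod_cast (show 1 ≤ q by omega)) (by omega))
  have h1 := norm_liftedSum_le hf hα hα1 hα2 hq hχ (k := m) (by omega)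
  have h2 : liftedSum K χ₁ χ₂ f (2 * m) =
      ((∑ p ∈ unitPairs F, (normFiber K f (2 * m) p.1 p.2).card : ℕ) : ℂ) := by
    rw [liftedSum_eq _ _ _ (by omega), Nat.cast_sum]
    refine (sum_subset (subset_univ _) fun p _ hp => ?_).symm.trans (sum_congr rfl fun p hp => ?_)
    · rw [mem_unitPairs, not_and_or, not_not, not_not] at hp
      rcases hp with h | h <;> simp [h, MulChar.map_zero]
    · rw [mem_unitPairs] at hp
      rcases (normFiber K f (2 * m) p.1 p.2).eq_empty_or_nonempty with h | ⟨x, hx⟩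
      · simp [h]
      · have he : normExp F (2 * m) ≠ 0 := by
          intro h0
          have := normExp_mul_add_one (F := F) (2 * m)
          have h3 : 1 < q ^ (2 * m) := Nat.one_lt_pow (by omega) (by omega)
          rw [h0] at this; omega
        obtain ⟨hx, hu, hv⟩ := mem_filter.1 hx
        have := hall (2 * m) (by omega) ((dvd_mul_left _ _).mul_left _) x hx ?_ ?_
        · rw [liftedTerm_eq hu hv] at this
          rw [this, one_mul]
        · rintro rfl
          rw [zero_pow he] at hu
          exact (map_ne_zero (algebraMap F K)).2 hp.1 hu.symm
        · intro h0
          rw [h0, zero_pow he] at hv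
          exact (map_ne_zero (algebraMap F K)).2 hp.2 hv.symm
  rw [h2, Complex.norm_natCast] at h1
  have h3 := le_sum_card_normFiber (K := K) hf0 hf (k := 2 * m) (by omega)
  have h4 : (q : ℝ) ^ (2 * m) ≤
      ((∑ p ∈ unitPairs F, (normFiber K f (2 * m) p.1 p.2).card : ℕ) : ℝ) + 3 := by
    exact_mod_cast h3
  rw [show (q : ℝ) ^ (2 * m) = q ^ m * q ^ m by rw [two_mul, pow_add]] at h4
  nlinarith [sq_nonneg (q - 1 : ℝ)]

end FiniteFieldCharSum

namespace FiniteFieldCharSum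

open Finset FiniteField

variable {F : Type*} [Field F] [Fintype F] {K : Type*} [Field K] [Algebra F K]

local notation "q" => Fintype.card F

theorem frobenius_iterate (x : K) (k : ℕ) : (frobeniusAlgHom F K)^[k] x = x ^ q ^ k := by
  rw [coe_frobeniusAlgHom, pow_iterate]

/-- The first `k` points of the Frobenius orbit of `x`. -/
noncomputable def orbit (F : Type*) [Field F] [Fintype F] {K : Type*} [Field K] [Algebra F K]
    (k : ℕ) (x : K) : Multiset K :=
  (Multiset.range k).map fun i => (frobeniusAlgHom F K)^[i] x

theorem card_orbit (k : ℕ) (x : K) : (orbit F k x).card = k := by simp [orbit]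

theorem cons_map_orbit (k : ℕ) (x : K) :
    x ::ₘ (orbit F k x).map (frobeniusAlgHom F K) =
      (frobeniusAlgHom F K)^[k] x ::ₘ orbit F k x := by
  induction k with
  | zero => simp [orbit]
  | succ k ih =>
    have h : orbit F (k + 1) x = (frobeniusAlgHom F K)^[k] x ::ₘ orbit F k x := by
      simp [orbit, Multiset.range_succ]
    rw [h, Multiset.map_cons, Multiset.cons_swap, ih,
      ← Function.iterate_succ_apply' (frobeniusAlgHom F K)]

theorem map_orbit {k : ℕ} {x : K} (hx : (frobeniusAlgHom F K)^[k] x = x) :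
    (orbit F k x).map (frobeniusAlgHom F K) = orbit F k x := by
  have := cons_map_orbit (F := F) k x
  rwa [hx, Multiset.cons_inj_right] at this

theorem exists_map_eq_prod_orbit {k : ℕ} {x : K} (hx : (frobeniusAlgHom F K)^[k] x = x) :
    ∃ p : F[X], p.map (algebraMap F K) = ((orbit F k x).map fun y => X - C y).prod := by
  refine (mem_lifts (f := algebraMap F K) _).1 ((lifts_iff_coeff_lifts _).2 fun n => ?_)
  refine exists_algebraMap_eq ?_
  have h : (((orbit F k x).map fun y => X - C y).prod).map (frobeniusAlgHom F K : K →+* K) =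
      ((orbit F k x).map fun y => X - C y).prod := by
    conv_rhs => rw [← map_orbit hx]
    rw [Polynomial.map_multiset_prod, Multiset.map_map, Multiset.map_map]
    simp
  conv_rhs => rw [← h]
  rw [coeff_map]
  rfl

/-- The monic polynomial over `F` whose roots are the first `k` points of the Frobenius orbit
of `x`, provided that `x` is fixed by the `k`-th power of the Frobenius map. -/
noncomputable def orbitPoly (F : Type*) [Field F] [Fintype F] {K : Type*} [Field K] [Algebra F K]
    (k : ℕ) (x : K) : F[X] :=
  open scoped Classical in
  if h : (frobeniusAlgHom F K)^[k] x = x then (exists_map_eq_prod_orbit h).choose else 0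

theorem map_orbitPoly {k : ℕ} {x : K} (hx : (frobeniusAlgHom F K)^[k] x = x) :
    (orbitPoly F k x).map (algebraMap F K) = ((orbit F k x).map fun y => X - C y).prod := by
  rw [orbitPoly, dif_pos hx]
  exact (exists_map_eq_prod_orbit hx).choose_spec

theorem monic_orbitPoly {k : ℕ} {x : K} (hx : (frobeniusAlgHom F K)^[k] x = x) :
    (orbitPoly F k x).Monic := by
  refine monic_of_injective (algebraMap F K).injective ?_
  rw [map_orbitPoly hx]
  exact monic_multiset_prod_of_monic _ _ fun y _ => monic_X_sub_C y

theorem natDegree_orbitPoly {k : ℕ} {x : K} (hx : (frobeniusAlgHom F K)^[k] x = x) :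
    (orbitPoly F k x).natDegree = k := by
  rw [← natDegree_map (algebraMap F K), map_orbitPoly hx, natDegree_multiset_prod_X_sub_C_eq_card,
    card_orbit]

theorem orbitPoly_dvd_iff {k : ℕ} {x : K} (hx : (frobeniusAlgHom F K)^[k] x = x) {h : F[X]}
    (hh : h ≠ 0) : orbitPoly F k x ∣ h ↔ orbit F k x ≤ (h.map (algebraMap F K)).roots := by
  rw [← Polynomial.map_dvd_map' (algebraMap F K), map_orbitPoly hx,
    Multiset.prod_X_sub_C_dvd_iff_le_roots ((Polynomial.map_ne_zero_iff
      (algebraMap F K).injective).2 hh)]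

theorem mem_fixedPts_iff {k : ℕ} (hk : k ≠ 0) {x : K} :
    x ∈ fixedPts F K k ↔ (frobeniusAlgHom F K)^[k] x = x := by
  rw [mem_fixedPts hk, frobenius_iterate]

theorem count_iterate_roots [DecidableEq K] (h : F[X]) (x : K) (i : ℕ) :
    (h.map (algebraMap F K)).roots.count ((frobeniusAlgHom F K)^[i] x) =
      (h.map (algebraMap F K)).roots.count x := by
  induction i with
  | zero => rfl
  | succ i ih =>
    have h1 : (h.map (algebraMap F K)).map (frobeniusAlgHom F K : K →+* K) =
        h.map (algebraMap F K) := by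
      rw [Polynomial.map_map, AlgHom.comp_algebraMap]
    rw [Function.iterate_succ_apply', ← ih, count_roots, count_roots]
    conv_lhs => rw [← h1]
    exact (eq_rootMultiplicity_map (f := (frobeniusAlgHom F K : K →+* K))
      (RingHom.injective _) _).symm

theorem orbit_mul {d : ℕ} {x : K} (hd : (frobeniusAlgHom F K)^[d] x = x) (j : ℕ) :
    orbit F (d * j) x = j • orbit F d x := by
  induction j with
  | zero => simp [orbit]
  | succ j ih =>
    rw [succ_nsmul, ← ih, mul_add_one, orbit, Multiset.range_add, Multiset.map_add,
      Multiset.map_map]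
    congr 1
    refine Multiset.map_congr rfl fun i _ => ?_
    rw [Function.comp, add_comm, Function.iterate_add_apply,
      ((show Function.IsPeriodicPt (frobeniusAlgHom F K) d x from hd).mul_const j).eq]

theorem minimalPeriod_pos {h : F[X]} (hh : h ≠ 0) {x : K} (hx : aeval x h = 0) :
    0 < Function.minimalPeriod (frobeniusAlgHom F K) x := by
  classical
  have hmem : ∀ i, (frobeniusAlgHom F K)^[i] x ∈ (h.map (algebraMap F K)).roots.toFinset := by
    intro i
    rw [Multiset.mem_toFinset, ← Multiset.one_le_count_iff_mem, count_iterate_roots,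
      Multiset.one_le_count_iff_mem, mem_roots ((Polynomial.map_ne_zero_iff
      (algebraMap F K).injective).2 hh), IsRoot, eval_map_algebraMap, hx]
  obtain ⟨i, j, hij, he⟩ := Finite.exists_ne_map_eq_of_infinite
    fun i : ℕ => (⟨_, hmem i⟩ : (h.map (algebraMap F K)).roots.toFinset)
  wlog hlt : i < j generalizing i j
  · exact this j i hij.symm he.symm (by omega)
  obtain ⟨d, rfl⟩ := Nat.exists_eq_add_of_lt hlt
  rw [Subtype.mk.injEq, add_assoc, Function.iterate_add_apply] at he
  exact Function.minimalPeriod_pos_of_mem_periodicPts (Function.mk_mem_periodicPts d.succ_pos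
    ((frobeniusAlgHom F K).injective.iterate i he).symm)

open scoped Classical in
theorem count_roots_eq_card {h : F[X]} (hh : h ≠ 0) {x : K} (hx : aeval x h = 0) :
    (h.map (algebraMap F K)).roots.count x =
      ((Icc 1 h.natDegree).filter fun k =>
        (frobeniusAlgHom F K)^[k] x = x ∧ orbitPoly F k x ∣ h).card := by
  classical
  set d := Function.minimalPeriod (frobeniusAlgHom F K) x with hd
  have hd0 : 0 < d := minimalPeriod_pos hh hx
  have hdx : (frobeniusAlgHom F K)^[d] x = x := Function.iterate_minimalPeriod
  set μ := (h.map (algebraMap F K)).roots.count x with hμ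
  have hdvd : ∀ j, orbitPoly F (d * j) x ∣ h ↔ j ≤ μ := by
    intro j
    have hdj : (frobeniusAlgHom F K)^[d * j] x = x :=
      ((show Function.IsPeriodicPt (frobeniusAlgHom F K) d x from hdx).mul_const j).eq
    rw [orbitPoly_dvd_iff hdj hh, orbit_mul hdx, Multiset.le_iff_count]
    have hnodup : (orbit F d x).Nodup := by
      refine Multiset.Nodup.map_on (fun i hi i' hi' hii => ?_) (Multiset.nodup_range d)
      rw [Multiset.mem_range] at hi hi'
      exact Function.iterate_injOn_Iio_minimalPeriod hi hi' hii
    have hmem : x ∈ orbit F d x :=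
      Multiset.mem_map.2 ⟨0, Multiset.mem_range.2 hd0, rfl⟩
    constructor
    · intro H
      have := H x
      rwa [Multiset.count_nsmul, Multiset.count_eq_one_of_mem hnodup hmem, mul_one] at this
    · intro hj y
      rw [Multiset.count_nsmul]
      by_cases hy : y ∈ orbit F d x
      · rw [Multiset.count_eq_one_of_mem hnodup hy, mul_one]
        obtain ⟨i, _, rfl⟩ := Multiset.mem_map.1 hy
        rwa [count_iterate_roots]
      · rw [Multiset.count_eq_zero_of_notMem hy, mul_zero]
        exact Nat.zero_le _
  have hset : ((Icc 1 h.natDegree).filter fun k =>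
      (frobeniusAlgHom F K)^[k] x = x ∧ orbitPoly F k x ∣ h) = (Icc 1 μ).image (d * ·) := by
    ext k
    simp only [mem_filter, mem_Icc, mem_image]
    constructor
    · rintro ⟨⟨h1, -⟩, h2, h3⟩
      obtain ⟨j, rfl⟩ := Function.isPeriodicPt_iff_minimalPeriod_dvd.1 h2
      refine ⟨j, ⟨?_, (hdvd j).1 h3⟩, rfl⟩
      rw [Nat.one_le_iff_ne_zero]
      rintro rfl
      simp at h1
    · rintro ⟨j, ⟨h1, h2⟩, rfl⟩
      have hdj : (frobeniusAlgHom F K)^[d * j] x = x :=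
        ((show Function.IsPeriodicPt (frobeniusAlgHom F K) d x from hdx).mul_const j).eq
      refine ⟨⟨Nat.mul_pos hd0 h1, ?_⟩, hdj, (hdvd j).2 h2⟩
      rw [← natDegree_orbitPoly hdj]
      exact natDegree_le_of_dvd ((hdvd j).2 h2) hh
  rw [hset, card_image_of_injective _ (fun i j => Nat.eq_of_mul_eq_mul_left hd0), Nat.card_Icc,
    Nat.add_sub_cancel]

open scoped Classical in
theorem sum_card_orbitPoly_dvd [IsAlgClosed K] {h : F[X]} (hh : h ≠ 0) :
    ∑ k ∈ Icc 1 h.natDegree, ((fixedPts F K k).filter fun x => orbitPoly F k x ∣ h).card =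
      h.natDegree := by
  classical
  have hhK : h.map (algebraMap F K) ≠ 0 := (Polynomial.map_ne_zero_iff
      (algebraMap F K).injective).2 hh
  have h1 : ∀ k ∈ Icc 1 h.natDegree, ((fixedPts F K k).filter fun x => orbitPoly F k x ∣ h) =
      (h.map (algebraMap F K)).roots.toFinset.filter fun x =>
        (frobeniusAlgHom F K)^[k] x = x ∧ orbitPoly F k x ∣ h := by
    intro k hk
    have hk0 : k ≠ 0 := by rw [mem_Icc] at hk; omega
    ext x
    simp only [mem_filter, Multiset.mem_toFinset, mem_fixedPts_iff hk0]
    refine ⟨fun H => ⟨?_, H⟩, fun H => H.2⟩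
    refine Multiset.mem_of_le ((orbitPoly_dvd_iff H.1 hh).1 H.2)
      (Multiset.mem_map.2 ⟨0, Multiset.mem_range.2 (Nat.pos_of_ne_zero hk0), rfl⟩)
  rw [sum_congr rfl fun k hk => congrArg card (h1 k hk)]
  simp only [card_filter]
  rw [sum_comm]
  simp only [← card_filter]
  have h2 : h.natDegree = ∑ x ∈ (h.map (algebraMap F K)).roots.toFinset,
      (h.map (algebraMap F K)).roots.count x := by
    rw [Multiset.toFinset_sum_count_eq, IsAlgClosed.card_roots_eq_natDegree, natDegree_map]
  conv_rhs => rw [h2]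
  refine sum_congr rfl fun x hx => ?_
  rw [Multiset.mem_toFinset, mem_roots hhK, IsRoot, eval_map_algebraMap] at hx
  rw [count_roots_eq_card hh hx]

theorem finite_monic_natDegree (n : ℕ) : {h : F[X] | h.Monic ∧ h.natDegree = n}.Finite := by
  refine Set.Finite.of_finite_image (f := fun h : F[X] => fun i : Fin n => h.coeff i)
    (Set.toFinite _) fun g hg h hh hgh => ?_
  ext i
  rcases lt_trichotomy i n with hi | rfl | hi
  · exact congrFun hgh ⟨i, hi⟩
  · have hg' := hg.1.coeff_natDegree
    have hh' := hh.1.coeff_natDegree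
    rw [hg.2] at hg'
    rw [hh.2] at hh'
    rw [hg', hh']
  · rw [coeff_eq_zero_of_natDegree_lt (hg.2.trans_lt hi),
      coeff_eq_zero_of_natDegree_lt (hh.2.trans_lt hi)]

/-- The monic polynomials of degree `n` over the finite field `F`. -/
noncomputable def monicPolys (F : Type*) [Field F] [Fintype F] (n : ℕ) : Finset F[X] :=
  (finite_monic_natDegree (F := F) n).toFinset

theorem mem_monicPolys {n : ℕ} {h : F[X]} : h ∈ monicPolys F n ↔ h.Monic ∧ h.natDegree = n := by
  simp [monicPolys]

/-- The coefficient of `T ^ n` in the `L`-function attached to `A`. -/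
noncomputable def coeffSum (A : F[X] →* ℂ) (n : ℕ) : ℂ := ∑ h ∈ monicPolys F n, A h

/-- The sum of `A` over the points of degree dividing `k`. -/
noncomputable def pointSum (K : Type*) [Field K] [Algebra F K] (A : F[X] →* ℂ) (k : ℕ) : ℂ :=
  ∑ x ∈ fixedPts F K k, A (orbitPoly F k x)

open scoped Classical in
theorem mul_coeffSum_sub {A : F[X] →* ℂ} {p : F[X]} (hp : p.Monic) {n : ℕ}
    (hn : p.natDegree ≤ n) :
    A p * coeffSum A (n - p.natDegree) = ∑ h ∈ monicPolys F n with p ∣ h, A h := by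
  rw [coeffSum, mul_sum]
  refine sum_bij (fun g _ => p * g) (fun g hg => ?_) (fun g _ g' _ hgg => ?_) (fun h hh => ?_)
    (fun g _ => (map_mul A p g).symm)
  · rw [mem_monicPolys] at hg
    rw [mem_filter, mem_monicPolys, hp.natDegree_mul hg.1, hg.2]
    exact ⟨⟨hp.mul hg.1, by omega⟩, dvd_mul_right _ _⟩
  · exact mul_left_cancel₀ hp.ne_zero hgg
  · rw [mem_filter, mem_monicPolys] at hh
    obtain ⟨⟨h1, h2⟩, g, rfl⟩ := hh
    have hg : g.Monic := hp.of_mul_monic_left h1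
    refine ⟨g, mem_monicPolys.2 ⟨hg, ?_⟩, rfl⟩
    rw [hp.natDegree_mul hg] at h2
    omega

theorem natCast_mul_coeffSum [IsAlgClosed K] (A : F[X] →* ℂ) (n : ℕ) :
    n * coeffSum A n = ∑ k ∈ Icc 1 n, pointSum K A k * coeffSum A (n - k) := by
  classical
  have h1 : ∀ k ∈ Icc 1 n, pointSum K A k * coeffSum A (n - k) =
      ∑ h ∈ monicPolys F n, ((fixedPts F K k).filter fun x => orbitPoly F k x ∣ h).card * A h := by
    intro k hk
    rw [mem_Icc] at hk
    rw [pointSum, sum_mul]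
    have h2 : ∀ x ∈ fixedPts F K k, A (orbitPoly F k x) * coeffSum A (n - k) =
        ∑ h ∈ monicPolys F n, if orbitPoly F k x ∣ h then A h else 0 := by
      intro x hx
      rw [mem_fixedPts_iff (by omega)] at hx
      have h3 := natDegree_orbitPoly hx
      rw [← sum_filter, ← mul_coeffSum_sub (monic_orbitPoly hx) (h3.trans_le hk.2), h3]
    rw [sum_congr rfl h2, sum_comm]
    refine sum_congr rfl fun h _ => ?_
    rw [← sum_filter, sum_const, nsmul_eq_mul]
  rw [sum_congr rfl h1, sum_comm, coeffSum, mul_sum]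
  refine sum_congr rfl fun h hh => ?_
  rw [mem_monicPolys] at hh
  rw [← sum_mul, ← Nat.cast_sum]
  congr 2
  rw [← hh.2, sum_card_orbitPoly_dvd hh.1.ne_zero]

theorem coeffSum_zero (A : F[X] →* ℂ) : coeffSum A 0 = 1 := by
  have : monicPolys F 0 = {1} := by
    ext h
    rw [mem_monicPolys, mem_singleton]
    refine ⟨fun H => H.1.natDegree_eq_zero.1 H.2, ?_⟩
    rintro rfl
    exact ⟨monic_one, natDegree_one⟩
  rw [coeffSum, this, sum_singleton, map_one]

theorem sum_monicPolys_eq_zero {B : F[X] →* ℂ} {m : F[X]} (hm : m.Monic)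
    (hB : ∀ g h, m ∣ g - h → B g = B h) {t : F[X]} (ht : IsCoprime m t) (ht1 : B t ≠ 1)
    {n : ℕ} (hn : m.natDegree ≤ n) : ∑ h ∈ monicPolys F n, B h = 0 := by
  classical
  let e : F[X] → F[X] := fun h => h + ((t * h) %ₘ m - h %ₘ m)
  have hmod : ∀ g, m ∣ g - g %ₘ m := fun g => ⟨g /ₘ m, by
    rw [sub_eq_iff_eq_add, add_comm, modByMonic_add_div g m]⟩
  have he : ∀ h, m ∣ e h - t * h := fun h => by
    have : e h - t * h = (h - h %ₘ m) - (t * h - (t * h) %ₘ m) := by simp only [e]; ring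
    rw [this]
    exact dvd_sub (hmod _) (hmod _)
  have hinj : Function.Injective e := by
    intro g h hgh
    have h1 : m ∣ t * (g - h) := by
      have := dvd_sub (he h) (he g)
      rw [hgh] at this
      convert this using 1; ring
    have h2 : m ∣ g - h := ht.dvd_of_dvd_mul_left h1
    have h3 : g %ₘ m = h %ₘ m := by
      rw [← sub_eq_zero, ← sub_modByMonic, (modByMonic_eq_zero_iff_dvd hm).2 h2]
    have h4 : (t * g) %ₘ m = (t * h) %ₘ m := by
      rw [← sub_eq_zero, ← sub_modByMonic, ← mul_sub, (modByMonic_eq_zero_iff_dvd hm).2 h1]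
    simpa [e, h3, h4] using hgh
  have hmaps : ∀ h ∈ monicPolys F n, e h ∈ monicPolys F n := by
    intro h hh
    rw [mem_monicPolys] at hh ⊢
    have hdeg : ((t * h) %ₘ m - h %ₘ m).degree < h.degree := by
      refine (degree_sub_le _ _).trans_lt ?_
      have : m.degree ≤ h.degree := by
        rw [degree_eq_natDegree hm.ne_zero, degree_eq_natDegree hh.1.ne_zero, hh.2]
        exact_mod_cast hn
      exact max_lt ((degree_modByMonic_lt _ hm).trans_le this)
        ((degree_modByMonic_lt _ hm).trans_le this)
    exact ⟨hh.1.add_of_left hdeg, by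
      rw [← hh.2]; exact natDegree_add_eq_left_of_degree_lt hdeg⟩
  have himage : (monicPolys F n).image e = monicPolys F n :=
    eq_of_subset_of_card_le (image_subset_iff.2 hmaps) (card_image_of_injective _ hinj).ge
  have hsum : ∑ h ∈ monicPolys F n, B h = B t * ∑ h ∈ monicPolys F n, B h := by
    conv_lhs => rw [← himage, sum_image hinj.injOn]
    rw [mul_sum]
    exact sum_congr rfl fun h _ => by rw [hB _ _ (he h), map_mul]
  have : (B t - 1) * ∑ h ∈ monicPolys F n, B h = 0 := by
    rw [sub_mul, one_mul, ← hsum, sub_self]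
  exact (mul_eq_zero.1 this).resolve_left (sub_ne_zero.2 ht1)

end FiniteFieldCharSum

namespace FiniteFieldCharSum

open Finset FiniteField

theorem le_one_of_forall_pow_le {z C : ℝ} (h : ∀ k, 3 ≤ k → z ^ k ≤ C) : z ≤ 1 := by
  by_contra! hz
  obtain ⟨n, hn⟩ := pow_unbounded_of_one_lt C hz
  have h1 := h (n + 3) (by omega)
  have h2 : z ^ n ≤ z ^ (n + 3) := pow_le_pow_right₀ hz.le (by omega)
  linarith

theorem norm_le_one_of_norm_pow_add_pow_le {u v : ℂ} {C : ℝ}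
    (h : ∀ k, 3 ≤ k → ‖u ^ k + v ^ k‖ ≤ C) : ‖u‖ ≤ 1 := by
  have huv : ‖u * v‖ ≤ 1 := by
    refine le_one_of_forall_pow_le (C := (C ^ 2 + C) / 2) fun k hk => ?_
    have h1 : 2 * (u * v) ^ k = (u ^ k + v ^ k) ^ 2 - (u ^ (2 * k) + v ^ (2 * k)) := by
      rw [mul_pow]; ring
    have h2 : ‖2 * (u * v) ^ k‖ ≤ C ^ 2 + C := by
      rw [h1]
      refine (norm_sub_le _ _).trans (add_le_add ?_ (h _ (by omega)))
      rw [norm_pow]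
      exact pow_le_pow_left₀ (norm_nonneg _) (h k hk) 2
    rw [norm_mul, norm_pow, Complex.norm_ofNat] at h2
    linarith
  by_contra! hu
  have hv : ‖v‖ ≤ 1 := by
    rw [norm_mul] at huv
    by_contra! hv
    nlinarith
  refine hu.not_ge (le_one_of_forall_pow_le (C := C + 1) fun k hk => ?_)
  have h1 : u ^ k = (u ^ k + v ^ k) - v ^ k := by ring
  have h2 := h k hk
  have h3 : ‖v ^ k‖ ≤ 1 := by rw [norm_pow]; exact pow_le_one₀ (norm_nonneg _) hv
  rw [← norm_pow, h1]
  exact (norm_sub_le _ _).trans (add_le_add h2 h3)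

theorem newton_degree_two {c S : ℕ → ℂ} (h0 : c 0 = 1)
    (hnewton : ∀ n : ℕ, n * c n = ∑ k ∈ Icc 1 n, S k * c (n - k)) (hc : ∀ n, 3 ≤ n → c n = 0)
    {u v : ℂ} (huv : u + v = -c 1) (huv' : u * v = c 2) (n : ℕ) :
    S (n + 1) = -(u ^ (n + 1) + v ^ (n + 1)) := by
  have h1 : S 1 = c 1 := by simpa [h0] using (hnewton 1).symm
  have h2 : S 2 = 2 * c 2 - c 1 ^ 2 := by
    have := hnewton 2
    rw [show Icc 1 2 = ({1, 2} : Finset ℕ) from rfl, sum_pair (by norm_num)] at this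
    simp only [Nat.cast_ofNat, h1, Nat.reduceSub, h0] at this
    rw [this]; ring
  have hrec : ∀ m, S (m + 3) = -c 1 * S (m + 2) - c 2 * S (m + 1) := by
    intro m
    have := hnewton (m + 3)
    rw [hc _ (by omega), mul_zero, ← sum_subset (s₁ := {m + 1, m + 2, m + 3})
      (fun k hk => by simp only [mem_insert, mem_singleton] at hk; rw [mem_Icc]; omega)
      (fun k hk hk' => by
        simp only [mem_insert, mem_singleton] at hk'
        rw [mem_Icc] at hk
        rw [hc _ (by omega), mul_zero]),
      sum_insert (by simp), sum_pair (by simp), show m + 3 - (m + 1) = 2 by omega,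
      show m + 3 - (m + 2) = 1 by omega, Nat.sub_self, h0] at this
    linear_combination -this
  induction n using Nat.strong_induction_on with
  | _ n ih =>
    match n with
    | 0 => rw [h1]; linear_combination huv
    | 1 => rw [h2]; linear_combination (u + v - c 1) * huv - 2 * huv'
    | n + 2 =>
      rw [hrec, ih (n + 1) (by omega), ih n (by omega)]
      linear_combination (u ^ (n + 2) + v ^ (n + 2)) * huv - (u ^ (n + 1) + v ^ (n + 1)) * huv'

theorem norm_le_of_newton_degree_two {c S : ℕ → ℂ} (h0 : c 0 = 1)
    (hnewton : ∀ n : ℕ, n * c n = ∑ k ∈ Icc 1 n, S k * c (n - k)) (hc : ∀ n, 3 ≤ n → c n = 0)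
    {R C : ℝ} (hR : 0 < R) (hS : ∀ k, 3 ≤ k → ‖S (2 * k)‖ ≤ C * R ^ (2 * k)) :
    ‖S 1‖ ≤ 2 * R := by
  obtain ⟨d, hd⟩ := IsAlgClosed.exists_pow_nat_eq (c 1 ^ 2 - 4 * c 2) two_pos
  have hsum : ∀ {u v : ℂ}, u + v = -c 1 → u * v = c 2 → ‖u‖ ≤ R := by
    intro u v huv huv'
    have hR' : (R : ℂ) ≠ 0 := by exact_mod_cast hR.ne'
    have h1 : ‖(u / R) ^ 2‖ ≤ 1 := by
      refine norm_le_one_of_norm_pow_add_pow_le (v := (v / R) ^ 2) (C := C) fun k hk => ?_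
      have h2 := newton_degree_two h0 hnewton hc huv huv' (2 * k - 1)
      rw [Nat.sub_add_cancel (by omega)] at h2
      have h3 := hS k hk
      rw [h2, norm_neg] at h3
      rw [← pow_mul, ← pow_mul, div_pow, div_pow, ← add_div, norm_div, norm_pow (R : ℂ),
        Complex.norm_real, Real.norm_of_nonneg hR.le, div_le_iff₀ (pow_pos hR _)]
      exact h3
    rw [norm_pow, norm_div, Complex.norm_real, Real.norm_of_nonneg hR.le] at h1
    have h4 := (sq_le_one_iff₀ (by positivity)).1 h1
    rwa [div_le_one hR] at h4
  have h1 := newton_degree_two h0 hnewton hc (u := (-c 1 + d) / 2) (v := (-c 1 - d) / 2)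
    (by ring) (by linear_combination -hd / 4) 0
  have h2 := hsum (u := (-c 1 + d) / 2) (v := (-c 1 - d) / 2)
    (by ring) (by linear_combination -hd / 4)
  have h3 := hsum (u := (-c 1 - d) / 2) (v := (-c 1 + d) / 2)
    (by ring) (by linear_combination -hd / 4)
  rw [h1, norm_neg, zero_add, pow_one, pow_one, two_mul]
  exact (norm_add_le _ _).trans (add_le_add h2 h3)

variable {F : Type*} [Field F] {K : Type*} [Field K] [Algebra F K]

/-- The map `h ↦ h(s) h(t)`, when it takes values in the base field. -/
noncomputable def pairNorm {s t : K}
    (H : ∀ h : F[X], ∃ u : F, algebraMap F K u = aeval s h * aeval t h) : F[X] →* F where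
  toFun h := (H h).choose
  map_one' := (algebraMap F K).injective <| by rw [(H 1).choose_spec]; simp
  map_mul' g h := (algebraMap F K).injective <| by
    rw [(H _).choose_spec, map_mul, map_mul, map_mul, (H g).choose_spec, (H h).choose_spec]
    ring

theorem algebraMap_pairNorm {s t : K}
    (H : ∀ h : F[X], ∃ u : F, algebraMap F K u = aeval s h * aeval t h) (h : F[X]) :
    algebraMap F K (pairNorm H h) = aeval s h * aeval t h :=
  (H h).choose_spec

/-- The multiplicative function `h ↦ χ₁(h(0)) χ₂(h(s) h(t))`. -/
noncomputable def polyChar (χ₁ χ₂ : MulChar F ℂ) {s t : K}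
    (H : ∀ h : F[X], ∃ u : F, algebraMap F K u = aeval s h * aeval t h) : F[X] →* ℂ where
  toFun h := χ₁ (h.eval 0) * χ₂ (pairNorm H h)
  map_one' := by simp
  map_mul' g h := by simp only [eval_mul, map_mul]; ring

theorem polyChar_congr (χ₁ χ₂ : MulChar F ℂ) {s t : K}
    (H : ∀ h : F[X], ∃ u : F, algebraMap F K u = aeval s h * aeval t h) {m : F[X]}
    (hm0 : m.eval 0 = 0) (hms : aeval s m = 0) (hmt : aeval t m = 0) {g h : F[X]}
    (hgh : m ∣ g - h) : polyChar χ₁ χ₂ H g = polyChar χ₁ χ₂ H h := by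
  obtain ⟨r, hr⟩ := hgh
  obtain rfl : g = h + m * r := by rw [← hr]; ring
  have h1 : pairNorm H (h + m * r) = pairNorm H h := by
    refine (algebraMap F K).injective ?_
    simp [algebraMap_pairNorm, hms, hmt]
  change χ₁ _ * χ₂ _ = χ₁ _ * χ₂ _
  rw [h1, eval_add, eval_mul, hm0, zero_mul, add_zero]

variable [Fintype F]

local notation "q" => Fintype.card F

theorem exists_algebraMap_eq_mul {f : F[X]} {s t : K} (hst : s ≠ t)
    (hs : ∀ x : K, aeval x f = 0 ↔ x = s ∨ x = t) (h : F[X]) :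
    ∃ u : F, algebraMap F K u = aeval s h * aeval t h := by
  refine exists_algebraMap_eq ?_
  have hpow : ∀ x : K, aeval (x ^ q) h = aeval x h ^ q := fun x => by
    simpa using (aeval_pow_card h x 1).symm
  have hroot : ∀ x : K, aeval x f = 0 → x ^ q = s ∨ x ^ q = t := fun x hx => by
    rw [← hs, ← pow_one q, ← aeval_pow_card, hx, zero_pow]
    simp
  have hne : s ^ q ≠ t ^ q := fun he => hst ((frobeniusAlgHom F K).injective he)
  rw [mul_pow, ← hpow, ← hpow]
  rcases hroot s ((hs s).2 (Or.inl rfl)) with h1 | h1 <;>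
    rcases hroot t ((hs t).2 (Or.inr rfl)) with h2 | h2
  · exact absurd (h1.trans h2.symm) hne
  · rw [h1, h2]
  · rw [h1, h2, mul_comm]
  · exact absurd (h1.trans h2.symm) hne

theorem aeval_orbitPoly {k : ℕ} {x : K} (hx : (frobeniusAlgHom F K)^[k] x = x) (z : K) :
    aeval z (orbitPoly F k x) = ∏ i ∈ range k, (z - x ^ q ^ i) := by
  rw [← eval_map_algebraMap, map_orbitPoly hx, eval_multiset_prod, orbit, Multiset.map_map,
    Multiset.map_map]
  simp only [Function.comp_def, frobenius_iterate, eval_sub, eval_X, eval_C]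
  rfl

theorem pow_mul_polyChar_orbitPoly (χ₁ χ₂ : MulChar F ℂ) {f : F[X]} {s t : K}
    (H : ∀ h : F[X], ∃ u : F, algebraMap F K u = aeval s h * aeval t h) {a : F}
    (hf : ∀ x : K, aeval x f = algebraMap F K a * (s - x) * (t - x)) {k : ℕ} {x : K}
    (hx : (frobeniusAlgHom F K)^[k] x = x) :
    (χ₁ (-1) * χ₂ a) ^ k * polyChar χ₁ χ₂ H (orbitPoly F k x) = liftedTerm χ₁ χ₂ f k x := by
  have hu : x ^ normExp F k = algebraMap F K ((-1) ^ k * (orbitPoly F k x).eval 0) := by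
    rw [map_mul, ← aeval_algebraMap_apply_eq_algebraMap_eval, map_zero, aeval_orbitPoly hx]
    simp only [zero_sub, prod_neg, card_range, map_pow, map_neg, map_one, ← mul_assoc, ← mul_pow]
    rw [prod_pow_eq_pow_sum]
    simp [normExp]
  have hv : (aeval x f) ^ normExp F k =
      algebraMap F K (a ^ k * pairNorm H (orbitPoly F k x)) := by
    rw [map_mul, algebraMap_pairNorm, aeval_orbitPoly hx, aeval_orbitPoly hx, map_pow,
      ← prod_mul_distrib]
    nth_rewrite 2 [← card_range k]
    rw [← prod_const, ← prod_mul_distrib, normExp, ← prod_pow_eq_pow_sum]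
    refine prod_congr rfl fun i _ => ?_
    rw [aeval_pow_card, hf, mul_assoc]
  rw [liftedTerm_eq hu hv, map_mul, map_mul, map_pow, map_pow]
  change _ * (χ₁ _ * χ₂ _) = _
  ring

/-- The Weil bound for the sums attached to a pair of multiplicative characters and a quadratic
polynomial. -/
theorem norm_sum_mulChar_mul_mulChar_le [IsAlgClosed K] {f : F[X]} {a : F} {s t : K} (ha : a ≠ 0)
    (hfd : f.natDegree = 2) (hfa : f.leadingCoeff = a)
    (hf : ∀ x : K, aeval x f = algebraMap F K a * (s - x) * (t - x)) (hst : s ≠ t) (hs0 : s ≠ 0)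
    (hs1 : aeval s (derivative f) ≠ 0) (hq : 3 ≤ q) {χ₁ χ₂ : MulChar F ℂ}
    (hχ : ¬(χ₁ = 1 ∧ χ₂ = 1)) :
    ‖∑ x : F, χ₁ x * χ₂ (f.eval x)‖ ≤ 2 * √q := by
  have hroots : ∀ x : K, aeval x f = 0 ↔ x = s ∨ x = t := fun x => by
    rw [hf, mul_eq_zero, mul_eq_zero, sub_eq_zero, sub_eq_zero, eq_comm (a := s),
      eq_comm (a := t)]
    simp [ha]
  have hs : aeval s f = 0 := (hroots s).2 (Or.inl rfl)
  have ht : aeval t f = 0 := (hroots t).2 (Or.inr rfl)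
  have H := exists_algebraMap_eq_mul hst hroots
  set B := polyChar χ₁ χ₂ H
  set κ := χ₁ (-1) * χ₂ a with hκ
  have hκ1 : ‖κ‖ = 1 := by
    rw [norm_mul, norm_mulChar_of_ne_zero χ₁ (neg_ne_zero.2 one_ne_zero),
      norm_mulChar_of_ne_zero χ₂ ha, one_mul]
  have hpoint : ∀ k ≠ 0, κ ^ k * pointSum K B k = liftedSum K χ₁ χ₂ f k := by
    intro k hk
    rw [pointSum, liftedSum, mul_sum]
    exact sum_congr rfl fun x hx =>
      pow_mul_polyChar_orbitPoly χ₁ χ₂ H hf ((mem_fixedPts_iff hk).1 hx)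
  have hnorm : ∀ k ≠ 0, ‖pointSum K B k‖ = ‖liftedSum K χ₁ χ₂ f k‖ := by
    intro k hk
    rw [← hpoint k hk, norm_mul, norm_pow, hκ1, one_pow, one_mul]
  have hvanish : ∀ n, 3 ≤ n → coeffSum B n = 0 := by
    intro n hn
    obtain ⟨k, hk, ⟨l, hl⟩, x, hx, hx0, hfx, hne⟩ :=
      exists_liftedTerm_ne_one hfd.le hs0 hs hs1 hq hχ
    rw [mem_fixedPts_iff hk] at hx
    have hm : (X * (C a⁻¹ * f)).Monic :=
      monic_X.mul (monic_C_mul_of_mul_leadingCoeff_eq_one (by rw [hfa, inv_mul_cancel₀ ha]))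
    refine sum_monicPolys_eq_zero hm (t := orbitPoly F k x) (fun g h hgh =>
      polyChar_congr χ₁ χ₂ H (by simp) (by simp [hs]) (by simp [ht]) hgh) ?_ ?_ ?_
    · rw [isCoprime_iff_aeval_ne_zero_of_isAlgClosed F K]
      by_contra! hz
      obtain ⟨z, hz1, hz2⟩ := hz
      rw [aeval_orbitPoly hx, prod_eq_zero_iff] at hz2
      obtain ⟨i, -, hi⟩ := hz2
      rw [sub_eq_zero] at hi
      rw [map_mul, map_mul, aeval_X, aeval_C, mul_eq_zero, mul_eq_zero, hi, ← aeval_pow_card] at hz1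
      simp [hx0, hfx, ha] at hz1
    · intro h1
      refine hne ?_
      rw [← pow_mul_polyChar_orbitPoly χ₁ χ₂ H hf hx]
      change κ ^ k * B _ = 1
      rw [h1, mul_one, hκ, mul_pow, ← map_pow, ← map_pow, hl, pow_mul, pow_mul,
        pow_card_sub_one_eq_one a ha, pow_card_sub_one_eq_one _ (neg_ne_zero.2 one_ne_zero)]
      simp
    · rw [natDegree_mul X_ne_zero (mul_ne_zero (by simpa using ha) (by rintro rfl; simp at hfd)),
        natDegree_X, natDegree_C_mul (inv_ne_zero ha), hfd]
      exact hn
  have hq0 : (0 : ℝ) < q := by exact_mod_cast (show 0 < q by omega)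
  have h1 := norm_le_of_newton_degree_two (coeffSum_zero B) (natCast_mul_coeffSum (K := K) B)
    hvanish (Real.sqrt_pos.2 hq0) (C := 4 * (q - 1 : ℝ) ^ 2 + 3) fun k hk => by
      rw [hnorm _ (by omega), pow_mul √_, Real.sq_sqrt hq0.le]
      exact norm_liftedSum_le hfd.le hs0 hs hs1 hq hχ hk
  rw [hnorm 1 one_ne_zero] at h1
  convert h1 using 2
  rw [liftedSum]
  refine sum_bij (fun x _ => algebraMap F K x) (fun x _ => ?_) (fun x _ y _ h => ?_)
    (fun x hx => ?_) (fun x _ => ?_)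
  · rw [mem_fixedPts one_ne_zero, pow_one, ← map_pow, FiniteField.pow_card]
  · exact (algebraMap F K).injective h
  · rw [mem_fixedPts one_ne_zero, pow_one] at hx
    obtain ⟨u, hu⟩ := exists_algebraMap_eq hx
    exact ⟨u, mem_univ _, hu⟩
  · refine (liftedTerm_eq ?_ ?_).symm
    · simp [normExp]
    · simp [normExp, aeval_algebraMap_apply_eq_algebraMap_eval]

end FiniteFieldCharSum

namespace FiniteFieldCharSum

open Finset

variable {F : Type*} [Field F]

theorem prod_mulChar_ne_one {ψ : ℕ → MulChar F ℂ} {T D : Finset ℕ} (hT : ∀ l ∈ T, l.Prime)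
    (hψ : ∀ l ∈ T, orderOf (ψ l) = l) (hD : D ⊆ T) (hne : D.Nonempty) : ∏ l ∈ D, ψ l ≠ 1 := by
  classical
  intro h
  obtain ⟨l, hl⟩ := hne
  have h1 : ψ l ^ (∏ i ∈ D.erase l, i) = 1 := by
    have h2 : (∏ i ∈ D.erase l, ψ i) ^ (∏ i ∈ D.erase l, i) = 1 := by
      rw [← prod_pow]
      refine prod_eq_one fun i hi => ?_
      rw [← orderOf_dvd_iff_pow_eq_one, hψ i (hD (mem_of_mem_erase hi))]
      exact dvd_prod_of_mem _ hi
    rw [← mul_prod_erase D ψ hl] at h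
    have h3 := congrArg (· ^ ∏ i ∈ D.erase l, i) h
    simpa [mul_pow, h2] using h3
  rw [← orderOf_dvd_iff_pow_eq_one, hψ l (hD hl), (hT l (hD hl)).prime.dvd_finsetProd_iff] at h1
  obtain ⟨i, hi, hli⟩ := h1
  rw [Nat.prime_dvd_prime_iff_eq (hT l (hD hl)) (hT i (hD (mem_of_mem_erase hi)))] at hli
  exact ne_of_mem_erase hi hli.symm

theorem prod_mulChar_apply (ψ : ℕ → MulChar F ℂ) (D : Finset ℕ) {y : F} (hy : y ≠ 0) :
    (∏ l ∈ D, ψ l) y = ∏ l ∈ D, ψ l y := by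
  classical
  induction D using Finset.induction_on with
  | empty => simp [MulChar.one_apply hy.isUnit]
  | insert l D hl ih => rw [prod_insert hl, prod_insert hl, MulChar.mul_apply, ih]

/-- The sieve weight attached to the characters `ψ l`, `l ∈ T`. It vanishes at every
nonzero `y` with `ψ l y = 1` for some `l ∈ T`. -/
noncomputable def sieveWeight (ψ : ℕ → MulChar F ℂ) (T : Finset ℕ) (y : F) : ℂ :=
  ∑ D ∈ T.powerset, (-1) ^ D.card * (∏ l ∈ D, ψ l) y

theorem sieveWeight_zero (ψ : ℕ → MulChar F ℂ) (T : Finset ℕ) : sieveWeight ψ T (0 : F) = 0 :=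
  sum_eq_zero fun D _ => by rw [MulChar.map_zero, mul_zero]

theorem sieveWeight_eq_zero {ψ : ℕ → MulChar F ℂ} {T : Finset ℕ} {y : F} (hy : y ≠ 0) {l : ℕ}
    (hl : l ∈ T) (hψ : ψ l y = 1) : sieveWeight ψ T y = 0 := by
  have h : sieveWeight ψ T y = ∏ l ∈ T, (1 + -ψ l y) := by
    rw [prod_one_add, sieveWeight]
    refine sum_congr rfl fun D _ => ?_
    rw [prod_neg, prod_mulChar_apply ψ D hy]
  rw [h]
  exact prod_eq_zero hl (by rw [hψ, add_neg_cancel])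

variable [Fintype F]

local notation "q" => Fintype.card F

theorem exists_mulChar_orderOf_eq {l : ℕ} (hl : l ∈ (q - 1).primeFactors) :
    ∃ ψ : MulChar F ℂ, orderOf ψ = l := by
  have hp : Fact l.Prime := ⟨Nat.prime_of_mem_primeFactors hl⟩
  have hcard : Nat.card (MulChar F ℂ) = q - 1 := by
    classical
    rw [MulChar.card_eq_card_units_of_hasEnoughRootsOfUnity, Nat.card_eq_fintype_card,
      Fintype.card_units]
  exact exists_prime_orderOf_dvd_card' l (hcard ▸ Nat.dvd_of_mem_primeFactors hl)

theorem exists_pow_eq_of_not_isPrimitiveRoot {y : F} (hy0 : y ≠ 0)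
    (hy : ¬IsPrimitiveRoot y (q - 1)) : ∃ l ∈ (q - 1).primeFactors, ∃ z : F, z ≠ 0 ∧ y = z ^ l := by
  classical
  obtain ⟨g, hg⟩ := IsCyclic.exists_generator (α := Fˣ)
  have hgo : orderOf g = q - 1 := by
    rw [orderOf_eq_card_of_forall_mem_zpowers hg, Nat.card_eq_fintype_card, Fintype.card_units]
  obtain ⟨j, hj⟩ := mem_powers_iff_mem_zpowers.2 (hg (Units.mk0 y hy0))
  simp only at hj
  have hyg : y = (g : F) ^ j := by
    have := congrArg Units.val hj
    simpa using this.symm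
  have hcop : ¬j.Coprime (q - 1) := by
    intro hcop
    refine hy ?_
    rw [hyg]
    refine IsPrimitiveRoot.pow_of_coprime ?_ j hcop
    rw [IsPrimitiveRoot.coe_units_iff, ← hgo]
    exact IsPrimitiveRoot.orderOf g
  obtain ⟨l, hl, hlj, hlq⟩ := Nat.Prime.not_coprime_iff_dvd.1 hcop
  have hq : q - 1 ≠ 0 := by have := Fintype.one_lt_card (α := F); omega
  refine ⟨l, Nat.mem_primeFactors.2 ⟨hl, hlq, hq⟩, ?_⟩
  obtain ⟨i, rfl⟩ := hlj
  exact ⟨(g : F) ^ i, pow_ne_zero _ g.ne_zero, by rw [hyg, ← pow_mul, mul_comm]⟩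

theorem exists_isPrimitiveRoot_eval {f : F[X]} (hf0 : f ≠ 0) (hf : f.natDegree ≤ 2)
    (hbound : ∀ χ₁ χ₂ : MulChar F ℂ, ¬(χ₁ = 1 ∧ χ₂ = 1) →
      ‖∑ x : F, χ₁ x * χ₂ (f.eval x)‖ ≤ 2 * √q)
    (hq : 4 * (2 ^ (q - 1).primeFactors.card) ^ 4 < q) :
    ∃ g : F, IsPrimitiveRoot g (q - 1) ∧ IsPrimitiveRoot (f.eval g) (q - 1) := by
  classical
  by_contra! hall
  set T := (q - 1).primeFactors with hT
  choose! ψ hψ using fun (l : ℕ) (hl : l ∈ T) => exists_mulChar_orderOf_eq (F := F) hl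
  have hweight : ∀ y : F, ¬IsPrimitiveRoot y (q - 1) → sieveWeight ψ T y = 0 := by
    intro y hy
    by_cases hy0 : y = 0
    · rw [hy0, sieveWeight_zero]
    obtain ⟨l, hl, z, hz, rfl⟩ := exists_pow_eq_of_not_isPrimitiveRoot hy0 hy
    refine sieveWeight_eq_zero hy0 hl ?_
    rw [map_pow, ← MulChar.pow_apply' _ (Nat.prime_of_mem_primeFactors hl).ne_zero]
    nth_rewrite 2 [← hψ l hl]
    rw [pow_orderOf_eq_one, MulChar.one_apply hz.isUnit]
  set S : MulChar F ℂ → MulChar F ℂ → ℂ := fun χ₁ χ₂ => ∑ x : F, χ₁ x * χ₂ (f.eval x) with hS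
  have hexpand : ∑ p ∈ T.powerset ×ˢ T.powerset, (-1) ^ p.1.card * (-1) ^ p.2.card *
      S (∏ l ∈ p.1, ψ l) (∏ l ∈ p.2, ψ l) = 0 := by
    have h1 : ∑ x : F, sieveWeight ψ T x * sieveWeight ψ T (f.eval x) = 0 := by
      refine sum_eq_zero fun x _ => ?_
      by_cases hx : IsPrimitiveRoot x (q - 1)
      · rw [hweight _ (hall x hx), mul_zero]
      · rw [hweight _ hx, zero_mul]
    simp only [sieveWeight, sum_mul_sum, ← sum_product'] at h1
    rw [sum_product_right] at h1
    rw [← h1]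
    refine sum_congr rfl fun p _ => ?_
    rw [hS, mul_sum]
    exact sum_congr rfl fun x _ => by ring
  have hmem : ((∅, ∅) : Finset ℕ × Finset ℕ) ∈ T.powerset ×ˢ T.powerset := by simp
  rw [← add_sum_erase _ _ hmem] at hexpand
  have hmain : (q : ℝ) - 3 ≤ ‖S 1 1‖ := by
    have h1 : S 1 1 = ((univ.filter fun x : F => x ≠ 0 ∧ f.eval x ≠ 0).card : ℂ) := by
      rw [hS, card_filter, Nat.cast_sum]
      refine sum_congr rfl fun x _ => ?_
      by_cases h1 : x = 0
      · simp [h1, MulChar.map_zero]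
      by_cases h2 : f.eval x = 0
      · simp [h2, MulChar.map_zero]
      · simp [h1, h2, MulChar.one_apply (Ne.isUnit h1), MulChar.one_apply (Ne.isUnit h2)]
    have h2 : (univ : Finset F) ⊆ (univ.filter fun x : F => x ≠ 0 ∧ f.eval x ≠ 0) ∪
        insert 0 f.roots.toFinset := by
      intro x _
      simp only [mem_union, mem_filter, mem_insert, Multiset.mem_toFinset, mem_roots hf0, IsRoot]
      tauto
    have h3 : q ≤ (univ.filter fun x : F => x ≠ 0 ∧ f.eval x ≠ 0).card + 3 := by
      refine (card_le_card h2).trans ((card_union_le _ _).trans (Nat.add_le_add_left ?_ _))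
      refine (card_insert_le _ _).trans (Nat.succ_le_succ ?_)
      exact (Multiset.toFinset_card_le _).trans ((card_roots' _).trans hf)
    rw [h1, Complex.norm_natCast, sub_le_iff_le_add]
    exact_mod_cast h3
  set w : ℕ := 2 ^ T.card with hw
  have hrest : ‖∑ p ∈ (T.powerset ×ˢ T.powerset).erase (∅, ∅), (-1) ^ p.1.card *
      (-1) ^ p.2.card * S (∏ l ∈ p.1, ψ l) (∏ l ∈ p.2, ψ l)‖ ≤ ((w : ℝ) ^ 2 - 1) * (2 * √q) := by
    have hcard : (((T.powerset ×ˢ T.powerset).erase (∅, ∅)).card : ℝ) = (w : ℝ) ^ 2 - 1 := by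
      rw [card_erase_of_mem hmem, card_product, card_powerset, ← hw, Nat.cast_sub, Nat.cast_mul,
        Nat.cast_one, sq]
      have : 0 < w := by positivity
      exact Nat.mul_pos this this
    rw [← hcard, ← nsmul_eq_mul]
    refine norm_sum_le_of_le _ (fun p hp => ?_) |>.trans_eq (sum_const _)
    rw [norm_mul, norm_mul, norm_pow, norm_pow, norm_neg, norm_one, one_pow, one_pow, one_mul,
      one_mul]
    rw [mem_erase, mem_product, mem_powerset, mem_powerset] at hp
    have hprime : ∀ l ∈ T, l.Prime := fun l hl => Nat.prime_of_mem_primeFactors hl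
    refine hbound _ _ fun h => hp.1 ?_
    ext1
    · by_contra h1
      exact prod_mulChar_ne_one hprime hψ hp.2.1 (nonempty_iff_ne_empty.2 h1) h.1
    · by_contra h1
      exact prod_mulChar_ne_one hprime hψ hp.2.2 (nonempty_iff_ne_empty.2 h1) h.2
  have hle : (q : ℝ) - 3 ≤ ((w : ℝ) ^ 2 - 1) * (2 * √q) := by
    rw [add_eq_zero_iff_eq_neg] at hexpand
    simp only [card_empty, pow_zero, one_mul, prod_empty] at hexpand
    rw [hexpand, norm_neg] at hmain
    exact hmain.trans hrest
  have hw1 : (1 : ℝ) ≤ w := by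
    have : 0 < w := by positivity
    exact_mod_cast this
  have hsqrt : 2 * (w : ℝ) ^ 2 < √q := by
    rw [Real.lt_sqrt (by positivity)]
    have : (4 : ℝ) * w ^ 4 < q := by exact_mod_cast hq
    linarith [show (2 * (w : ℝ) ^ 2) ^ 2 = 4 * w ^ 4 by ring]
  have hsq : √q * √q = (q : ℝ) := Real.mul_self_sqrt (Nat.cast_nonneg _)
  have h2 : 2 ≤ √(q : ℝ) := by nlinarith
  nlinarith

theorem exists_quadratic_roots {F : Type*} [Field F] {a b c : F} (ha : a ≠ 0)
    (hdisc : b ^ 2 - 4 * a * c ≠ 0) (K : Type*) [Field K] [Algebra F K] [IsAlgClosed K] :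
    ∃ s t : K, (∀ x : K, aeval x (C a * X ^ 2 + C b * X + C c) =
      algebraMap F K a * (s - x) * (t - x)) ∧ s ≠ t ∧ s ≠ 0 := by
  have ha' : algebraMap F K a ≠ 0 := (_root_.map_ne_zero _).2 ha
  obtain ⟨s, hs⟩ := IsAlgClosed.exists_aeval_eq_zero K (C a * X ^ 2 + C b * X + C c)
    (by rw [degree_quadratic ha]; decide)
  simp only [map_add, map_mul, map_pow, aeval_C, aeval_X] at hs
  obtain ⟨t, ht⟩ : ∃ t : K, algebraMap F K a * (s + t) = -algebraMap F K b :=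
    ⟨-algebraMap F K b / algebraMap F K a - s, by field_simp; ring⟩
  have hf : ∀ x : K, aeval x (C a * X ^ 2 + C b * X + C c) =
      algebraMap F K a * (s - x) * (t - x) := by
    intro x
    simp only [map_add, map_mul, map_pow, aeval_C, aeval_X]
    linear_combination hs + (x - s) * ht
  have hst : s ≠ t := by
    rintro rfl
    refine hdisc ((map_eq_zero (algebraMap F K)).1 ?_)
    simp only [map_sub, map_mul, map_pow, map_ofNat]
    linear_combination (algebraMap F K b + 2 * algebraMap F K a * s) * ht -
      4 * algebraMap F K a * hs
  by_cases hs0 : s = 0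
  · exact ⟨t, s, fun x => by rw [hf, mul_right_comm], hst.symm, fun ht0 => hst (hs0.trans ht0.symm)⟩
  · exact ⟨s, t, hf, hst, hs0⟩

theorem exists_isPrimitiveRoot_quadratic {F : Type*} [Field F] [Fintype F] {a b c : F}
    (ha : a ≠ 0) (hdisc : b ^ 2 - 4 * a * c ≠ 0)
    (hq : 4 * W (Fintype.card F - 1) ^ 4 < Fintype.card F) :
    ∃ g : F, IsPrimitiveRoot g (Fintype.card F - 1) ∧
      IsPrimitiveRoot ((C a * X ^ 2 + C b * X + C c).eval g) (Fintype.card F - 1) := by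
  obtain ⟨s, t, hf, hst, hs0⟩ := exists_quadratic_roots ha hdisc (AlgebraicClosure F)
  have hfd := natDegree_quadratic (b := b) (c := c) ha
  have hW : 0 < W (Fintype.card F - 1) := by unfold W; positivity
  have hq3 : 3 ≤ Fintype.card F := by
    have := Nat.pow_pos (n := 4) hW
    omega
  have hderiv : aeval s (derivative (C a * X ^ 2 + C b * X + C c)) ≠ 0 := by
    have h1 := hf 0
    have h2 := hf 1
    simp only [map_add, map_mul, map_pow, aeval_C, aeval_X] at h1 h2
    have h : aeval s (derivative (C a * X ^ 2 + C b * X + C c)) =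
        algebraMap F (AlgebraicClosure F) a * (s - t) := by
      simp only [derivative_mul, derivative_C, derivative_X_pow, derivative_X,
        map_add, map_mul, map_pow, aeval_C, aeval_X, map_zero, map_one, map_natCast]
      push_cast
      linear_combination h2 - h1
    rw [h]
    exact mul_ne_zero ((_root_.map_ne_zero _).2 ha) (sub_ne_zero.2 hst)
  refine exists_isPrimitiveRoot_eval (by intro h; simp [h] at hfd) hfd.le
    (fun χ₁ χ₂ hχ => norm_sum_mulChar_mul_mulChar_le ha hfd (leadingCoeff_quadratic ha) hf hst hs0
      hderiv hq3 hχ) hq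

end FiniteFieldCharSum

end

/-- **Theorem 3.** If `a ≠ 0`, `b² − 4ac ≠ 0` and `q > 4·W(q−1)⁴`, then
there is a primitive root `g` of `F_q` such that `a·g² + b·g + c` is also primitive. -/
theorem stmt_4 (F : Type*) [Field F] [Fintype F]
    (a b c : F) (ha : a ≠ 0) (hdisc : b ^ 2 - 4 * a * c ≠ 0)
    (hq : 4 * W (Fintype.card F - 1) ^ 4 < Fintype.card F) :
    ∃ g : F, IsPrimitiveRoot g (Fintype.card F - 1) ∧
      IsPrimitiveRoot (a * g ^ 2 + b * g + c) (Fintype.card F - 1) := by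
  obtain ⟨g, hg, hg'⟩ := FiniteFieldCharSum.exists_isPrimitiveRoot_quadratic ha hdisc hq
  exact ⟨g, hg, by simpa using hg'⟩
end

section
/- Suppose the triple (a, b, c) ∈ F_q³ satisfies a ≠ 0 and b² − 4ac ≠ 0. Let e be a divisor of q − 1 and let p₁, …, p_s (s ≥ 1) be the distinct primes dividing q − 1 but not dividing e. Then N(q−1, q−1) ≥ Σ_{i=1}^{s} N(p_i·e, e) + Σ_{i=1}^{s} N(e, p_i·e) − (2s − 1)·N(e, e). -/
/-- `g` is `e`-free: `g ≠ 0` and whenever `g = h^d` with `d ∣ e`, we have `d = 1`. -/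
def EFree {F : Type*} [Field F] [Fintype F] (e : ℕ) (g : F) : Prop :=
  g ≠ 0 ∧ ∀ d : ℕ, d ∣ e → (∃ h : F, g = h ^ d) → d = 1

/-- `N(e₁, e₂)`: the number of `g ∈ F_q^×` such that `g` is `e₁`-free and
`a·g² + b·g + c` is `e₂`-free. -/
noncomputable def NN {F : Type*} [Field F] [Fintype F] (a b c : F) (e₁ e₂ : ℕ) : ℕ :=
  Set.ncard {g : F | EFree e₁ g ∧ EFree e₂ (a * g ^ 2 + b * g + c)}

/-- It suffices to test `e`-freeness on the prime divisors of `e`. -/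
theorem eFree_iff_prime {F : Type*} [Field F] [Fintype F] {e : ℕ} {g : F} :
    EFree e g ↔ g ≠ 0 ∧ ∀ p : ℕ, p.Prime → p ∣ e → ¬ ∃ h : F, g = h ^ p := by
  refine and_congr_right fun _ => ⟨fun H p hp hpe hg => hp.ne_one (H p hpe hg), ?_⟩
  rintro H d hd ⟨h, rfl⟩
  by_contra hd1
  obtain ⟨p, hp, k, rfl⟩ := Nat.exists_prime_and_dvd hd1
  exact H p hp ((Dvd.intro k rfl).trans hd) ⟨h ^ k, by rw [← pow_mul, mul_comm]⟩

theorem EFree.of_dvd {F : Type*} [Field F] [Fintype F] {e e' : ℕ} {g : F}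
    (hg : EFree e g) (h : e' ∣ e) : EFree e' g :=
  ⟨hg.1, fun d hd => hg.2 d (hd.trans h)⟩

/-- A Bonferroni-type lower bound for the size of an intersection of subsets of `S`. -/
theorem sum_ncard_sub_le_ncard {α ι : Type*} [Finite α] (I : Finset ι) (A : ι → Set α)
    {S T : Set α} (hA : ∀ i ∈ I, A i ⊆ S)
    (hT : ∀ x ∈ S, (∀ i ∈ I, x ∈ A i) → x ∈ T) :
    (∑ i ∈ I, ((A i).ncard : ℤ)) - ((I.card : ℤ) - 1) * (S.ncard : ℤ) ≤ (T.ncard : ℤ) := by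
  have hcover : S ⊆ T ∪ ⋃ i ∈ I, S \ A i := by
    intro x hx
    by_cases h : ∀ i ∈ I, x ∈ A i
    · exact Or.inl (hT x hx h)
    · push Not at h
      obtain ⟨i, hi, hxi⟩ := h
      exact Or.inr (Set.mem_biUnion hi ⟨hx, hxi⟩)
  have hcard : S.ncard ≤ T.ncard + ∑ i ∈ I, (S \ A i).ncard :=
    (Set.ncard_le_ncard hcover).trans <| (Set.ncard_union_le _ _).trans <|
      Nat.add_le_add_left (I.set_ncard_biUnion_le _) _
  have hdiff : ∑ i ∈ I, (S \ A i).ncard + ∑ i ∈ I, (A i).ncard = I.card * S.ncard := by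
    rw [← Finset.sum_add_distrib, ← smul_eq_mul, ← Finset.sum_const]
    exact Finset.sum_congr rfl fun i hi => Set.ncard_sdiff_add_ncard_of_subset (hA i hi)
  zify at hcard hdiff
  linarith

/-- **the sieve inequality, Lemma 3.** Let `e ∣ q − 1` and let `ps` be the
set of the `s ≥ 1` distinct primes dividing `q − 1` but not `e`. Then
`N(q−1, q−1) ≥ Σᵢ N(pᵢe, e) + Σᵢ N(e, pᵢe) − (2s − 1)·N(e, e)`. -/
theorem stmt_6 (F : Type*) [Field F] [Fintype F]
    (a b c : F) (ha : a ≠ 0) (hdisc : b ^ 2 - 4 * a * c ≠ 0)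
    (e : ℕ) (he : e ∣ Fintype.card F - 1)
    (ps : Finset ℕ)
    (hps : ∀ p, p ∈ ps ↔ p.Prime ∧ p ∣ Fintype.card F - 1 ∧ ¬ p ∣ e)
    (hs : 1 ≤ ps.card) :
    (∑ p ∈ ps, (NN a b c (p * e) e : ℤ)) + (∑ p ∈ ps, (NN a b c e (p * e) : ℤ))
        - (2 * (ps.card : ℤ) - 1) * (NN a b c e e : ℤ)
      ≤ (NN a b c (Fintype.card F - 1) (Fintype.card F - 1) : ℤ) := by
  have hfree : ∀ g : F, EFree e g → (∀ p ∈ ps, EFree (p * e) g) →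
      EFree (Fintype.card F - 1) g := by
    intro g hg hps'
    refine eFree_iff_prime.2 ⟨hg.1, fun p hp hpq => ?_⟩
    by_cases hpe : p ∣ e
    · exact (eFree_iff_prime.1 hg).2 p hp hpe
    · exact (eFree_iff_prime.1 (hps' p ((hps p).2 ⟨hp, hpq, hpe⟩))).2 p hp (dvd_mul_right p e)
  have key := sum_ncard_sub_le_ncard (ps.disjSum ps)
    (Sum.elim
      (fun p => {g : F | EFree (p * e) g ∧ EFree e (a * g ^ 2 + b * g + c)})
      (fun p => {g : F | EFree e g ∧ EFree (p * e) (a * g ^ 2 + b * g + c)}))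
    (S := {g : F | EFree e g ∧ EFree e (a * g ^ 2 + b * g + c)})
    (T := {g : F | EFree (Fintype.card F - 1) g ∧
      EFree (Fintype.card F - 1) (a * g ^ 2 + b * g + c)})
    (by
      rintro (p | p) - g ⟨h₁, h₂⟩
      · exact ⟨h₁.of_dvd (dvd_mul_left e p), h₂⟩
      · exact ⟨h₁, h₂.of_dvd (dvd_mul_left e p)⟩)
    (fun g hg hall =>
      ⟨hfree _ hg.1 fun p hp => (hall (Sum.inl p) (Finset.inl_mem_disjSum.2 hp)).1,
        hfree _ hg.2 fun p hp => (hall (Sum.inr p) (Finset.inr_mem_disjSum.2 hp)).2⟩)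
  rw [Finset.sum_disjSum, Finset.card_disjSum, Nat.cast_add, ← two_mul] at key
  exact key
end

section
/- Suppose the triple (a, b, c) ∈ F_q³ satisfies a ≠ 0 and b² − 4ac ≠ 0. Let e be a divisor of q − 1 and let l be a prime dividing q − 1 but not dividing e. Then |N(e, l·e) − θ(l)·N(e, e)| ≤ (1 − 1/l)·θ(e)²·( 2·W(e)²·√q − W(e)·(√q − 1) ) and |N(l·e, e) − θ(l)·N(e, e)| ≤ (1 − 1/l)·θ(e)²·( 2·W(e)²·√q − 2·W(e)·(√q − 1) ). -/
/-- `θ(m) = ∏_{p ∣ m, p prime} (1 − 1/p)`. -/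
noncomputable def θ (m : ℕ) : ℝ := ∏ p ∈ m.primeFactors, (1 - 1 / (p : ℝ))

section

open Polynomial Finset

universe u

/-- Low-degree combinations of `X ^ k * (X ^ A * g) ^ j * X ^ (r * i)` with `k < A`,
`j < d`, `d * A ≤ r` do not vanish when `g 0 ≠ 0`. -/
theorem sum_monomials_ne_zero {L : Type*} [Field L] {A B d r : ℕ} (hdA : d * A ≤ r)
    {g : L[X]} (hg : g.coeff 0 ≠ 0) (u : Fin B × Fin d × Fin A → L) (hu : u ≠ 0) :
    ∑ t, C (u t) * X ^ (t.2.2 : ℕ) * (X ^ A * g) ^ (t.2.1 : ℕ) * X ^ (r * t.1) ≠ 0 := by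
  classical
  let w : Fin B × Fin d × Fin A → ℕ := fun t => t.2.2 + A * t.2.1 + r * t.1
  have hlt : ∀ t : Fin B × Fin d × Fin A, (t.2.2 : ℕ) + A * t.2.1 < r := by
    rintro ⟨i, j, k⟩
    have h1 : A * ((j : ℕ) + 1) ≤ A * d := Nat.mul_le_mul_left _ j.2
    have := k.2
    simp only
    nlinarith
  have hw : Function.Injective w := by
    rintro ⟨i, j, k⟩ ⟨i', j', k'⟩ h
    have h1 := hlt (i, j, k)
    have h2 := hlt (i', j', k')
    simp only [w] at h h1 h2
    have e1 : (i : ℕ) = i' := by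
      have := congrArg (· / r) h
      rw [Nat.add_mul_div_left _ _ (by omega), Nat.add_mul_div_left _ _ (by omega),
        Nat.div_eq_of_lt h1, Nat.div_eq_of_lt h2] at this
      omega
    rw [e1] at h
    have h3 : (k : ℕ) + A * j = k' + A * j' := by omega
    have e2 : (j : ℕ) = j' := by
      have := congrArg (· / A) h3
      rw [Nat.add_mul_div_left _ _ (by have := k.2; omega),
        Nat.add_mul_div_left _ _ (by have := k.2; omega),
        Nat.div_eq_of_lt k.2, Nat.div_eq_of_lt k'.2] at this
      omega
    rw [e2] at h3
    have e3 : (k : ℕ) = k' := by omega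
    simp [Fin.ext_iff, e1, e2, e3]
  obtain ⟨t₁, ht₁⟩ := Function.ne_iff.mp hu
  obtain ⟨t₀, ht₀, hmin⟩ := exists_min_image (univ.filter fun t => u t ≠ 0) w
    ⟨t₁, by simpa using ht₁⟩
  intro h0
  have hc := congrArg (fun P => P.coeff (w t₀)) h0
  simp only [finsetSum_coeff, coeff_zero] at hc
  have hterm : ∀ t : Fin B × Fin d × Fin A,
      C (u t) * X ^ (t.2.2 : ℕ) * (X ^ A * g) ^ (t.2.1 : ℕ) * X ^ (r * t.1)
        = C (u t) * (g ^ (t.2.1 : ℕ) * X ^ (w t)) := by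
    intro t
    simp only [w, pow_add, mul_pow, pow_mul]
    ring
  rw [sum_eq_single t₀] at hc
  · rw [hterm, coeff_C_mul, coeff_mul_X_pow', if_pos le_rfl, Nat.sub_self,
      coeff_zero_eq_eval_zero, eval_pow, ← coeff_zero_eq_eval_zero] at hc
    exact mul_ne_zero (by simpa using ht₀) (pow_ne_zero _ hg) hc
  · intro t _ ht
    rw [hterm, coeff_C_mul]
    by_cases hut : u t = 0
    · simp [hut]
    · have h1 := hmin t (by simpa using hut)
      have h2 : w t ≠ w t₀ := fun h => ht (hw h)
      rw [coeff_mul_X_pow', if_neg (by omega), mul_zero]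
  · simp

theorem exists_ne_zero_sum_smul_eq_zero {L ι : Type*} [Field L] [Fintype ι] {M : ℕ}
    (P : ι → L[X]) (hP : ∀ i, P i ∈ degreeLT L M) (hM : M < Fintype.card ι) :
    ∃ v : ι → L, v ≠ 0 ∧ ∑ i, C (v i) * P i = 0 := by
  let P' : ι → degreeLT L M := fun i => ⟨P i, hP i⟩
  let e := degreeLTEquiv L M
  have hfd : FiniteDimensional L (degreeLT L M) := Module.Finite.equiv e.symm
  have hfr : Module.finrank L (degreeLT L M) = M := by
    rw [e.finrank_eq, Module.finrank_fin_fun]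
  have := LinearMap.ker_ne_bot_of_finrank_lt (f := Fintype.linearCombination L P')
    (by rw [hfr, Module.finrank_fintype_fun_eq_card]; exact hM)
  obtain ⟨v, hv, hv0⟩ := Submodule.exists_mem_ne_zero_of_ne_bot this
  refine ⟨v, hv0, ?_⟩
  have h := congrArg Subtype.val (LinearMap.mem_ker.mp hv)
  simp only [Fintype.linearCombination_apply, ZeroMemClass.coe_zero,
    AddSubmonoidClass.coe_finsetSum, SetLike.val_smul, P'] at h
  simpa [smul_eq_C_mul] using h

/-- Stepanov's method in Bombieri's form. The points of a translate of `𝔽_{r²}` at which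
`f ^ ((r² - 1) / d)` takes a given nonzero value number at most `(r² + O(r)) / d`. -/
theorem card_mul_le_of_pow_eq {L : Type*} [Field L] (p n : ℕ) [Fact p.Prime] [CharP L p]
    [PerfectRing L p]
    {A d r m : ℕ} (hr : r = p ^ n) (hd : 2 ≤ d) (hA : 1 ≤ A) (hdA : d * A + 1 = r)
    {f₁ : L[X]} (hf₁ : f₁.coeff 0 ≠ 0) (hm : (X * f₁).natDegree ≤ m)
    (c₀ ζ : L) (hζ : ζ ≠ 0) (T : Finset L)
    (hT : ∀ x ∈ T, x ^ (r * r) = x + c₀ ∧ ((X * f₁).eval x) ^ (A * (r + 1)) = ζ) :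
    d * T.card ≤ r * r + (1 + d * m + d * (3 + d * m)) * r := by
  classical
  set c := 3 + d * m with hc
  set B := A + c with hB
  set G : L[X] := (X * f₁) ^ A with hG
  have hGdeg : G.natDegree ≤ A * m := natDegree_pow_le_of_le _ hm
  let P : Fin B × Fin d × Fin A → L[X] := fun t =>
    X ^ (r * t.2.2) * C (ζ ^ (t.2.1 : ℕ)) * G ^ (d - 1 - t.2.1) * (X + C c₀) ^ (t.1 : ℕ)
  have hPdeg : ∀ t, P t ∈ degreeLT L (r * A + B + d * m * A) := by
    rintro ⟨i, j, k⟩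
    rw [mem_degreeLT]
    refine lt_of_le_of_lt degree_le_natDegree ?_
    norm_cast
    have h1 : (P (i, j, k)).natDegree ≤ r * k + 0 + (d - 1 - j) * (A * m) + i * 1 := by
      refine natDegree_mul_le_of_le (natDegree_mul_le_of_le (natDegree_mul_le_of_le ?_ ?_) ?_) ?_
      · exact natDegree_X_pow_le _
      · exact (natDegree_C _).le
      · exact natDegree_pow_le_of_le _ hGdeg
      · exact natDegree_pow_le_of_le _ (natDegree_X_add_C _).le
    have h2 : r * (k : ℕ) ≤ r * A := Nat.mul_le_mul_left _ k.2.le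
    have h3 : (d - 1 - (j : ℕ)) * (A * m) ≤ d * (A * m) := Nat.mul_le_mul_right _ (by omega)
    have h4 := i.2
    nlinarith
  have hcard : r * A + B + d * m * A < Fintype.card (Fin B × Fin d × Fin A) := by
    simp only [Fintype.card_prod, Fintype.card_fin]
    have hr2 : A + 2 ≤ r := by nlinarith
    obtain ⟨s, rfl⟩ : ∃ s, r = s + 2 := ⟨r - 2, by omega⟩
    have h5 : d * A = s + 1 := by omega
    rw [h5, hB]
    have h6 : c * A ≤ c * s := Nat.mul_le_mul_left _ (by omega)
    nlinarith
  obtain ⟨v, hv0, hv⟩ := exists_ne_zero_sum_smul_eq_zero P hPdeg hcard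
  have hroot : ∀ y : L, ∃ x, x ^ r = y := fun y => by
    obtain ⟨x, hx⟩ := (iterateFrobeniusEquiv L p n).surjective y
    exact ⟨x, by rw [hr]; simpa [iterateFrobeniusEquiv_apply, iterateFrobenius_def] using hx⟩
  choose root hroot using hroot
  let u := fun t => root (v t)
  have hu0 : u ≠ 0 := by
    rintro h
    apply hv0
    funext t
    have : u t = 0 := congrFun h t
    rw [← hroot (v t)]
    simp only [u] at this
    rw [this]
    simp only [Pi.zero_apply]
    exact zero_pow (by omega)
  set h : L[X] :=
    ∑ t, C (u t) * X ^ (t.2.2 : ℕ) * (X ^ A * f₁ ^ A) ^ (t.2.1 : ℕ) * X ^ (r * t.1) with hh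
  have hne : h ≠ 0 := by
    refine sum_monomials_ne_zero (by omega) ?_ u hu0
    rw [coeff_zero_eq_eval_zero, eval_pow, ← coeff_zero_eq_eval_zero]
    exact pow_ne_zero _ hf₁
  have hdeg : h.natDegree ≤ A + d * (A * m) + r * B := by
    refine natDegree_sum_le_of_forall_le _ _ ?_
    rintro ⟨i, j, k⟩ _
    rw [← mul_pow, ← hG]
    have h1 : (C (u (i, j, k)) * X ^ (k : ℕ) * G ^ (j : ℕ) * X ^ (r * i)).natDegree
        ≤ 0 + (k : ℕ) + (j : ℕ) * (A * m) + r * (i : ℕ) := by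
      refine natDegree_mul_le_of_le (natDegree_mul_le_of_le (natDegree_mul_le_of_le ?_ ?_) ?_) ?_
      · exact (natDegree_C _).le
      · exact natDegree_X_pow_le _
      · exact natDegree_pow_le_of_le _ hGdeg
      · exact natDegree_X_pow_le _
    have h2 : r * (i : ℕ) ≤ r * B := Nat.mul_le_mul_left _ i.2.le
    have h3 : (j : ℕ) * (A * m) ≤ d * (A * m) := Nat.mul_le_mul_right _ j.2.le
    have h4 := k.2
    simp only
    omega
  have hvan : ∀ x ∈ T, h.eval x = 0 := by
    intro x hx
    obtain ⟨hx1, hx2⟩ := hT x hx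
    have hGx : G.eval x ^ r * G.eval x = ζ := by
      rw [hG, eval_pow, ← pow_succ, ← pow_mul, hx2]
    have hG0 : G.eval x ≠ 0 := fun h0 => hζ (by rw [← hGx, h0, mul_zero])
    have key : (h.eval x) ^ r * G.eval x ^ (d - 1) = 0 := by
      rw [hh, eval_finsetSum, hr, sum_pow_char_pow, ← hr, sum_mul, ← eval_zero (x := x), ← hv,
        eval_finsetSum]
      refine sum_congr rfl ?_
      rintro ⟨i, j, k⟩ _
      rw [← mul_pow, ← hG]
      simp only [P, u, eval_mul, eval_C, eval_pow, eval_X, eval_add, mul_pow, hroot]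
      have e1 : (x ^ (r * (i : ℕ))) ^ r = (x + c₀) ^ (i : ℕ) := by
        rw [← hx1]; ring
      have e2 : (G.eval x ^ (j : ℕ)) ^ r * G.eval x ^ (d - 1)
          = ζ ^ (j : ℕ) * G.eval x ^ (d - 1 - (j : ℕ)) := by
        have : d - 1 = j + (d - 1 - j) := by have := j.2; omega
        rw [← hGx]
        conv_lhs => rw [this]
        ring
      rw [e1]
      linear_combination (v (i, j, k) * (x ^ (k : ℕ)) ^ r * (x + c₀) ^ (i : ℕ)) * e2
    rcases mul_eq_zero.mp key with h1 | h1
    · exact eq_zero_of_pow_eq_zero h1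
    · exact absurd (eq_zero_of_pow_eq_zero h1) hG0
  have hTle : T.card ≤ h.natDegree := by
    refine le_trans ?_ (card_roots' h)
    refine (card_le_card fun x hx => ?_).trans (Multiset.toFinset_card_le _)
    rw [Multiset.mem_toFinset, mem_roots hne]
    exact hvan x hx
  calc d * T.card ≤ d * (A + d * (A * m) + r * B) := Nat.mul_le_mul_left _ (hTle.trans hdeg)
    _ = d * A + d * m * (d * A) + r * (d * A) + r * d * c := by rw [hB]; ring
    _ ≤ r + d * m * r + r * r + r * d * c := by gcongr <;> omega
    _ = r * r + (1 + d * m + d * c) * r := by ring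

theorem card_value_class_le {K : Type*} [Field K] [Fintype K] [DecidableEq K]
    {L : Type*} [Field L] [Algebra K L]
    (p n : ℕ) [Fact p.Prime] [CharP K p] [CharP L p] [PerfectRing L p]
    {A d r m : ℕ} (hr : r = p ^ n) (hK : Fintype.card K = r * r) (hd : 2 ≤ d) (hA : 1 ≤ A)
    (hdA : d * A + 1 = r) {f : K[X]} (hm : f.natDegree ≤ m) {ρ : L}
    (h0 : aeval ρ f = 0) (h1 : aeval ρ (derivative f) ≠ 0) {t : K} (ht : t ≠ 0) :
    d * #{x : K | f.eval x ^ (A * (r + 1)) = t ^ (A * (r + 1))}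
      ≤ r * r + (1 + d * m + d * (3 + d * m)) * r := by
  classical
  set F : L[X] := (f.map (algebraMap K L)).comp (X + C ρ) with hF
  have hF0 : F.coeff 0 = 0 := by
    rw [coeff_zero_eq_eval_zero, hF, eval_comp]
    rw [eval_add, eval_X, eval_C, zero_add, eval_map_algebraMap, h0]
  obtain ⟨f₁, hf₁⟩ := X_dvd_iff.mpr hF0
  have hf₁0 : f₁.coeff 0 ≠ 0 := by
    have : f₁.coeff 0 = F.coeff 1 := by rw [hf₁, ← zero_add 1, coeff_X_mul]
    rw [this]
    have h2 : (derivative F).eval 0 = F.coeff 1 := by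
      rw [← coeff_zero_eq_eval_zero, coeff_derivative]; simp
    rw [← h2, hF, derivative_comp]
    rw [eval_mul, eval_comp, derivative_map, eval_add, eval_X, eval_C, zero_add,
      eval_map_algebraMap, derivative_add, derivative_X, derivative_C, add_zero, eval_one, one_mul]
    exact h1
  have hdeg : (X * f₁).natDegree ≤ m := by
    rw [← hf₁, hF, natDegree_comp, natDegree_X_add_C, mul_one]
    exact (natDegree_map_le).trans hm
  set S : Finset K := {x : K | f.eval x ^ (A * (r + 1)) = t ^ (A * (r + 1))}
  have hinj : Function.Injective fun x : K => algebraMap K L x - ρ := fun x y h =>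
    (algebraMap K L).injective (by simpa using h)
  have key := card_mul_le_of_pow_eq p n hr hd hA hdA hf₁0 hdeg (ρ - ρ ^ (r * r))
    (algebraMap K L t ^ (A * (r + 1)))
    (pow_ne_zero _ (by simpa using ht)) (S.image fun x => algebraMap K L x - ρ) (by
      intro y hy
      obtain ⟨x, hx, rfl⟩ := mem_image.mp hy
      constructor
      · have hx' : x ^ (r * r) = x := by rw [← hK]; exact FiniteField.pow_card x
        have hrr : r * r = p ^ (n + n) := by rw [hr, pow_add]
        rw [hrr, sub_pow_char_pow, ← hrr, ← map_pow, hx']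
        ring
      · rw [← hf₁, hF, eval_comp]
        simp only [eval_add, eval_X, eval_C, sub_add_cancel, eval_map_algebraMap,
          aeval_algebraMap_apply, coe_aeval_eq_eval]
        rw [← map_pow, ← map_pow, (mem_filter.mp hx).2])
  rwa [card_image_of_injective _ hinj] at key

theorem sum_units_eq_zero {G : Type*} [Group G] [Fintype G] (χ : G →* ℂ) (h : ∃ x, χ x ≠ 1) :
    ∑ x, χ x = 0 := by
  obtain ⟨y, hy⟩ := h
  have : χ y * ∑ x, χ x = ∑ x, χ x := by
    rw [mul_sum]
    exact Fintype.sum_bijective (fun x => y * x) (Group.mulLeft_bijective y) _ _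
      fun x => (map_mul χ y x).symm
  by_contra h0
  exact hy (mul_right_cancel₀ h0 (by rw [this, one_mul]))

theorem norm_charSum_le_of_square {K : Type*} [Field K] [Fintype K]
    {L : Type*} [Field L] [Algebra K L]
    (p n : ℕ) [Fact p.Prime] [CharP K p] [CharP L p] [PerfectRing L p]
    {A d r m : ℕ} (hr : r = p ^ n) (hK : Fintype.card K = r * r) (hd : 2 ≤ d) (hA : 1 ≤ A)
    (hdA : d * A + 1 = r) {f : K[X]} (hm : f.natDegree ≤ m) {ρ : L}
    (h0 : aeval ρ f = 0) (h1 : aeval ρ (derivative f) ≠ 0)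
    (χ : K →* ℂ) (hχ0 : χ 0 = 0) (hχd : ∀ x ≠ 0, χ x ^ d = 1) (hχ1 : ∃ x ≠ 0, χ x ≠ 1) :
    ‖∑ x : K, χ (f.eval x)‖ ≤ (1 + d * m + d * (3 + d * m) + m : ℕ) * (r : ℝ) := by
  classical
  set c := 1 + d * m + d * (3 + d * m) with hc
  set e := A * (r + 1) with he
  have hcardU : Fintype.card Kˣ = d * e := by
    rw [Fintype.card_units, hK, he, ← hdA]
    apply Nat.sub_eq_of_eq_add
    ring
  have he0 : 0 < e := by positivity
  have hroots : #{x : K | f.eval x = 0} ≤ m := by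
    have hf : f ≠ 0 := by rintro rfl; simp at h1
    refine le_trans ?_ ((card_roots' f).trans hm)
    refine (card_le_card fun x hx => ?_).trans (Multiset.toFinset_card_le _)
    rw [Multiset.mem_toFinset, mem_roots hf]
    exact (mem_filter.mp hx).2
  have hker : #{t : Kˣ | t ^ e = 1} = e := by
    have := IsCyclic.card_powMonoidHom_ker Kˣ e
    rw [Nat.card_eq_fintype_card (α := Kˣ), hcardU, Nat.gcd_mul_left_left] at this
    conv_rhs => rw [← this]
    rw [Nat.card_eq_fintype_card, Fintype.card_subtype]
    simp [MonoidHom.mem_ker]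
  have hker1 : ∀ t : Kˣ, t ^ e = 1 → χ t = 1 := by
    intro t ht
    obtain ⟨γ, hγ⟩ := IsCyclic.exists_generator (α := Kˣ)
    obtain ⟨k, rfl⟩ := (mem_powers_iff_mem_zpowers.mpr (hγ t))
    simp only at ht ⊢
    rw [← pow_mul] at ht
    have h2 := orderOf_dvd_of_pow_eq_one ht
    rw [orderOf_eq_card_of_forall_mem_zpowers hγ, Nat.card_eq_fintype_card, hcardU] at h2
    obtain ⟨j, rfl⟩ := Nat.dvd_of_mul_dvd_mul_right he0 h2
    rw [Units.val_pow_eq_pow_val, map_pow, pow_mul, hχd _ γ.ne_zero, one_pow]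
  have hnorm : ∀ t : Kˣ, ‖χ t‖ = 1 := fun t =>
    Complex.norm_eq_one_of_pow_eq_one (hχd _ t.ne_zero) (by omega)
  have hfib : ∀ y : Kˣ, univ.filter (fun t : Kˣ => (y : K) ^ e = (t : K) ^ e)
      = (univ.filter fun t : Kˣ => t ^ e = 1).image (fun t => y * t) := by
    intro y
    ext t
    simp only [mem_filter, mem_univ, true_and, mem_image]
    constructor
    · intro h
      refine ⟨y⁻¹ * t, ?_, by simp⟩
      rw [mul_pow, inv_pow, inv_mul_eq_one]
      exact Units.ext (by simpa using h)
    · rintro ⟨s, hs, rfl⟩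
      have : ((s ^ e : Kˣ) : K) = 1 := by rw [hs]; rfl
      simp only [Units.val_mul, mul_pow, Units.val_pow_eq_pow_val] at this ⊢
      rw [this, mul_one]
  let N : Kˣ → ℕ := fun t => #{x : K | f.eval x ^ e = (t : K) ^ e}
  have hN : ∀ t : Kˣ, (N t : ℝ) ≤ ((r : ℝ) * r + c * r) / d := by
    intro t
    rw [le_div_iff₀ (by positivity), mul_comm]
    exact_mod_cast card_value_class_le p n hr hK hd hA hdA hm h0 h1 t.ne_zero
  have hsum1 : ∑ t : Kˣ, χ t * N t = e * ∑ x : K, χ (f.eval x) := by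
    calc ∑ t : Kˣ, χ t * N t
        = ∑ t : Kˣ, ∑ x : K, if f.eval x ^ e = (t : K) ^ e then χ t else 0 := by
          refine sum_congr rfl fun t _ => ?_
          simp only [N]
          rw [← sum_filter, sum_const, nsmul_eq_mul, mul_comm]
      _ = ∑ x : K, ∑ t : Kˣ, if f.eval x ^ e = (t : K) ^ e then χ t else 0 := sum_comm
      _ = e * ∑ x : K, χ (f.eval x) := by
          rw [mul_sum]
          refine sum_congr rfl fun x _ => ?_
          by_cases hx : f.eval x = 0
          · rw [hx, hχ0, mul_zero]
            refine sum_eq_zero fun t _ => ?_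
            rw [if_neg]
            rw [zero_pow he0.ne']
            exact (pow_ne_zero _ t.ne_zero).symm
          · lift f.eval x to Kˣ using IsUnit.mk0 _ hx with y
            rw [← sum_filter, hfib, sum_image (fun _ _ _ _ h => mul_left_cancel h)]
            rw [sum_congr rfl (g := fun _ => χ y), sum_const, hker, nsmul_eq_mul]
            intro t ht
            rw [Units.val_mul, map_mul, hker1 t (mem_filter.mp ht).2, mul_one]
  have hsum2 : ∑ t : Kˣ, (N t : ℝ) = e * #{x : K | f.eval x ≠ 0} := by
    calc ∑ t : Kˣ, (N t : ℝ)
        = ∑ t : Kˣ, ∑ x : K, if f.eval x ^ e = (t : K) ^ e then (1 : ℝ) else 0 := by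
          refine sum_congr rfl fun t _ => ?_
          simp [N]
      _ = ∑ x : K, ∑ t : Kˣ, if f.eval x ^ e = (t : K) ^ e then (1 : ℝ) else 0 := sum_comm
      _ = ∑ x : K, if f.eval x ≠ 0 then (e : ℝ) else 0 := by
          refine sum_congr rfl fun x _ => ?_
          by_cases hx : f.eval x = 0
          · rw [hx, if_neg (by simp)]
            refine sum_eq_zero fun t _ => ?_
            rw [if_neg]
            rw [zero_pow he0.ne']
            exact (pow_ne_zero _ t.ne_zero).symm
          · rw [if_pos hx]
            lift f.eval x to Kˣ using IsUnit.mk0 _ hx with y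
            rw [← sum_filter, hfib, sum_image (fun _ _ _ _ h => mul_left_cancel h)]
            simp [hker]
      _ = e * #{x : K | f.eval x ≠ 0} := by
          rw [← sum_filter, sum_const, nsmul_eq_mul, mul_comm]
  have hsplit : #{x : K | f.eval x = 0} + #{x : K | f.eval x ≠ 0} = r * r := by
    rw [← hK, ← card_univ]
    exact card_filter_add_card_filter_not _
  have hzero : ∑ t : Kˣ, χ t = 0 := by
    refine sum_units_eq_zero (χ.comp (Units.coeHom K)) ?_
    obtain ⟨x, hx, hx1⟩ := hχ1
    exact ⟨Units.mk0 x hx, hx1⟩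
  set M : ℝ := ((r : ℝ) * r + c * r) / d with hM
  have hd0 : (d : ℝ) ≠ 0 := by positivity
  have hfin : (e : ℝ) * ‖∑ x : K, χ (f.eval x)‖ ≤ e * ((c + m : ℕ) * (r : ℝ)) := by
    calc (e : ℝ) * ‖∑ x : K, χ (f.eval x)‖ = ‖∑ t : Kˣ, χ t * ((N t : ℂ) - (M : ℂ))‖ := by
          simp only [mul_sub, sum_sub_distrib]
          rw [← sum_mul, hzero, zero_mul, sub_zero, hsum1, norm_mul, Complex.norm_natCast]
      _ ≤ ∑ t : Kˣ, (M - N t) := by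
          refine norm_sum_le_of_le _ fun t _ => ?_
          rw [norm_mul, hnorm, one_mul]
          rw [← Complex.ofReal_natCast, ← Complex.ofReal_sub, Complex.norm_real, Real.norm_eq_abs,
            abs_sub_comm, abs_of_nonneg (sub_nonneg.mpr (hN t))]
      _ = e * (c * r + #{x : K | f.eval x = 0}) := by
          rw [sum_sub_distrib, hsum2, sum_const, card_univ, hcardU, nsmul_eq_mul]
          have h3 : ((d * e : ℕ) : ℝ) * M = e * (r * r + c * r) := by
            rw [hM]; push_cast; field_simp
          have h4 : (#{x : K | f.eval x = 0} : ℝ) + #{x : K | f.eval x ≠ 0} = r * r := by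
            exact_mod_cast hsplit
          rw [h3]
          linear_combination (-(e : ℝ)) * h4
      _ ≤ e * ((c + m : ℕ) * (r : ℝ)) := by
          have h5 : (#{x : K | f.eval x = 0} : ℝ) ≤ m := by exact_mod_cast hroots
          have h6 : (1 : ℝ) ≤ r := by exact_mod_cast (by omega : 1 ≤ r)
          push_cast
          gcongr
          nlinarith [Nat.cast_nonneg (α := ℝ) m]
  exact le_of_mul_le_mul_left hfin (by exact_mod_cast he0)

/-- The mixed character sum `∑ χ₁(x) χ₂(a x² + b x + c)` over a finite field. -/
noncomputable def quadSum {K : Type*} [Field K] [Fintype K] (χ₁ χ₂ : K →* ℂ) (a b c : K) : ℂ :=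
  ∑ x, χ₁ x * χ₂ (a * x ^ 2 + b * x + c)

/-- The product of the values of `a X² + b X + c` at the roots of `X² - s X + p`. -/
def quadRes {K : Type*} [Field K] (a b c s p : K) : K :=
  a * c * s ^ 2 + b * (a * p + c) * s + (a * p - c) ^ 2 + b ^ 2 * p

/-- The sum of `χ₁(h(0)) χ₂(Res(a X² + b X + c, h))` over monic quadratic polynomials `h`. -/
noncomputable def quadResSum {K : Type*} [Field K] [Fintype K] (χ₁ χ₂ : K →* ℂ) (a b c : K) : ℂ :=
  ∑ w : K × K, χ₁ w.2 * χ₂ (quadRes a b c w.1 w.2)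

/-- Exponent `d` bounds the order of both characters, and `χ₂` is nontrivial. -/
structure CharPair {K : Type*} [Field K] (d : ℕ) (χ₁ χ₂ : K →* ℂ) : Prop where
  left_zero : ‖χ₁ 0‖ ≤ 1
  left_pow : ∀ x ≠ 0, χ₁ x ^ d = 1
  right_zero : χ₂ 0 = 0
  right_pow : ∀ x ≠ 0, χ₂ x ^ d = 1
  right_ne : ∃ x ≠ 0, χ₂ x ≠ 1

theorem card_fiber_trace_norm_le_two {F E : Type*} [Field F] [Fintype F] [Field E] [Fintype E]
    [DecidableEq F]
    [Algebra F E] (hE : Module.finrank F E = 2) (w : F × F) :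
    #{i : (F × F) ⊕ E | Sum.elim (fun v => (v.1 + v.2, v.1 * v.2))
      (fun z => (Algebra.trace F E z, Algebra.norm F z)) i = w} ≤ 2 := by
  classical
  obtain ⟨s, p⟩ := w
  have htr : ∀ z : E, algebraMap F E (Algebra.trace F E z) = z + z ^ Nat.card F := by
    intro z
    rw [FiniteField.algebraMap_trace_eq_sum_pow, hE]
    simp [sum_range_succ]
  have hno : ∀ z : E, algebraMap F E (Algebra.norm F z) = z * z ^ Nat.card F := by
    intro z
    rw [FiniteField.algebraMap_norm_eq_prod_pow, hE]
    simp [prod_range_succ]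
  by_contra! hcon
  obtain ⟨i, hi, j, hj, k, hk, hij, hik, hjk⟩ := two_lt_card.mp hcon
  have hLR : ∀ i : (F × F) ⊕ E, i.isLeft ∨ i.isRight := by rintro (_ | _) <;> simp
  simp only [mem_filter, mem_univ, true_and] at hi hj hk
  let ψ : (F × F) ⊕ E → E := Sum.elim (fun v => algebraMap F E v.1) id
  have hroot : ∀ i : (F × F) ⊕ E, Sum.elim (fun v : F × F => (v.1 + v.2, v.1 * v.2))
      (fun z => (Algebra.trace F E z, Algebra.norm F z)) i = (s, p) →
      ψ i ^ 2 - algebraMap F E s * ψ i + algebraMap F E p = 0 := by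
    rintro (⟨x, y⟩ | z) h
    · simp only [Sum.elim_inl, Prod.mk.injEq] at h
      simp only [ψ, Sum.elim_inl, ← h.1, ← h.2, map_add, map_mul]
      ring
    · simp only [Sum.elim_inr, Prod.mk.injEq] at h
      simp only [ψ, Sum.elim_inr, ← h.1, ← h.2, htr, hno, id]
      ring
  have hinl : ∀ i j : (F × F) ⊕ E, i.isLeft → j.isLeft → ψ i = ψ j →
      Sum.elim (fun v : F × F => (v.1 + v.2, v.1 * v.2))
      (fun z => (Algebra.trace F E z, Algebra.norm F z)) i = (s, p) →
      Sum.elim (fun v : F × F => (v.1 + v.2, v.1 * v.2))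
      (fun z => (Algebra.trace F E z, Algebra.norm F z)) j = (s, p) → i = j := by
    rintro (⟨x, y⟩ | z) (⟨x', y'⟩ | z') h1 h2 h3 h4 h5 <;> simp at h1 h2
    simp only [ψ, Sum.elim_inl, (algebraMap F E).injective.eq_iff] at h3
    simp only [Sum.elim_inl, Prod.mk.injEq] at h4 h5
    have : y = y' := by linear_combination h4.1 - h5.1 - h3
    simp [h3, this]
  by_cases hx : ∃ x₀ : F, s = 2 * x₀ ∧ p = x₀ ^ 2
  · obtain ⟨x₀, rfl, rfl⟩ := hx
    have hψ : ∀ i : (F × F) ⊕ E, Sum.elim (fun v : F × F => (v.1 + v.2, v.1 * v.2))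
      (fun z => (Algebra.trace F E z, Algebra.norm F z)) i = (2 * x₀, x₀ ^ 2) →
        ψ i = algebraMap F E x₀ := by
      intro i h
      have h1 := hroot i h
      have h2 : (ψ i - algebraMap F E x₀) ^ 2 = 0 := by
        rw [← h1]; simp only [map_mul, map_pow, map_ofNat]; ring
      exact sub_eq_zero.mp (eq_zero_of_pow_eq_zero h2)
    have e1 : ψ i = ψ j := (hψ i hi).trans (hψ j hj).symm
    have e2 : ψ i = ψ k := (hψ i hi).trans (hψ k hk).symm
    have hinr : ∀ i j : (F × F) ⊕ E, i.isRight → j.isRight → ψ i = ψ j → i = j := by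
      rintro (⟨x, y⟩ | z) (⟨x', y'⟩ | z') h1 h2 h3 <;> simp at h1 h2
      simpa [ψ] using h3
    rcases hLR i with h1 | h1 <;> rcases hLR j with h2 | h2 <;>
      rcases hLR k with h3 | h3
    all_goals first
      | exact hij (hinl i j h1 h2 e1 hi hj)
      | exact hik (hinl i k h1 h3 e2 hi hk)
      | exact hjk (hinl j k h2 h3 (e1.symm.trans e2) hj hk)
      | exact hij (hinr i j h1 h2 e1)
      | exact hik (hinr i k h1 h3 e2)
      | exact hjk (hinr j k h2 h3 (e1.symm.trans e2))
  · have hmix : ∀ (v : F × F) (z : E), Sum.elim (fun v : F × F => (v.1 + v.2, v.1 * v.2))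
      (fun z => (Algebra.trace F E z, Algebra.norm F z)) (Sum.inr z) = (s, p) →
        algebraMap F E v.1 ≠ z := by
      rintro v z h rfl
      simp only [Sum.elim_inr, Prod.mk.injEq, Algebra.trace_algebraMap, Algebra.norm_algebraMap,
        hE] at h
      exact hx ⟨v.1, by rw [← h.1, two_nsmul, two_mul], h.2.symm⟩
    have hinj : ∀ i j : (F × F) ⊕ E, ψ i = ψ j →
        Sum.elim (fun v : F × F => (v.1 + v.2, v.1 * v.2))
        (fun z => (Algebra.trace F E z, Algebra.norm F z)) i = (s, p) →
        Sum.elim (fun v : F × F => (v.1 + v.2, v.1 * v.2))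
        (fun z => (Algebra.trace F E z, Algebra.norm F z)) j = (s, p) → i = j := by
      rintro (v | z) (v' | z') h h1 h2
      · exact hinl _ _ rfl rfl h h1 h2
      · exact absurd h (hmix v z' h2)
      · exact absurd h.symm (hmix v' z h1)
      · simpa [ψ] using h
    have d1 : ψ i - ψ j ≠ 0 := sub_ne_zero.mpr fun h => hij (hinj i j h hi hj)
    have d2 : ψ i - ψ k ≠ 0 := sub_ne_zero.mpr fun h => hik (hinj i k h hi hk)
    have d3 : ψ j - ψ k ≠ 0 := sub_ne_zero.mpr fun h => hjk (hinj j k h hj hk)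
    have r1 : ψ i + ψ j - algebraMap F E s = 0 :=
      (mul_eq_zero.mp (by linear_combination hroot i hi - hroot j hj :
        (ψ i - ψ j) * (ψ i + ψ j - algebraMap F E s) = 0)).resolve_left d1
    have r2 : ψ i + ψ k - algebraMap F E s = 0 :=
      (mul_eq_zero.mp (by linear_combination hroot i hi - hroot k hk :
        (ψ i - ψ k) * (ψ i + ψ k - algebraMap F E s) = 0)).resolve_left d2
    exact d3 (by linear_combination r1 - r2)

theorem sum_add_sum_trace_norm {F E : Type*} [Field F] [Fintype F] [Field E] [Fintype E]
    [Algebra F E] (hE : Module.finrank F E = 2) (Φ : F × F → ℂ) :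
    ∑ v : F × F, Φ (v.1 + v.2, v.1 * v.2)
      + ∑ z : E, Φ (Algebra.trace F E z, Algebra.norm F z) = 2 * ∑ w, Φ w := by
  classical
  let π : (F × F) ⊕ E → F × F := Sum.elim (fun v => (v.1 + v.2, v.1 * v.2))
      (fun z => (Algebra.trace F E z, Algebra.norm F z))
  have hle : ∀ w, #{i | π i = w} ≤ 2 := card_fiber_trace_norm_le_two hE
  have htot : ∑ w, #{i | π i = w} = ∑ _w : F × F, 2 := by
    rw [← card_eq_sum_card_fiberwise (fun _ _ => mem_univ _), card_univ, Fintype.card_sum,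
      Module.card_eq_pow_finrank (K := F) (V := E), hE, sum_const, card_univ, Fintype.card_prod,
      smul_eq_mul]
    ring
  have heq : ∀ w, #{i | π i = w} = 2 := fun w =>
    (sum_eq_sum_iff_of_le fun w _ => hle w).mp htot w (mem_univ w)
  have : ∑ i, Φ (π i) = 2 * ∑ w, Φ w := by
    rw [← sum_fiberwise univ π, mul_sum]
    refine sum_congr rfl fun w _ => ?_
    rw [sum_congr rfl (g := fun _ => Φ w) (fun i hi => by rw [(mem_filter.mp hi).2]), sum_const,
      heq, nsmul_eq_mul]
    rfl
  rw [← this, Fintype.sum_sum_type]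
  rfl

/-- The first two power sums of the inverse roots of the `L`-function determine its quadratic
coefficient. -/
theorem quadSum_sq_add_quadSum_norm {F E : Type*} [Field F] [Fintype F] [Field E] [Fintype E]
    [Algebra F E] (hE : Module.finrank F E = 2) (χ₁ χ₂ : F →* ℂ) (a b c : F) :
    quadSum χ₁ χ₂ a b c ^ 2
      + quadSum (χ₁.comp (Algebra.norm F : E →* F)) (χ₂.comp (Algebra.norm F : E →* F))
        (algebraMap F E a) (algebraMap F E b) (algebraMap F E c)
      = 2 * quadResSum χ₁ χ₂ a b c := by
  rw [quadResSum, ← sum_add_sum_trace_norm (E := E) hE, quadSum, sq, sum_mul_sum,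
    ← Fintype.sum_prod_type', quadSum]
  congr 1
  · refine sum_congr rfl fun v _ => ?_
    have : quadRes a b c (v.1 + v.2) (v.1 * v.2)
        = (a * v.1 ^ 2 + b * v.1 + c) * (a * v.2 ^ 2 + b * v.2 + c) := by
      rw [quadRes]; ring
    simp only [this, map_mul]
    ring
  · refine sum_congr rfl fun z _ => ?_
    simp only [MonoidHom.comp_apply]
    congr 2
    apply (algebraMap F E).injective
    have hfrob : ∀ x y : E, (x + y) ^ Nat.card F = x ^ Nat.card F + y ^ Nat.card F := by
      intro x y
      obtain ⟨p, _, n, hp, hn⟩ := FiniteField.card' F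
      have : CharP E p := charP_of_injective_algebraMap (algebraMap F E).injective p
      have : Fact p.Prime := ⟨hp⟩
      rw [Nat.card_eq_fintype_card, hn]
      exact add_pow_char_pow x y p n
    have hfix : ∀ x : F, algebraMap F E x ^ Nat.card F = algebraMap F E x := by
      intro x
      rw [← map_pow, Nat.card_eq_fintype_card, FiniteField.pow_card]
    rw [FiniteField.algebraMap_norm_eq_prod_pow, hE, prod_range_succ, prod_range_one, pow_zero,
      pow_one, pow_one, hfrob, hfrob, mul_pow, mul_pow, hfix, hfix, hfix, quadRes]
    simp only [map_add, map_mul, map_sub, map_pow, FiniteField.algebraMap_norm_eq_prod_pow,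
      FiniteField.algebraMap_trace_eq_sum_pow, hE, prod_range_succ, sum_range_succ, prod_range_zero,
      sum_range_zero, pow_zero, pow_one]
    ring

theorem CharPair.norm {F E : Type*} [Field F] [Fintype F] [Field E] [Fintype E]
    [Algebra F E] {d : ℕ} {χ₁ χ₂ : F →* ℂ} (h : CharPair d χ₁ χ₂) :
    CharPair d (χ₁.comp (Algebra.norm F : E →* F)) (χ₂.comp (Algebra.norm F : E →* F)) where
  left_zero := by simpa using h.left_zero
  left_pow x hx := h.left_pow _ (Algebra.norm_ne_zero_iff.mpr hx)
  right_zero := by simpa using h.right_zero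
  right_pow x hx := h.right_pow _ (Algebra.norm_ne_zero_iff.mpr hx)
  right_ne := by
    obtain ⟨x, hx, hx1⟩ := h.right_ne
    obtain ⟨y, rfl⟩ := FiniteField.norm_surjective F E x
    exact ⟨y, fun h => hx (by simp [h]), hx1⟩

theorem exists_quadratic_extension (F : Type u) [Field F] [Fintype F] :
    ∃ (E : Type u) (_ : Field E) (_ : Fintype E) (_ : Algebra F E), Module.finrank F E = 2 := by
  obtain ⟨p, hp⟩ := CharP.exists F
  have : Fact p.Prime := ⟨CharP.char_is_prime F p⟩
  let φ : FiniteField.Extension F p 2 →ₐ[F] AlgebraicClosure F := IsAlgClosed.lift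
  have h2 : Module.finrank F φ.fieldRange = 2 :=
    (AlgEquiv.ofInjectiveField φ).toLinearEquiv.finrank_eq.symm.trans
      (FiniteField.finrank_extension F p 2)
  have : FiniteDimensional F φ.fieldRange := Module.finite_of_finrank_pos (by omega)
  have : Finite φ.fieldRange := Module.finite_of_finite F
  exact ⟨φ.fieldRange, inferInstance, Fintype.ofFinite _, inferInstance, h2⟩

theorem exists_simple_root_comp_pow {K : Type*} [Field K] {L : Type*} [Field L] [IsAlgClosed L]
    [Algebra K L] {a b c κ : K} (ha : a ≠ 0) (hdisc : b ^ 2 - 4 * a * c ≠ 0) (hκ : κ ≠ 0) {d : ℕ}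
    (hd : (d : K) ≠ 0) :
    ∃ ρ : L, aeval ρ (C a * (C κ * X ^ d) ^ 2 + C b * (C κ * X ^ d) + C c : K[X]) = 0 ∧
      aeval ρ (derivative (C a * (C κ * X ^ d) ^ 2 + C b * (C κ * X ^ d) + C c : K[X])) ≠ 0 := by
  let i := algebraMap K L
  have hi : ∀ x : K, x ≠ 0 → i x ≠ 0 := fun x hx => (map_ne_zero i).mpr hx
  have hd0 : 0 < d := Nat.pos_of_ne_zero (by rintro rfl; simp at hd)
  have hw : ∃ w : L, w ≠ 0 ∧ i a * w ^ 2 + i b * w + i c = 0 := by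
    by_cases hc : c = 0
    · have hb : b ≠ 0 := by rintro rfl; simp [hc] at hdisc
      refine ⟨-(i b) / i a, div_ne_zero (neg_ne_zero.mpr (hi b hb)) (hi a ha), ?_⟩
      have := hi a ha
      rw [hc, map_zero]
      field_simp
      ring
    · obtain ⟨w, hw⟩ := IsAlgClosed.exists_root (C (i a) * X ^ 2 + C (i b) * X + C (i c))
        (by rw [degree_quadratic (hi a ha)]; norm_num)
      refine ⟨w, ?_, by simpa using hw⟩
      rintro rfl
      exact hi c hc (by simpa using hw)
  obtain ⟨w, hw0, hw⟩ := hw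
  obtain ⟨ρ, hρ⟩ := IsAlgClosed.exists_pow_nat_eq (w / i κ) hd0
  have hκρ : i κ * ρ ^ d = w := by
    have := hi κ hκ
    rw [hρ]; field_simp
  have hρ0 : ρ ≠ 0 := by
    rintro rfl
    rw [zero_pow hd0.ne', mul_zero] at hκρ
    exact hw0 hκρ.symm
  have hd' : 2 * i a * w + i b ≠ 0 := by
    intro h
    apply hi _ hdisc
    simp only [map_sub, map_mul, map_pow, map_ofNat]
    linear_combination (2 * i a * w + i b) * h - 4 * i a * hw
  refine ⟨ρ, ?_, ?_⟩
  · simp only [map_add, map_mul, map_pow, aeval_C, aeval_X]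
    rw [← hw, ← hκρ]
  · have : aeval ρ (derivative (C a * (C κ * X ^ d) ^ 2 + C b * (C κ * X ^ d) + C c : K[X]))
        = (2 * i a * w + i b) * (i κ * (i d * ρ ^ (d - 1))) := by
      simp only [← hκρ, i]
      simp [derivative_pow, map_ofNat (algebraMap K L) 2]
      ring
    rw [this]
    exact mul_ne_zero hd' (mul_ne_zero (hi _ hκ) (mul_ne_zero (hi _ hd) (pow_ne_zero _ hρ0)))

theorem norm_quadSum_le_of_square {K : Type*} [Field K] [Fintype K] (p n : ℕ) [Fact p.Prime]
    {A d r : ℕ} (hr : r = p ^ n) (hK : Fintype.card K = r * r) (hd : 2 ≤ d) (hA : 1 ≤ A)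
    (hdA : d * A + 1 = r) {χ₁ χ₂ : K →* ℂ} (hχ : CharPair d χ₁ χ₂) {a b c : K} (ha : a ≠ 0)
    (hdisc : b ^ 2 - 4 * a * c ≠ 0) :
    ‖quadSum χ₁ χ₂ a b c‖ ≤
      (1 + d * (2 * d) + d * (3 + d * (2 * d)) + 2 * d + 2 : ℕ) * (r : ℝ) := by
  classical
  set B : ℕ := 1 + d * (2 * d) + d * (3 + d * (2 * d)) + 2 * d with hB
  have hn0 : n ≠ 0 := by
    rintro rfl
    nlinarith
  have : CharP K p := by
    refine charP_of_card_eq_prime_pow (f := n + n) ?_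
    rw [hK, hr, pow_add]
  have : CharP (AlgebraicClosure K) p :=
    charP_of_injective_algebraMap (algebraMap K (AlgebraicClosure K)).injective p
  have hdK : (d : K) ≠ 0 := by
    intro h
    have h1 : ((d * A + 1 : ℕ) : K) = 0 := by rw [hdA, hr]; simp [hn0]
    push_cast at h1
    simp [h] at h1
  have hnorm : ∀ x : K, ‖χ₂ x‖ ≤ 1 := by
    intro x
    by_cases hx : x = 0
    · simp [hx, hχ.right_zero]
    · exact (Complex.norm_eq_one_of_pow_eq_one (hχ.right_pow x hx) (by omega)).le
  have hnorm1 : ∀ x : K, ‖χ₁ x‖ ≤ 1 := by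
    intro x
    by_cases hx : x = 0
    · simpa [hx] using hχ.left_zero
    · exact (Complex.norm_eq_one_of_pow_eq_one (hχ.left_pow x hx) (by omega)).le
  let Q : K → K := fun x => a * x ^ 2 + b * x + c
  have hunits : ∀ h : K → ℂ, ∑ x, h x = h 0 + ∑ x : Kˣ, h x := by
    intro h
    rw [← sum_add_sum_compl {(0 : K)}, sum_singleton]
    congr 1
    refine (sum_bij (fun (x : Kˣ) _ => (x : K)) ?_ ?_ ?_ ?_).symm
    · simp
    · intro x _ y _ h; exact Units.ext h
    · intro x hx
      exact ⟨Units.mk0 x (by simpa using hx), mem_univ _, rfl⟩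
    · simp
  have hκ : ∀ κ : Kˣ, ‖∑ z : Kˣ, χ₂ (Q (κ * z ^ d))‖ ≤ B * (r : ℝ) + 1 := by
    intro κ
    obtain ⟨ρ, h0, h1⟩ := exists_simple_root_comp_pow (L := AlgebraicClosure K) ha hdisc
      κ.ne_zero hdK
    have hdeg : (C a * (C (κ : K) * X ^ d) ^ 2 + C b * (C (κ : K) * X ^ d) + C c : K[X]).natDegree
        ≤ 2 * d := by
      rw [mul_pow, ← pow_mul]
      compute_degree
      omega
    have h2 := norm_charSum_le_of_square p n hr hK hd hA hdA hdeg h0 h1 χ₂ hχ.right_zero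
      hχ.right_pow hχ.right_ne
    simp only [eval_add, eval_mul, eval_pow, eval_C, eval_X] at h2
    have h3 := hunits fun z => χ₂ (Q (κ * z ^ d))
    simp only [Q] at h3 ⊢
    rw [← hB, h3] at h2
    calc _ = ‖(_ + ∑ z : Kˣ, χ₂ (a * (κ * (z : K) ^ d) ^ 2 + b * (κ * (z : K) ^ d) + c)) -
          χ₂ (a * (κ * (0 : K) ^ d) ^ 2 + b * (κ * (0 : K) ^ d) + c)‖ := by
            rw [add_sub_cancel_left]
      _ ≤ _ := (norm_sub_le _ _).trans (add_le_add h2 (hnorm _))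
  have hav : (Fintype.card Kˣ : ℂ) * ∑ x : Kˣ, χ₁ x * χ₂ (Q x)
      = ∑ κ : Kˣ, χ₁ κ * ∑ z : Kˣ, χ₂ (Q (κ * z ^ d)) := by
    conv_rhs => simp only [mul_sum]
    rw [sum_comm, ← nsmul_eq_mul, ← card_univ, ← sum_const]
    refine sum_congr rfl fun z _ => ?_
    rw [← Equiv.sum_comp (Equiv.mulRight (z ^ d))]
    refine sum_congr rfl fun κ _ => ?_
    simp [hχ.left_pow]
  have hcard : (0 : ℝ) < Fintype.card Kˣ := by exact_mod_cast Fintype.card_pos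
  have hle : ‖∑ x : Kˣ, χ₁ x * χ₂ (Q x)‖ ≤ B * (r : ℝ) + 1 := by
    refine le_of_mul_le_mul_left ?_ hcard
    calc (Fintype.card Kˣ : ℝ) * ‖∑ x : Kˣ, χ₁ x * χ₂ (Q x)‖
        = ‖∑ κ : Kˣ, χ₁ κ * ∑ z : Kˣ, χ₂ (Q (κ * z ^ d))‖ := by
          rw [← hav, norm_mul, Complex.norm_natCast]
      _ ≤ ∑ κ : Kˣ, (B * (r : ℝ) + 1) := by
          refine norm_sum_le_of_le _ fun κ _ => ?_
          rw [norm_mul]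
          exact (mul_le_mul (hnorm1 _) (hκ κ) (norm_nonneg _) zero_le_one).trans (one_mul _).le
      _ = _ := by rw [sum_const, card_univ, nsmul_eq_mul]
  have hr1 : (1 : ℝ) ≤ r := by exact_mod_cast (by omega : 1 ≤ r)
  rw [quadSum, hunits]
  refine (norm_add_le _ _).trans ((add_le_add (?_ : _ ≤ (1 : ℝ)) hle).trans ?_)
  · rw [norm_mul]
    exact mul_le_one₀ (hnorm1 _) (norm_nonneg _) (hnorm _)
  · push_cast
    linarith

theorem exists_amplified_quadSum
    {Good : ∀ (K : Type u) [Field K] [Fintype K], (K →* ℂ) → (K →* ℂ) → K → K → K → Prop}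
    {β t : ℝ} (ht : 1 ≤ t) (hβ : t ^ 2 - 2 * β = t)
    (hlift : ∀ (K E : Type u) [Field K] [Fintype K] [Field E] [Fintype E] [Algebra K E]
      (χ₁ χ₂ : K →* ℂ) (a b c : K), Good K χ₁ χ₂ a b c → Good E
        (χ₁.comp (Algebra.norm K : E →* K)) (χ₂.comp (Algebra.norm K : E →* K))
        (algebraMap K E a) (algebraMap K E b) (algebraMap K E c))
    (hres : ∀ (K : Type u) [Field K] [Fintype K] (χ₁ χ₂ : K →* ℂ) (a b c : K),
      Good K χ₁ χ₂ a b c → ‖quadResSum χ₁ χ₂ a b c‖ ≤ β * Fintype.card K)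
    {F : Type u} [Field F] [Fintype F] {χ₁ χ₂ : F →* ℂ} {a b c : F} (hG : Good F χ₁ χ₂ a b c)
    {x : ℝ} (hx : 0 ≤ x) (h : (t + x) * √(Fintype.card F) ≤ ‖quadSum χ₁ χ₂ a b c‖) (k : ℕ) :
    ∃ (E : Type u) (_ : Field E) (_ : Fintype E) (ψ₁ ψ₂ : E →* ℂ) (a' b' c' : E),
      Good E ψ₁ ψ₂ a' b' c' ∧ Fintype.card E = Fintype.card F ^ 2 ^ k ∧
      (t + 2 ^ k * x) * √(Fintype.card E) ≤ ‖quadSum ψ₁ ψ₂ a' b' c'‖ := by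
  induction k with
  | zero => exact ⟨F, _, _, χ₁, χ₂, a, b, c, hG, by simp, by simpa using h⟩
  | succ k ih =>
    obtain ⟨K, _, _, ψ₁, ψ₂, a', b', c', hG', hcard, hS⟩ := ih
    obtain ⟨E, _, _, _, hE⟩ := exists_quadratic_extension K
    have hcE : Fintype.card E = Fintype.card K ^ 2 := by
      rw [Module.card_eq_pow_finrank (K := K) (V := E), hE]
    refine ⟨E, _, _, _, _, _, _, _, hlift K E _ _ _ _ _ hG', ?_, ?_⟩
    · rw [hcE, hcard, ← pow_mul, pow_succ]
    · have hid := quadSum_sq_add_quadSum_norm hE ψ₁ ψ₂ a' b' c'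
      have hR := hres K _ _ _ _ _ hG'
      set S := quadSum ψ₁ ψ₂ a' b' c'
      set R := quadResSum ψ₁ ψ₂ a' b' c'
      rw [eq_sub_of_add_eq' hid, hcE]
      have hq : √((Fintype.card K : ℝ)) ^ 2 = Fintype.card K := Real.sq_sqrt (by positivity)
      push_cast
      rw [Real.sqrt_sq (by positivity)]
      set s := √((Fintype.card K : ℝ))
      have hs : 0 ≤ s := Real.sqrt_nonneg _
      have h1 : ‖S‖ ^ 2 - 2 * ‖R‖ ≤ ‖2 * R - S ^ 2‖ := by
        have := norm_sub_norm_le (S ^ 2) (2 * R)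
        rw [norm_sub_rev] at this
        simpa using this
      have hy : 0 ≤ 2 ^ k * x := by positivity
      have h2 : ((t + 2 ^ k * x) * s) ^ 2 ≤ ‖S‖ ^ 2 := by gcongr
      rw [mul_pow, hq] at h2
      refine le_trans ?_ h1
      have hk : (0 : ℝ) ≤ Fintype.card K := by positivity
      rw [pow_succ]
      have h3 : t + 2 * (2 ^ k * x) ≤ (t + 2 ^ k * x) ^ 2 - 2 * β := by nlinarith
      have h4 := mul_le_mul_of_nonneg_right h3 hk
      linarith

theorem norm_quadSum_le_of_quadResSum_le
    (Good : ∀ (K : Type u) [Field K] [Fintype K], (K →* ℂ) → (K →* ℂ) → K → K → K → Prop)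
    {β t : ℝ} (ht : 1 ≤ t) (hβ : t ^ 2 - 2 * β = t)
    (hlift : ∀ (K E : Type u) [Field K] [Fintype K] [Field E] [Fintype E] [Algebra K E]
      (χ₁ χ₂ : K →* ℂ) (a b c : K), Good K χ₁ χ₂ a b c → Good E
        (χ₁.comp (Algebra.norm K : E →* K)) (χ₂.comp (Algebra.norm K : E →* K))
        (algebraMap K E a) (algebraMap K E b) (algebraMap K E c))
    (hres : ∀ (K : Type u) [Field K] [Fintype K] (χ₁ χ₂ : K →* ℂ) (a b c : K),
      Good K χ₁ χ₂ a b c → ‖quadResSum χ₁ χ₂ a b c‖ ≤ β * Fintype.card K)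
    {F : Type u} [Field F] [Fintype F] {χ₁ χ₂ : F →* ℂ} {a b c : F} (hG : Good F χ₁ χ₂ a b c)
    (hpair : ∀ (K : Type u) [Field K] [Fintype K] (χ₁ χ₂ : K →* ℂ) (a b c : K),
      Good K χ₁ χ₂ a b c → CharPair (Fintype.card F - 1) χ₁ χ₂ ∧ a ≠ 0 ∧ b ^ 2 - 4 * a * c ≠ 0) :
    ‖quadSum χ₁ χ₂ a b c‖ ≤ t * √(Fintype.card F) := by
  by_contra! hcon
  have hq1 : 1 < Fintype.card F := Fintype.one_lt_card
  have hs : 0 < √(Fintype.card F : ℝ) := Real.sqrt_pos.mpr (by positivity)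
  set d := Fintype.card F - 1 with hd
  set x := ‖quadSum χ₁ χ₂ a b c‖ / √(Fintype.card F) - t with hx
  have hx0 : 0 < x := by rwa [hx, sub_pos, lt_div_iff₀ hs]
  have h0 : (t + x) * √(Fintype.card F) ≤ ‖quadSum χ₁ χ₂ a b c‖ := by
    rw [hx, add_sub_cancel, div_mul_cancel₀ _ hs.ne']
  have hd2 : 2 ≤ d := by
    obtain ⟨y, hy, hy1⟩ := (hpair F _ _ _ _ _ hG).1.right_ne
    by_contra hlt
    have : d = 1 := by omega
    have h := (hpair F _ _ _ _ _ hG).1.right_pow y hy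
    rw [this, pow_one] at h
    exact hy1 h
  obtain ⟨p, -, n, hp, hFp⟩ := FiniteField.card' F
  have : Fact p.Prime := ⟨hp⟩
  set B : ℕ := 1 + d * (2 * d) + d * (3 + d * (2 * d)) + 2 * d + 2
  obtain ⟨k, hk⟩ := pow_unbounded_of_one_lt (B / x) (one_lt_two (α := ℝ))
  obtain ⟨E, _, _, ψ₁, ψ₂, a', b', c', hG', hcard, hS⟩ :=
    exists_amplified_quadSum ht hβ hlift hres hG hx0.le h0 (k + 1)
  obtain ⟨hP, ha, hdisc⟩ := hpair E _ _ _ _ _ hG'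
  set r := Fintype.card F ^ 2 ^ k with hr
  have hrr : Fintype.card E = r * r := by rw [hcard, hr, ← pow_add, pow_succ, mul_two]
  have hr2 : 1 < r := Nat.one_lt_pow (by positivity) hq1
  obtain ⟨A, hA⟩ : d ∣ r - 1 := by
    simpa [hd, hr] using Nat.sub_dvd_pow_sub_pow (Fintype.card F) 1 (2 ^ k)
  have hA1 : 1 ≤ A := Nat.one_le_iff_ne_zero.mpr (by rintro rfl; omega)
  have hrp : r = p ^ ((n : ℕ) * 2 ^ k) := by rw [hr, hFp, pow_mul]
  have hle := norm_quadSum_le_of_square p _ hrp hrr hd2 hA1 (by omega) hP ha hdisc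
  have hsq : √(Fintype.card E : ℝ) = r := by
    rw [hrr, Nat.cast_mul, Real.sqrt_mul_self (by positivity)]
  rw [hsq] at hS
  have hr0 : (0 : ℝ) < r := by exact_mod_cast (by omega : 0 < r)
  have h1 := le_of_mul_le_mul_right (hS.trans hle) hr0
  rw [div_lt_iff₀ hx0] at hk
  rw [pow_succ] at h1
  have : 0 < 2 ^ k * x := by positivity
  linarith

section

variable {K : Type*} [Field K] [Fintype K]

theorem MulChar.norm_apply_le_one (χ : MulChar K ℂ) (x : K) : ‖χ x‖ ≤ 1 := by
  classical
  by_cases hx : x = 0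
  · simp [hx]
  · have h := χ.pow_card_eq_one
    refine (Complex.norm_eq_one_of_pow_eq_one (n := Fintype.card Kˣ) ?_
      Fintype.card_ne_zero).le
    rw [← χ.pow_apply' Fintype.card_ne_zero, h, MulChar.one_apply (Ne.isUnit hx)]

theorem norm_jacobiSum_le {χ φ : MulChar K ℂ} (hχ : χ ≠ 1) (hφ : φ ≠ 1) :
    ‖jacobiSum χ φ‖ ≤ √(Fintype.card K) := by
  by_cases h : χ * φ = 1
  · rw [eq_inv_of_mul_eq_one_right h, jacobiSum_nontrivial_inv hχ, norm_neg]
    refine (χ.norm_apply_le_one _).trans ?_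
    rw [Real.one_le_sqrt]
    exact_mod_cast Fintype.card_pos (α := K)
  · have hchar : ringChar ℂ ≠ ringChar K := by
      rw [ringChar.eq_zero]
      exact (CharP.char_ne_zero_of_finite K (ringChar K)).symm
    have h1 := jacobiSum_mul_jacobiSum_inv hchar hχ hφ h
    have h2 : jacobiSum χ⁻¹ φ⁻¹ = starRingEnd ℂ (jacobiSum χ φ) := by
      rw [← jacobiSum_ringHomComp, ← MulChar.star_eq_inv, ← MulChar.star_eq_inv]
      rfl
    rw [h2, Complex.mul_conj, ← Complex.ofReal_natCast, Complex.ofReal_inj,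
      Complex.normSq_eq_norm_sq] at h1
    rw [← h1, Real.sqrt_sq (norm_nonneg _)]

theorem sum_mulChar_linear {χ : MulChar K ℂ} (hχ : χ ≠ 1) {a : K} (ha : a ≠ 0) (b : K) :
    ∑ x, χ (a * x + b) = 0 := by
  rw [← MulChar.sum_eq_zero_of_ne_one hχ,
    ← Equiv.sum_comp ((Equiv.mulLeft₀ a ha).trans (Equiv.addRight b)) χ]
  rfl

theorem sum_mulChar_mul_linear (χ φ : MulChar K ℂ) {a c : K} (ha : a ≠ 0) (hc : c ≠ 0) :
    ∑ x, χ x * φ (a * x - c) = χ (c / a) * φ (-c) * jacobiSum χ φ := by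
  rw [jacobiSum, mul_sum, ← Equiv.sum_comp (Equiv.mulLeft₀ (c / a) (div_ne_zero hc ha))]
  refine sum_congr rfl fun x _ => ?_
  have : a * (c / a * x) - c = -c * (1 - x) := by field_simp; ring
  simp only [Equiv.mulLeft₀_apply, this, map_mul]
  ring

theorem mulChar_sq_eq_one_apply {χ : MulChar K ℂ} (hχ : χ ≠ 1) (h2 : χ ^ 2 = 1) :
    ringChar K ≠ 2 ∧ ∀ [DecidableEq K] (x : K), χ x = (quadraticChar K x : ℂ) := by
  have hsq : ∀ x : K, x ≠ 0 → IsSquare x → χ x = 1 := by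
    rintro _ hx ⟨y, rfl⟩
    have hy : y ≠ 0 := fun h => hx (by simp [h])
    rw [map_mul, ← sq, ← χ.pow_apply' two_ne_zero, h2, MulChar.one_apply (Ne.isUnit hy)]
  obtain ⟨w, hw⟩ := MulChar.ne_one_iff.mp hχ
  have hwn : ¬ IsSquare (w : K) := fun h => hw (hsq _ w.ne_zero h)
  refine ⟨fun h => hwn (FiniteField.isSquare_of_char_two h _), fun {_} x => ?_⟩
  have hw1 : χ w = -1 := by
    have h : χ w ^ 2 = 1 := by rw [← χ.pow_apply' two_ne_zero, h2, MulChar.one_apply w.isUnit]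
    exact (sq_eq_one_iff.mp h).resolve_left hw
  by_cases hx : x = 0
  · rw [hx, χ.map_zero, MulChar.map_zero, Int.cast_zero]
  by_cases hxs : IsSquare x
  · rw [hsq x hx hxs, (quadraticChar_one_iff_isSquare hx).mpr hxs, Int.cast_one]
  · have h1 := quadraticChar_neg_one_iff_not_isSquare.mpr hxs
    have h3 := quadraticChar_neg_one_iff_not_isSquare.mpr hwn
    have hxw : x * w ≠ 0 := mul_ne_zero hx w.ne_zero
    have h4 : IsSquare (x * w) := by
      rw [← quadraticChar_one_iff_isSquare hxw, map_mul, h1, h3]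
      norm_num
    have h5 := hsq _ hxw h4
    rw [map_mul, hw1] at h5
    rw [h1]
    push_cast
    linear_combination -h5

theorem norm_sum_quadratic_le_one {χ : MulChar K ℂ} (hχ : χ ≠ 1) (h2 : χ ^ 2 = 1) {a b c : K}
    (ha : a ≠ 0) (hdisc : b ^ 2 - 4 * a * c ≠ 0) :
    ‖∑ x, χ (a * x ^ 2 + b * x + c)‖ ≤ 1 := by
  classical
  obtain ⟨hchar, hquad⟩ := mulChar_sq_eq_one_apply hχ h2
  have h20 : (2 : K) ≠ 0 := Ring.two_ne_zero hchar
  set D := b ^ 2 - 4 * a * c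
  have h4a : (4 : K) * a ≠ 0 := by
    rw [show (4 : K) = 2 * 2 by norm_num]
    exact mul_ne_zero (mul_ne_zero h20 h20) ha
  have hnorm : ∀ x : K, x ≠ 0 → ‖χ x‖ = 1 := by
    intro x hx
    refine Complex.norm_eq_one_of_pow_eq_one (n := 2) ?_ two_ne_zero
    rw [← χ.pow_apply' two_ne_zero, h2, MulChar.one_apply (Ne.isUnit hx)]
  have h1 : χ (4 * a) * ∑ x, χ (a * x ^ 2 + b * x + c) = ∑ s, χ (s ^ 2 - D) := by
    rw [mul_sum, ← Equiv.sum_comp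
      ((Equiv.mulLeft₀ (2 * a) (mul_ne_zero h20 ha)).trans (Equiv.addRight b))
      fun s => χ (s ^ 2 - D)]
    refine sum_congr rfl fun x _ => ?_
    rw [← map_mul]
    congr 1
    simp only [Equiv.trans_apply, Equiv.mulLeft₀_apply, Equiv.coe_addRight, D]
    ring
  have h3 : ∑ s, χ (s ^ 2 - D) = ∑ u, (χ u + 1) * χ (u - D) := by
    rw [← sum_fiberwise univ (fun s : K => s ^ 2)]
    refine sum_congr rfl fun u _ => ?_
    rw [sum_congr rfl (g := fun _ => χ (u - D)) (fun i hi => by rw [(mem_filter.mp hi).2]),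
      sum_const, nsmul_eq_mul, hquad u]
    have := quadraticChar_card_sqrts hchar u
    rw [Set.toFinset_ofPred] at this
    congr 1
    exact_mod_cast this
  have h5 : ∑ s, χ (s ^ 2 - D) = χ (D / 1) * χ (-D) * (-χ (-1)) := by
    have h6 := sum_mulChar_mul_linear χ χ one_ne_zero hdisc
    have h7 := sum_mulChar_linear hχ one_ne_zero (-D)
    simp only [one_mul, ← sub_eq_add_neg] at h6 h7
    have hinv : χ⁻¹ = χ := by
      rw [inv_eq_iff_mul_eq_one, ← sq, h2]
    have h8 := jacobiSum_nontrivial_inv hχ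
    rw [hinv] at h8
    rw [h3, ← h8, ← h6, ← add_zero (∑ x, χ x * χ (x - D)), ← h7, ← sum_add_distrib]
    exact sum_congr rfl fun u _ => by ring
  rw [← one_mul ‖_‖, ← hnorm _ h4a, ← norm_mul, h1, h5, hnorm _ h4a]
  simp only [norm_mul, norm_neg]
  exact mul_le_one₀ (mul_le_one₀ (χ.norm_apply_le_one _) (norm_nonneg _) (χ.norm_apply_le_one _))
    (norm_nonneg _) (χ.norm_apply_le_one _)

theorem quadResSum_eq (χ : K →* ℂ) (ψ : MulChar K ℂ) {a b c : K} (ha : a ≠ 0) :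
    quadResSum χ ψ.toMonoidHom a b c
      = (∑ s, ψ (a * c * s ^ 2 + b * s + 1)) * ∑ p, χ p * ψ (a * p - c) ^ 2
        + χ (c / a) * ∑ s, ψ (a * c * (s + b / a) ^ 2) := by
  classical
  have hp : ∀ p, ∑ s, ψ (quadRes a b c s p) = (∑ s, ψ (a * c * s ^ 2 + b * s + 1))
      * ψ (a * p - c) ^ 2 + if p = c / a then ∑ s, ψ (a * c * (s + b / a) ^ 2) else 0 := by
    intro p
    by_cases h : p = c / a
    · subst h
      have h0 : a * (c / a) - c = 0 := by field_simp; ring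
      rw [if_pos rfl, h0, MulChar.map_zero, zero_pow two_ne_zero, mul_zero, zero_add]
      refine sum_congr rfl fun s _ => ?_
      congr 1
      rw [quadRes]
      field_simp
      ring
    · have hδ : a * p - c ≠ 0 := fun h0 => h (by field_simp; linear_combination h0)
      rw [if_neg h, add_zero, sum_mul,
        ← Equiv.sum_comp ((Equiv.mulLeft₀ _ hδ).trans (Equiv.addRight (-(b / a))))]
      refine sum_congr rfl fun s _ => ?_
      rw [← map_pow, ← map_mul]
      congr 1
      simp only [Equiv.trans_apply, Equiv.mulLeft₀_apply, Equiv.coe_addRight, quadRes]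
      field_simp
      ring
  rw [quadResSum, Fintype.sum_prod_type_right]
  simp only [MulChar.coe_toMonoidHom, ← mul_sum, hp, mul_add, sum_add_distrib]
  congr 1
  · rw [mul_sum]
    exact sum_congr rfl fun p _ => by ring
  · simp

end

section CompNorm

variable {F E : Type*} [Field F] [Field E] [Finite E] [Algebra F E]

/-- The multiplicative character `χ ∘ N` of an extension of finite fields. -/
noncomputable def MulChar.compNorm (E : Type*) [Field E] [Finite E] [Algebra F E]
    (χ : MulChar F ℂ) : MulChar E ℂ :=
  { χ.toMonoidHom.comp (Algebra.norm F : E →* F) with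
    map_nonunit' := fun x hx => by
      have : x = 0 := by simpa using hx
      simp [this] }

theorem MulChar.compNorm_apply (χ : MulChar F ℂ) (x : E) :
    χ.compNorm E x = χ (Algebra.norm F x) := rfl

theorem MulChar.compNorm_pow (χ : MulChar F ℂ) (n : ℕ) :
    χ.compNorm E ^ n = (χ ^ n).compNorm E := by
  ext x
  rw [MulChar.pow_apply_coe, MulChar.compNorm_apply, MulChar.compNorm_apply]
  have : Algebra.norm F (x : E) ≠ 0 := Algebra.norm_ne_zero_iff.mpr x.ne_zero
  rw [← Units.val_mk0 this, MulChar.pow_apply_coe]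

theorem MulChar.compNorm_one : (1 : MulChar F ℂ).compNorm E = 1 := by
  ext x
  rw [MulChar.compNorm_apply, MulChar.one_apply_coe,
    MulChar.one_apply (Algebra.norm_ne_zero_iff.mpr x.ne_zero).isUnit]

theorem MulChar.compNorm_ne_one [Finite F] {χ : MulChar F ℂ} (h : χ ≠ 1) : χ.compNorm E ≠ 1 := by
  obtain ⟨x, hx⟩ := MulChar.ne_one_iff.mp h
  obtain ⟨y, hy⟩ := FiniteField.norm_surjective F E x
  have hy0 : y ≠ 0 := by
    rintro rfl
    rw [Algebra.norm_zero] at hy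
    exact x.ne_zero hy.symm
  refine MulChar.ne_one_iff.mpr ⟨Units.mk0 y hy0, ?_⟩
  rwa [Units.val_mk0, MulChar.compNorm_apply, hy]

end CompNorm

theorem disc_algebraMap_ne_zero {F E : Type*} [Field F] [Field E] [Algebra F E] {a b c : F}
    (h : b ^ 2 - 4 * a * c ≠ 0) : algebraMap F E b ^ 2
      - 4 * algebraMap F E a * algebraMap F E c ≠ 0 := by
  have := (map_ne_zero (algebraMap F E)).mpr h
  simpa only [map_sub, map_mul, map_pow, map_ofNat] using this

theorem MulChar.apply_pow_of_pow_eq_one {K : Type*} [Field K] {χ : MulChar K ℂ} {d : ℕ}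
    (h : χ ^ d = 1) {x : K} (hx : x ≠ 0) : χ x ^ d = 1 := by
  rw [← Units.val_mk0 hx, ← MulChar.pow_apply_coe, h, MulChar.one_apply_coe]

theorem MulChar.exists_ne_zero_apply_ne_one {K : Type*} [Field K] {χ : MulChar K ℂ}
    (h : χ ≠ 1) : ∃ x ≠ 0, χ x ≠ 1 := by
  obtain ⟨x, hx⟩ := MulChar.ne_one_iff.mp h
  exact ⟨x, x.ne_zero, hx⟩

theorem MulChar.pow_card_sub_one {K : Type*} [Field K] [Fintype K] (χ : MulChar K ℂ) :
    χ ^ (Fintype.card K - 1) = 1 := by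
  classical
  rw [← Fintype.card_units]
  exact χ.pow_card_eq_one

theorem norm_sum_quadratic_le {F : Type u} [Field F] [Fintype F] {χ : MulChar F ℂ} (hχ : χ ≠ 1)
    {a b c : F} (ha : a ≠ 0) (hdisc : b ^ 2 - 4 * a * c ≠ 0) :
    ‖∑ x, χ (a * x ^ 2 + b * x + c)‖ ≤ √(Fintype.card F) := by
  by_cases h2 : χ ^ 2 = 1
  · refine (norm_sum_quadratic_le_one hχ h2 ha hdisc).trans ?_
    rw [Real.one_le_sqrt]
    exact_mod_cast Fintype.card_pos (α := F)
  set d := Fintype.card F - 1 with hd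
  let Good : ∀ (K : Type u) [Field K] [Fintype K], (K →* ℂ) → (K →* ℂ) → K → K → K → Prop :=
    fun K _ _ χ₁ χ₂ a b c => χ₁ = 1 ∧ a ≠ 0 ∧ b ^ 2 - 4 * a * c ≠ 0 ∧
      ∃ ψ : MulChar K ℂ, χ₂ = ψ.toMonoidHom ∧ ψ ^ d = 1 ∧ ψ ^ 2 ≠ 1
  have := norm_quadSum_le_of_quadResSum_le Good (β := 0) (t := 1) (F := F) (χ₁ := 1)
    (χ₂ := χ.toMonoidHom) (a := a) (b := b) (c := c) le_rfl (by norm_num) ?_ ?_ ?_ ?_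
  · simpa [quadSum] using this
  · rintro K E _ _ _ _ _ _ _ a b c ⟨rfl, ha, hdisc, ψ, rfl, hψ, hψ2⟩
    refine ⟨rfl, (_root_.map_ne_zero _).mpr ha, disc_algebraMap_ne_zero hdisc, ψ.compNorm E, rfl, ?_, ?_⟩
    · rw [MulChar.compNorm_pow, hψ, MulChar.compNorm_one]
    · rw [MulChar.compNorm_pow]
      exact MulChar.compNorm_ne_one hψ2
  · rintro K _ _ _ _ a b c ⟨rfl, ha, hdisc, ψ, rfl, hψ, hψ2⟩
    rw [quadResSum_eq _ _ ha]
    have h1 := sum_mulChar_linear hψ2 ha (-c)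
    have h3 := sum_mulChar_linear hψ2 one_ne_zero (b / a)
    simp only [MulChar.pow_apply' _ two_ne_zero, one_mul, ← sub_eq_add_neg] at h1 h3
    simp [h1, map_mul, ← mul_sum, h3]
  · exact ⟨rfl, ha, hdisc, χ, rfl, χ.pow_card_sub_one, h2⟩
  · rintro K _ _ _ _ a b c ⟨rfl, ha, hdisc, ψ, rfl, hψ, hψ2⟩
    refine ⟨⟨by simp, by simp, ψ.map_zero, fun x hx => ψ.apply_pow_of_pow_eq_one hψ hx,
      MulChar.exists_ne_zero_apply_ne_one ?_⟩, ha, hdisc⟩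
    rintro rfl
    exact hψ2 (one_pow 2)

theorem norm_quadResSum_le {K : Type*} [Field K] [Fintype K] {χ ψ : MulChar K ℂ} (hχ : χ ≠ 1)
    (hψ : ψ ≠ 1) {a b c : K} (ha : a ≠ 0) (hdisc : b ^ 2 - 4 * a * c ≠ 0) :
    ‖quadResSum χ.toMonoidHom ψ.toMonoidHom a b c‖ ≤ Fintype.card K := by
  classical
  rw [quadResSum_eq _ _ ha]
  simp only [MulChar.coe_toMonoidHom]
  by_cases hc : c = 0
  · have hb : b ≠ 0 := by rintro rfl; simp [hc] at hdisc
    have h := sum_mulChar_linear hψ hb 1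
    simp [hc, h, χ.map_zero]
  have hdisc' : b ^ 2 - 4 * (a * c) * 1 ≠ 0 := by convert hdisc using 2; ring
  have hac : a * c ≠ 0 := mul_ne_zero ha hc
  by_cases h2 : ψ ^ 2 = 1
  · have hsq : ∀ x : K, x ≠ 0 → ψ x ^ 2 = 1 := fun x hx => ψ.apply_pow_of_pow_eq_one h2 hx
    have hT := norm_sum_quadratic_le_one hψ h2 hac hdisc'
    have h1 : ∑ p, χ p * ψ (a * p - c) ^ 2 = -χ (c / a) := by
      rw [eq_neg_iff_add_eq_zero, ← MulChar.sum_eq_zero_of_ne_one hχ,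
        ← sum_erase_add _ _ (mem_univ (c / a)), ← sum_erase_add univ χ (mem_univ (c / a))]
      have h0 : a * (c / a) - c = 0 := by field_simp; ring
      rw [h0, ψ.map_zero]
      congr 1
      rw [zero_pow two_ne_zero, mul_zero, add_zero]
      refine sum_congr rfl fun p hp => ?_
      rw [hsq, mul_one]
      intro h
      refine (mem_erase.mp hp).1 ?_
      field_simp
      linear_combination h
    have h3 : ‖∑ s, ψ (a * c * (s + b / a) ^ 2)‖ ≤ Fintype.card K - 1 := by
      rw [← sum_erase_add _ _ (mem_univ (-(b / a)))]
      rw [neg_add_cancel, zero_pow two_ne_zero, mul_zero, ψ.map_zero, add_zero]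
      refine (norm_sum_le_of_le _ fun s _ => ψ.norm_apply_le_one _).trans ?_
      rw [sum_const, card_erase_of_mem (mem_univ _), card_univ, nsmul_eq_mul, mul_one,
        Nat.cast_sub Fintype.card_pos, Nat.cast_one]
    rw [h1]
    refine (norm_add_le _ _).trans ?_
    rw [norm_mul, norm_mul, norm_neg]
    have h4 := χ.norm_apply_le_one (c / a)
    have h5 := mul_le_one₀ hT (norm_nonneg _) h4
    have h6 := mul_le_mul h4 h3 (norm_nonneg _) zero_le_one
    linarith
  · have h3 := sum_mulChar_linear h2 one_ne_zero (b / a)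
    simp only [MulChar.pow_apply' _ two_ne_zero, one_mul] at h3
    have h1 := sum_mulChar_mul_linear χ (ψ ^ 2) ha hc
    simp only [MulChar.pow_apply' _ two_ne_zero] at h1
    simp only [map_mul, map_pow, ← mul_sum, h3, h1, mul_zero, add_zero]
    rw [norm_mul]
    refine (mul_le_mul (b := √(Fintype.card K)) (d := √(Fintype.card K))
      ?_ ?_ (norm_nonneg _) (Real.sqrt_nonneg _)).trans ?_
    · simpa only [map_mul] using norm_sum_quadratic_le hψ hac hdisc'
    · rw [norm_mul, ← one_mul √_]
      refine mul_le_mul ?_ (norm_jacobiSum_le hχ h2) (norm_nonneg _) zero_le_one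
      rw [norm_mul, norm_pow]
      exact mul_le_one₀ (χ.norm_apply_le_one _) (by positivity)
        (pow_le_one₀ (norm_nonneg _) (ψ.norm_apply_le_one _))
    · rw [Real.mul_self_sqrt (by positivity)]

theorem norm_sum_mul_quadratic_le {F : Type u} [Field F] [Fintype F] {χ ψ : MulChar F ℂ}
    (hχ : χ ≠ 1) (hψ : ψ ≠ 1) {a b c : F} (ha : a ≠ 0) (hdisc : b ^ 2 - 4 * a * c ≠ 0) :
    ‖∑ x, χ x * ψ (a * x ^ 2 + b * x + c)‖ ≤ 2 * √(Fintype.card F) := by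
  set d := Fintype.card F - 1 with hd
  let Good : ∀ (K : Type u) [Field K] [Fintype K], (K →* ℂ) → (K →* ℂ) → K → K → K → Prop :=
    fun K _ _ χ₁ χ₂ a b c => a ≠ 0 ∧ b ^ 2 - 4 * a * c ≠ 0 ∧ ∃ φ ψ : MulChar K ℂ,
      χ₁ = φ.toMonoidHom ∧ χ₂ = ψ.toMonoidHom ∧ φ ^ d = 1 ∧ φ ≠ 1 ∧ ψ ^ d = 1 ∧ ψ ≠ 1
  refine norm_quadSum_le_of_quadResSum_le Good (β := 1) (t := 2) (F := F) (χ₁ := χ.toMonoidHom)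
    (χ₂ := ψ.toMonoidHom) (a := a) (b := b) (c := c) (by norm_num) (by norm_num) ?_ ?_ ?_ ?_
  · rintro K E _ _ _ _ _ _ _ a b c ⟨ha, hdisc, φ, ψ, rfl, rfl, hφ, hφ1, hψ, hψ1⟩
    refine ⟨(_root_.map_ne_zero _).mpr ha, disc_algebraMap_ne_zero hdisc, φ.compNorm E, ψ.compNorm E,
      rfl, rfl, ?_, MulChar.compNorm_ne_one hφ1, ?_, MulChar.compNorm_ne_one hψ1⟩
    · rw [MulChar.compNorm_pow, hφ, MulChar.compNorm_one]
    · rw [MulChar.compNorm_pow, hψ, MulChar.compNorm_one]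
  · rintro K _ _ _ _ a b c ⟨ha, hdisc, φ, ψ, rfl, rfl, hφ, hφ1, hψ, hψ1⟩
    rw [one_mul]
    exact norm_quadResSum_le hφ1 hψ1 ha hdisc
  · exact ⟨ha, hdisc, χ, ψ, rfl, rfl, χ.pow_card_sub_one, hχ, ψ.pow_card_sub_one, hψ⟩
  · rintro K _ _ _ _ a b c ⟨ha, hdisc, φ, ψ, rfl, rfl, hφ, hφ1, hψ, hψ1⟩
    exact ⟨⟨by simp [φ.map_zero], fun x hx => φ.apply_pow_of_pow_eq_one hφ hx, ψ.map_zero,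
      fun x hx => ψ.apply_pow_of_pow_eq_one hψ hx, MulChar.exists_ne_zero_apply_ne_one hψ1⟩,
      ha, hdisc⟩

theorem norm_sum_one_mul_quadratic_le {F : Type u} [Field F] [Fintype F] {ψ : MulChar F ℂ}
    (hψ : ψ ≠ 1) {a b c : F} (ha : a ≠ 0) (hdisc : b ^ 2 - 4 * a * c ≠ 0) :
    ‖∑ x, (1 : MulChar F ℂ) x * ψ (a * x ^ 2 + b * x + c)‖ ≤ √(Fintype.card F) + 1 := by
  classical
  have h : ∑ x, (1 : MulChar F ℂ) x * ψ (a * x ^ 2 + b * x + c)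
      = ∑ x, ψ (a * x ^ 2 + b * x + c) - ψ c := by
    rw [← sum_erase_add _ _ (mem_univ (0 : F)), ← sum_erase_add univ (fun x => ψ _)
      (mem_univ (0 : F)), MulChar.map_zero]
    have : a * 0 ^ 2 + b * 0 + c = c := by ring
    rw [this, zero_mul, add_zero, add_sub_cancel_right]
    refine sum_congr rfl fun x hx => ?_
    rw [MulChar.one_apply (mem_erase.mp hx).1.isUnit, one_mul]
  rw [h]
  exact (norm_sub_le _ _).trans (add_le_add (norm_sum_quadratic_le hψ ha hdisc)
    (ψ.norm_apply_le_one _))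

theorem norm_sum_mul_one_quadratic_le {F : Type u} [Field F] [Fintype F] {χ : MulChar F ℂ}
    (hχ : χ ≠ 1) {a b c : F} (ha : a ≠ 0) :
    ‖∑ x, χ x * (1 : MulChar F ℂ) (a * x ^ 2 + b * x + c)‖ ≤ 2 := by
  classical
  have h : ∑ x, χ x * (1 : MulChar F ℂ) (a * x ^ 2 + b * x + c)
      = -∑ x with a * x ^ 2 + b * x + c = 0, χ x := by
    rw [eq_neg_iff_add_eq_zero, ← MulChar.sum_eq_zero_of_ne_one hχ, sum_filter,
      ← sum_add_distrib]
    refine sum_congr rfl fun x _ => ?_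
    by_cases hx : a * x ^ 2 + b * x + c = 0
    · rw [if_pos hx, hx, MulChar.map_zero, mul_zero, zero_add]
    · rw [if_neg hx, MulChar.one_apply (Ne.isUnit hx)]
      simp
  rw [h, norm_neg]
  refine (norm_sum_le_of_le _ fun x _ => χ.norm_apply_le_one _).trans ?_
  rw [sum_const, nsmul_eq_mul, mul_one]
  have hdeg : (C a * X ^ 2 + C b * X + C c : F[X]).natDegree = 2 := natDegree_quadratic ha
  have h0 : (C a * X ^ 2 + C b * X + C c : F[X]) ≠ 0 := by
    intro h; rw [h] at hdeg; simp at hdeg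
  have hle : #{x : F | a * x ^ 2 + b * x + c = 0} ≤ 2 := by
    refine le_trans ?_ (hdeg ▸ card_roots' _)
    refine (card_le_card fun x hx => ?_).trans (Multiset.toFinset_card_le _)
    rw [Multiset.mem_toFinset, mem_roots h0]
    simpa using hx
  exact_mod_cast hle

section

variable {F : Type*} [Field F] [Fintype F]

theorem efree_iff {e : ℕ} (he : e ≠ 0) (g : F) :
    EFree e g ↔ g ≠ 0 ∧ ∀ p ∈ e.primeFactors, ¬ ∃ h : F, g = h ^ p := by
  refine and_congr_right fun _ => ⟨fun h p hp hg => ?_, fun h d hd ⟨y, hy⟩ => ?_⟩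
  · exact (Nat.prime_of_mem_primeFactors hp).ne_one (h p (Nat.dvd_of_mem_primeFactors hp) hg)
  · by_contra hd1
    obtain ⟨k, hk⟩ := Nat.minFac_dvd d
    refine h d.minFac (Nat.mem_primeFactors.mpr
      ⟨Nat.minFac_prime hd1, (Nat.minFac_dvd d).trans hd, he⟩) ⟨y ^ k, ?_⟩
    rw [hy, ← pow_mul, mul_comm, ← hk]

open Classical in
/-- The indicator function of the nonzero elements that are not `p`-th powers for any `p ∈ P`. -/
noncomputable def nonPowInd (P : Finset ℕ) (g : F) : ℂ :=
  if g ≠ 0 ∧ ∀ p ∈ P, ¬ ∃ h : F, g = h ^ p then 1 else 0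

theorem natCast_NN {e₁ e₂ : ℕ} (h₁ : e₁ ≠ 0) (h₂ : e₂ ≠ 0) (a b c : F) :
    (NN a b c e₁ e₂ : ℂ) = ∑ g, nonPowInd e₁.primeFactors g
      * nonPowInd e₂.primeFactors (a * g ^ 2 + b * g + c) := by
  classical
  rw [NN, Set.ncard_eq_toFinset_card', Set.toFinset_ofPred, card_filter, Nat.cast_sum]
  refine sum_congr rfl fun g _ => ?_
  rw [efree_iff h₁, efree_iff h₂]
  simp only [nonPowInd, ite_zero_mul_ite_zero, mul_one, Nat.cast_ite, Nat.cast_one, Nat.cast_zero]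

theorem mulChar_apply_eq_one_iff {p : ℕ} {ψ : MulChar F ℂ} (hψ : orderOf ψ = p) {g : F}
    (hg : g ≠ 0) : ψ g = 1 ↔ ∃ h : F, g = h ^ p := by
  constructor
  · intro h
    obtain ⟨γ, hγ⟩ := IsCyclic.exists_generator (α := Fˣ)
    obtain ⟨k, hk⟩ := mem_powers_iff_mem_zpowers.mpr (hγ (Units.mk0 g hg))
    have hk' : (γ : F) ^ k = g := by
      simpa using congrArg Units.val hk
    have h1 : ψ ^ k = 1 := by
      ext x
      obtain ⟨j, rfl⟩ := mem_powers_iff_mem_zpowers.mpr (hγ x)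
      rw [MulChar.pow_apply_coe, MulChar.one_apply_coe]
      simp only [Units.val_pow_eq_pow_val, map_pow]
      rw [← pow_mul, mul_comm, pow_mul, ← map_pow, hk', h, one_pow]
    obtain ⟨m, rfl⟩ := hψ ▸ orderOf_dvd_of_pow_eq_one h1
    exact ⟨(γ : F) ^ m, by rw [← hk', ← pow_mul, mul_comm]⟩
  · rintro ⟨y, rfl⟩
    have hp : p ≠ 0 := by
      rintro rfl
      exact (orderOf_pos ψ).ne' hψ
    have hy : y ≠ 0 := by
      rintro rfl
      exact hg (zero_pow hp)
    rw [map_pow]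
    exact ψ.apply_pow_of_pow_eq_one (hψ ▸ pow_orderOf_eq_one ψ) hy

theorem exists_mulChar_nonPowInd_insert {p : ℕ} (hp : p.Prime) (hpq : p ∣ Fintype.card F - 1) :
    ∃ ψ : MulChar F ℂ, orderOf ψ = p ∧ ∀ (P : Finset ℕ) (g : F),
      nonPowInd (insert p P) g = nonPowInd P g * ((1 - 1 / (p : ℂ)) * (1 : MulChar F ℂ) g
        - 1 / p * ∑ k ∈ Ico 1 p, (ψ ^ k) g) := by
  classical
  obtain ⟨ψ, hψ⟩ := MulChar.exists_mulChar_orderOf F hpq (Complex.isPrimitiveRoot_exp p hp.ne_zero)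
  refine ⟨ψ, hψ, fun P g => ?_⟩
  by_cases hg : g = 0
  · simp [nonPowInd, hg]
  have hp0 : (p : ℂ) ≠ 0 := by exact_mod_cast hp.ne_zero
  have hgeom : ∑ k ∈ Ico 1 p, (ψ ^ k) g = (if ∃ h : F, g = h ^ p then (p : ℂ) else 0) - 1 := by
    have h1 : ∑ k ∈ Ico 1 p, (ψ ^ k) g = ∑ k ∈ range p, ψ g ^ k - 1 := by
      rw [range_eq_Ico, sum_eq_sum_Ico_succ_bot hp.pos, pow_zero, add_sub_cancel_left]
      refine sum_congr rfl fun k hk => ?_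
      rw [ψ.pow_apply' (by have := (mem_Ico.mp hk).1; omega)]
    rw [h1]
    congr 1
    have hiff := mulChar_apply_eq_one_iff hψ hg
    by_cases h : ∃ y : F, g = y ^ p
    · rw [if_pos h]
      simp [hiff.mpr h]
    · rw [if_neg h]
      have h2 := mul_geom_sum (ψ g) p
      rw [ψ.apply_pow_of_pow_eq_one (hψ ▸ pow_orderOf_eq_one ψ) hg, sub_self] at h2
      exact (mul_eq_zero.mp h2).resolve_left (sub_ne_zero.mpr (mt hiff.mp h))
  rw [hgeom, MulChar.one_apply (Ne.isUnit hg)]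
  simp only [nonPowInd, forall_mem_insert]
  by_cases h : ∃ y : F, g = y ^ p
  · rw [if_neg (fun h' => h'.2.1 h), if_pos h]
    field_simp
    ring
  · rw [if_neg h]
    simp only [hg, h, ne_eq, not_false_eq_true, true_and]
    ring

theorem exists_mulChar_expansion (P : Finset ℕ) (hP : ∀ p ∈ P, p.Prime ∧ p ∣ Fintype.card F - 1)
    [Fintype (MulChar F ℂ)] :
    ∃ c : MulChar F ℂ → ℂ,
      (∀ g, nonPowInd P g = (∏ p ∈ P, (1 - 1 / (p : ℂ))) * ∑ χ, c χ * χ g) ∧ c 1 = 1 ∧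
      ∑ χ, ‖c χ‖ ≤ 2 ^ #P ∧ ∀ χ, c χ ≠ 0 → χ ^ (∏ p ∈ P, p) = 1 := by
  classical
  induction P using Finset.induction_on with
  | empty =>
    refine ⟨fun χ => if χ = 1 then 1 else 0, fun g => ?_, if_pos rfl, ?_, fun χ hχ => ?_⟩
    · by_cases hg : g = 0
      · simp [nonPowInd, hg, MulChar.map_zero]
      · simp [nonPowInd, hg, MulChar.one_apply (Ne.isUnit hg)]
    · simp [apply_ite norm]
    · have : χ = 1 := by by_contra h; simp [h] at hχ
      simp [this]
  | insert p P hpP ih =>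
    obtain ⟨c, hc, hc1, hcn, hcs⟩ := ih fun p hp => hP p (mem_insert_of_mem hp)
    obtain ⟨hp, hpq⟩ := hP p (mem_insert_self _ _)
    obtain ⟨ψ, hψ, hind⟩ := exists_mulChar_nonPowInd_insert hp hpq
    have hp1 : (0 : ℝ) < p - 1 := by
      have : (2 : ℝ) ≤ p := by exact_mod_cast hp.two_le
      linarith
    have hp1c : (p : ℂ) - 1 ≠ 0 := by
      have : (((p : ℝ) - 1 : ℝ) : ℂ) ≠ 0 := by exact_mod_cast hp1.ne'
      simpa using this
    have hp0 : (p : ℂ) ≠ 0 := by exact_mod_cast hp.ne_zero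
    have hcard : #(Ico 1 p) = p - 1 := Nat.card_Ico 1 p
    refine ⟨fun χ => c χ - 1 / ((p : ℂ) - 1) * ∑ k ∈ Ico 1 p, c (χ * (ψ ^ k)⁻¹), ?_, ?_, ?_, ?_⟩
    · intro g
      have hmul : ∀ k, (∑ χ, c χ * χ g) * (ψ ^ k) g = ∑ χ, c (χ * (ψ ^ k)⁻¹) * χ g := by
        intro k
        rw [← Equiv.sum_comp (Equiv.mulRight (ψ ^ k)) (fun χ => c (χ * (ψ ^ k)⁻¹) * χ g), sum_mul]
        refine sum_congr rfl fun χ _ => ?_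
        simp only [Equiv.coe_mulRight, mul_inv_cancel_right, MulChar.mul_apply]
        ring
      have hone : (∑ χ, c χ * χ g) * (1 : MulChar F ℂ) g = ∑ χ, c χ * χ g := by
        rw [sum_mul]
        refine sum_congr rfl fun χ _ => ?_
        rw [mul_assoc, ← MulChar.mul_apply, mul_one]
      have hR : ∑ χ, (c χ - 1 / ((p : ℂ) - 1) * ∑ k ∈ Ico 1 p, c (χ * (ψ ^ k)⁻¹)) * χ g
          = ∑ χ, c χ * χ g - 1 / ((p : ℂ) - 1) * ∑ k ∈ Ico 1 p, (∑ χ, c χ * χ g) * (ψ ^ k) g := by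
        simp only [hmul, sub_mul, sum_sub_distrib]
        congr 1
        rw [sum_comm, mul_sum]
        refine sum_congr rfl fun χ _ => ?_
        rw [mul_assoc, sum_mul]
      rw [hR, hind, hc, prod_insert hpP, ← mul_sum]
      set s₁ := ∑ χ, c χ * χ g
      set s₂ := ∑ k ∈ Ico 1 p, (ψ ^ k) g
      set Θ := ∏ p ∈ P, (1 - 1 / (p : ℂ))
      have h1 : (1 - 1 / (p : ℂ)) * (1 / ((p : ℂ) - 1)) = 1 / p := by field_simp
      linear_combination Θ * (1 - 1 / (p : ℂ)) * hone + Θ * s₁ * s₂ * h1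
    · have h0 : ∀ k ∈ Ico 1 p, c (1 * (ψ ^ k)⁻¹) = 0 := by
        intro k hk
        by_contra hne
        have h := hcs _ hne
        rw [one_mul, inv_pow, inv_eq_one, ← pow_mul] at h
        have hdvd := orderOf_dvd_of_pow_eq_one h
        rw [hψ] at hdvd
        rw [mem_Ico] at hk
        rcases hp.dvd_mul.mp hdvd with h1 | h1
        · exact absurd (Nat.le_of_dvd (by omega) h1) (by omega)
        · obtain ⟨r, hr, hpr⟩ := (hp.prime.dvd_finsetProd_iff _).mp h1
          rw [Nat.prime_dvd_prime_iff_eq hp (hP r (mem_insert_of_mem hr)).1] at hpr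
          exact hpP (hpr ▸ hr)
      simp only [sum_eq_zero h0, hc1, mul_zero, sub_zero]
    · have hshift : ∀ k, ∑ χ, ‖c (χ * (ψ ^ k)⁻¹)‖ = ∑ χ, ‖c χ‖ := fun k =>
        Equiv.sum_comp (Equiv.mulRight (ψ ^ k)⁻¹) fun χ => ‖c χ‖
      have hn : ‖1 / ((p : ℂ) - 1)‖ = 1 / ((p : ℝ) - 1) := by
        rw [← Complex.ofReal_natCast, ← Complex.ofReal_one, ← Complex.ofReal_sub,
          ← Complex.ofReal_div, Complex.norm_real, Real.norm_of_nonneg (by positivity)]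
      calc ∑ χ, ‖c χ - 1 / ((p : ℂ) - 1) * ∑ k ∈ Ico 1 p, c (χ * (ψ ^ k)⁻¹)‖
          ≤ ∑ χ, (‖c χ‖ + 1 / ((p : ℝ) - 1) * ∑ k ∈ Ico 1 p, ‖c (χ * (ψ ^ k)⁻¹)‖) := by
            refine sum_le_sum fun χ _ => (norm_sub_le _ _).trans ?_
            rw [norm_mul, hn]
            gcongr
            exact norm_sum_le _ _
        _ = 2 * ∑ χ, ‖c χ‖ := by
            rw [sum_add_distrib, ← mul_sum, sum_comm, sum_congr rfl fun k _ => hshift k, sum_const,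
              hcard, nsmul_eq_mul, Nat.cast_sub hp.one_le, Nat.cast_one]
            field_simp
            ring
        _ ≤ 2 ^ #(insert p P) := by
            rw [card_insert_of_notMem hpP, pow_succ]
            linarith
    · intro χ hχ
      rw [prod_insert hpP]
      by_cases h1 : c χ = 0
      · have h2 : ∃ k ∈ Ico 1 p, c (χ * (ψ ^ k)⁻¹) ≠ 0 := by
          by_contra! h2
          exact hχ (by simp only [h1, sum_eq_zero h2, mul_zero, sub_zero])
        obtain ⟨k, -, hk⟩ := h2
        have h3 := congrArg (· ^ p) (hcs _ hk)
        simp only [one_pow, ← pow_mul, mul_pow, inv_pow] at h3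
        have h4 : ψ ^ (k * (∏ p ∈ P, p) * p) = 1 := by
          rw [← orderOf_dvd_iff_pow_eq_one, hψ]
          exact Dvd.intro_left _ rfl
        rw [h4, inv_one, mul_one] at h3
        rwa [mul_comm]
      · rw [mul_comm, pow_mul, hcs _ h1, one_pow]

end

section

theorem norm_sum_mul_mul_le {ι : Type*} [Fintype ι] {c : ι → ℂ} {i₀ : ι} (hc : c i₀ = 1) {w : ℝ}
    (hw : ∑ i, ‖c i‖ ≤ w) {T : ι → ι → ℂ} {B₁ B₂ : ℝ} (hB₁ : 0 ≤ B₁) (hB₂ : 0 ≤ B₂)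
    (hT₁ : ∀ j, c j ≠ 0 → ‖T i₀ j‖ ≤ B₁) (hT₂ : ∀ i j, i ≠ i₀ → c j ≠ 0 → ‖T i j‖ ≤ B₂) :
    ‖∑ i, ∑ j, c i * c j * T i j‖ ≤ w * (B₁ + (w - 1) * B₂) := by
  classical
  have hw0 : 0 ≤ w := (sum_nonneg fun i _ => norm_nonneg (c i)).trans hw
  have hrow : ∀ i (B : ℝ), 0 ≤ B → (∀ j, c j ≠ 0 → ‖T i j‖ ≤ B) →
      ‖∑ j, c i * c j * T i j‖ ≤ ‖c i‖ * (w * B) := by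
    intro i B hB hT
    calc ‖∑ j, c i * c j * T i j‖ ≤ ∑ j, ‖c i * c j * T i j‖ := norm_sum_le _ _
      _ ≤ ∑ j, ‖c i‖ * (‖c j‖ * B) := by
          refine sum_le_sum fun j _ => ?_
          rw [norm_mul, norm_mul, mul_assoc]
          gcongr ?_ * ?_
          by_cases hj : c j = 0
          · simp [hj]
          · gcongr
            exact hT j hj
      _ ≤ ‖c i‖ * (w * B) := by
          rw [← mul_sum, ← sum_mul]
          gcongr
  have hsplit : ‖c i₀‖ + ∑ i ∈ univ.erase i₀, ‖c i‖ = ∑ i, ‖c i‖ :=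
    add_sum_erase univ (fun i => ‖c i‖) (mem_univ i₀)
  rw [hc, norm_one] at hsplit
  calc ‖∑ i, ∑ j, c i * c j * T i j‖ ≤ ∑ i, ‖∑ j, c i * c j * T i j‖ := norm_sum_le _ _
    _ = ‖∑ j, c i₀ * c j * T i₀ j‖ + ∑ i ∈ univ.erase i₀, ‖∑ j, c i * c j * T i j‖ :=
        (add_sum_erase univ (fun i => ‖∑ j, c i * c j * T i j‖) (mem_univ i₀)).symm
    _ ≤ ‖c i₀‖ * (w * B₁) + ∑ i ∈ univ.erase i₀, ‖c i‖ * (w * B₂) :=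
        add_le_add (hrow i₀ B₁ hB₁ hT₁)
          (sum_le_sum fun i hi => hrow i B₂ hB₂ fun j => hT₂ i j (ne_of_mem_erase hi))
    _ = w * (B₁ + (∑ i ∈ univ.erase i₀, ‖c i‖) * B₂) := by
        rw [hc, norm_one, ← sum_mul]
        ring
    _ ≤ w * (B₁ + (w - 1) * B₂) := by
        gcongr
        linarith

variable {F : Type*} [Field F] [Fintype F]

theorem norm_sum_nonPowInd_insert_sub_le (u v : F → F) {P : Finset ℕ}
    (hP : ∀ p ∈ P, p.Prime ∧ p ∣ Fintype.card F - 1) {l : ℕ} (hl : l.Prime)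
    (hlq : l ∣ Fintype.card F - 1) (hlP : l ∉ P) {B₁ B₂ : ℝ} (hB₁ : 0 ≤ B₁) (hB₂ : 0 ≤ B₂)
    (h₁ : ∀ φ : MulChar F ℂ, φ ≠ 1 → ‖∑ g, (1 : MulChar F ℂ) (u g) * φ (v g)‖ ≤ B₁)
    (h₂ : ∀ χ φ : MulChar F ℂ, χ ≠ 1 → φ ≠ 1 → ‖∑ g, χ (u g) * φ (v g)‖ ≤ B₂) :
    ‖∑ g, nonPowInd P (u g) * nonPowInd (insert l P) (v g)
        - (1 - 1 / (l : ℂ)) * ∑ g, nonPowInd P (u g) * nonPowInd P (v g)‖ ≤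
      (1 - 1 / (l : ℝ)) * (∏ p ∈ P, (1 - 1 / (p : ℝ))) ^ 2 *
        (2 ^ #P * (B₁ + (2 ^ #P - 1) * B₂)) := by
  classical
  have := Fintype.ofFinite (MulChar F ℂ)
  obtain ⟨c, hc, hc1, hcn, hcs⟩ := exists_mulChar_expansion P hP
  obtain ⟨ψ, hψ, hind⟩ := exists_mulChar_nonPowInd_insert hl hlq
  have hl0 : (0 : ℝ) < l := by exact_mod_cast hl.pos
  have hone (x : F) : nonPowInd P x * (1 : MulChar F ℂ) x = nonPowInd P x := by
    by_cases hx : x = 0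
    · simp [nonPowInd, hx]
    · rw [MulChar.one_apply (Ne.isUnit hx), mul_one]
  have hne : ∀ k ∈ Ico 1 l, ∀ η, c η ≠ 0 → η * ψ ^ k ≠ 1 := by
    intro k hk η hη h
    have h0 := congrArg (· ^ ∏ p ∈ P, p) h
    simp only [mul_pow, hcs η hη, one_mul, one_pow, ← pow_mul] at h0
    have hdvd := orderOf_dvd_of_pow_eq_one h0
    rw [hψ] at hdvd
    rw [mem_Ico] at hk
    rcases hl.dvd_mul.mp hdvd with h1 | h1
    · exact absurd (Nat.le_of_dvd (by omega) h1) (by omega)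
    · obtain ⟨r, hr, hlr⟩ := (hl.prime.dvd_finsetProd_iff _).mp h1
      rw [Nat.prime_dvd_prime_iff_eq hl (hP r hr).1] at hlr
      exact hlP (hlr ▸ hr)
  have hdiff : ∑ g, nonPowInd P (u g) * nonPowInd (insert l P) (v g)
        - (1 - 1 / (l : ℂ)) * ∑ g, nonPowInd P (u g) * nonPowInd P (v g)
      = -(((1 / l : ℝ) * (∏ p ∈ P, (1 - 1 / (p : ℝ))) ^ 2 : ℝ) : ℂ) * ∑ k ∈ Ico 1 l,
        ∑ χ, ∑ η, c χ * c η * ∑ g, χ (u g) * (η * ψ ^ k) (v g) := by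
    have hk : ∀ k, (((∏ p ∈ P, (1 - 1 / (p : ℝ))) ^ 2 : ℝ) : ℂ) *
          ∑ χ, ∑ η, c χ * c η * ∑ g, χ (u g) * (η * ψ ^ k) (v g)
        = ∑ g, nonPowInd P (u g) * nonPowInd P (v g) * (ψ ^ k) (v g) := by
      intro k
      have hg : ∀ g, nonPowInd P (u g) * nonPowInd P (v g) * (ψ ^ k) (v g)
          = (((∏ p ∈ P, (1 - 1 / (p : ℝ))) ^ 2 : ℝ) : ℂ) *
            ∑ χ, ∑ η, c χ * c η * (χ (u g) * (η * ψ ^ k) (v g)) := by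
        intro g
        rw [hc, hc]
        push_cast
        have : ∑ χ, ∑ η, c χ * c η * (χ (u g) * (η * ψ ^ k) (v g))
            = (∑ χ, c χ * χ (u g)) * (∑ η, c η * η (v g)) * (ψ ^ k) (v g) := by
          rw [sum_mul_sum, sum_mul]
          refine sum_congr rfl fun χ _ => ?_
          rw [sum_mul]
          refine sum_congr rfl fun η _ => ?_
          rw [MulChar.mul_apply]
          ring
        rw [this]
        ring
      simp only [hg]
      symm
      rw [← mul_sum, sum_comm]
      congr 1
      refine sum_congr rfl fun χ _ => ?_
      rw [sum_comm]
      exact sum_congr rfl fun η _ => (mul_sum _ _ _).symm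
    rw [Complex.ofReal_mul, ← neg_mul, mul_assoc, mul_sum (Ico 1 l) _
      (((∏ p ∈ P, (1 - 1 / (p : ℝ))) ^ 2 : ℝ) : ℂ), sum_congr rfl fun k _ => hk k, sum_comm,
      mul_sum, mul_sum, ← sum_sub_distrib]
    refine sum_congr rfl fun g _ => ?_
    rw [hind, ← mul_sum]
    push_cast
    linear_combination (1 - 1 / (l : ℂ)) * nonPowInd P (u g) * hone (v g)
  rw [hdiff, norm_mul, norm_neg, Complex.norm_real, Real.norm_of_nonneg (by positivity)]
  calc 1 / (l : ℝ) * (∏ p ∈ P, (1 - 1 / (p : ℝ))) ^ 2 * ‖∑ k ∈ Ico 1 l,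
        ∑ χ, ∑ η, c χ * c η * ∑ g, χ (u g) * (η * ψ ^ k) (v g)‖
      ≤ 1 / (l : ℝ) * (∏ p ∈ P, (1 - 1 / (p : ℝ))) ^ 2 *
        ∑ k ∈ Ico 1 l, (2 ^ #P * (B₁ + (2 ^ #P - 1) * B₂)) := by
        gcongr
        refine (norm_sum_le _ _).trans (sum_le_sum fun k hk => ?_)
        exact norm_sum_mul_mul_le hc1 hcn hB₁ hB₂ (fun η hη => h₁ _ (hne k hk η hη))
          fun χ η hχ hη => h₂ _ _ hχ (hne k hk η hη)
    _ = _ := by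
        rw [sum_const, Nat.card_Ico, nsmul_eq_mul, Nat.cast_sub hl.one_le, Nat.cast_one]
        field_simp

end

end

/-- **Lemma 4.** Let `e ∣ q − 1`, and let `l` be a prime dividing `q − 1`
but not `e`. Then
`|N(e, le) − θ(l)·N(e,e)| ≤ (1 − 1/l)·θ(e)²·(2·W(e)²·√q − W(e)·(√q − 1))`
and
`|N(le, e) − θ(l)·N(e,e)| ≤ (1 − 1/l)·θ(e)²·(2·W(e)²·√q − 2·W(e)·(√q − 1))`. -/
theorem stmt_7 (F : Type*) [Field F] [Fintype F]
    (a b c : F) (ha : a ≠ 0) (hdisc : b ^ 2 - 4 * a * c ≠ 0)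
    (e : ℕ) (he : e ∣ Fintype.card F - 1)
    (l : ℕ) (hl : l.Prime) (hld : l ∣ Fintype.card F - 1) (hle : ¬ l ∣ e) :
    |(NN a b c e (l * e) : ℝ) - θ l * (NN a b c e e : ℝ)| ≤
        (1 - 1 / (l : ℝ)) * θ e ^ 2 *
          (2 * (W e : ℝ) ^ 2 * Real.sqrt (Fintype.card F) -
            (W e : ℝ) * (Real.sqrt (Fintype.card F) - 1)) ∧
    |(NN a b c (l * e) e : ℝ) - θ l * (NN a b c e e : ℝ)| ≤
        (1 - 1 / (l : ℝ)) * θ e ^ 2 *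
          (2 * (W e : ℝ) ^ 2 * Real.sqrt (Fintype.card F) -
            2 * (W e : ℝ) * (Real.sqrt (Fintype.card F) - 1)) := by
  have hq : 1 < Fintype.card F := Fintype.one_lt_card
  have he0 : e ≠ 0 := fun h => by
    rw [h, zero_dvd_iff] at he
    omega
  have hle0 : l * e ≠ 0 := mul_ne_zero hl.ne_zero he0
  have hP : ∀ p ∈ e.primeFactors, p.Prime ∧ p ∣ Fintype.card F - 1 := fun p hp =>
    ⟨Nat.prime_of_mem_primeFactors hp, (Nat.dvd_of_mem_primeFactors hp).trans he⟩
  have hlP : l ∉ e.primeFactors := fun h => hle (Nat.dvd_of_mem_primeFactors h)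
  have hins : (l * e).primeFactors = insert l e.primeFactors := by
    rw [Nat.primeFactors_mul hl.ne_zero he0, hl.primeFactors, Finset.insert_eq]
  have hθl : θ l = 1 - 1 / (l : ℝ) := by simp [θ, hl.primeFactors]
  have hW : (W e : ℝ) = 2 ^ e.primeFactors.card := by simp [W]
  have hnorm (m n : ℕ) : |(m : ℝ) - θ l * (n : ℝ)| = ‖(m : ℂ) - (1 - 1 / (l : ℂ)) * n‖ := by
    rw [hθl, ← Real.norm_eq_abs, ← Complex.norm_real]
    push_cast
    rfl
  have hs : 0 ≤ Real.sqrt (Fintype.card F) := Real.sqrt_nonneg _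
  rw [hnorm, hnorm, natCast_NN he0 hle0, natCast_NN he0 he0, natCast_NN hle0 he0, hins]
  constructor
  · refine (norm_sum_nonPowInd_insert_sub_le (fun g => g) (fun g => a * g ^ 2 + b * g + c) hP hl
      hld hlP (B₁ := Real.sqrt (Fintype.card F) + 1) (by positivity) (by positivity)
      (fun φ hφ => norm_sum_one_mul_quadratic_le hφ ha hdisc)
      (fun χ φ hχ hφ => norm_sum_mul_quadratic_le hχ hφ ha hdisc)).trans_eq ?_
    rw [hW, θ]
    ring
  · have hcomm (P Q : Finset ℕ) :
        ∑ g, nonPowInd P g * nonPowInd Q (a * g ^ 2 + b * g + c)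
          = ∑ g, nonPowInd Q (a * g ^ 2 + b * g + c) * nonPowInd P g :=
      Finset.sum_congr rfl fun g _ => mul_comm _ _
    rw [hcomm, hcomm]
    refine (norm_sum_nonPowInd_insert_sub_le (fun g => a * g ^ 2 + b * g + c) (fun g => g) hP hl
      hld hlP (B₁ := 2) (by positivity) (B₂ := 2 * Real.sqrt (Fintype.card F)) (by positivity)
      (fun φ hφ => ?_) (fun χ φ hχ hφ => ?_)).trans_eq ?_
    · rw [Finset.sum_congr rfl fun g _ => mul_comm _ _]
      exact norm_sum_mul_one_quadratic_le hφ ha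
    · rw [Finset.sum_congr rfl fun g _ => mul_comm _ _]
      exact norm_sum_mul_quadratic_le hφ hχ ha hdisc
    · rw [hW, θ]
      ring
end
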